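/- arXiv:2209.10264 — 2 statements merged into one kernel-verified Lean document; each statement's English description precedes it below -/
import Mathlib

section
/- Among all octagonal chains with n octagons (n ≥ 3), the linear octagonal chain L_n = O(2,2,...,2) is the unique chain with maximum Kirchhoff index: for every vector w = (w_1,...,w_{n−2}) with each w_i ∈ {0,1,2,3,4} and w ≠ (2,2,...,2), one has Kf(O(w)) < Kf(L_n). -/
/-!  Common definitions: Moore–Penrose pseudoinverse, resistance distance and
Kirchhoff index of a simple graph (unit resistors), weighted electrical networks
(given by a symmetric conductance function), multigraph electrical networks,
and the octagonal chains `O(w)`.  -/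

/-- `M` is a Moore–Penrose pseudoinverse of `A`. -/
def Matrix.IsMoorePenroseInv {n : Type} [Fintype n] (A M : Matrix n n ℝ) : Prop :=
  A * M * A = A ∧ M * A * M = M ∧ (A * M).transpose = A * M ∧ (M * A).transpose = M * A

open Classical in
/-- The Moore–Penrose pseudoinverse of a real square matrix (it exists and is
unique; defined by choice). -/
noncomputable def mpinv {n : Type} [Fintype n] (A : Matrix n n ℝ) : Matrix n n ℝ :=
  if h : ∃ M, A.IsMoorePenroseInv M then h.choose else 0

open Classical in
/-- The (real) Laplacian matrix of a simple graph: degree diagonal minus adjacency. -/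
noncomputable def glap {V : Type} [Fintype V] (G : SimpleGraph V) : Matrix V V ℝ :=
  fun u v =>
    if u = v then ((Finset.univ.filter (fun t => G.Adj u t)).card : ℝ)
    else if G.Adj u v then -1 else 0

/-- Resistance distance `r_G(u,v) = (e_u - e_v)ᵀ L⁺ (e_u - e_v)` in a simple graph,
each edge being a unit resistor. -/
noncomputable def resDist {V : Type} [Fintype V] (G : SimpleGraph V) (u v : V) : ℝ :=
  mpinv (glap G) u u - mpinv (glap G) u v - mpinv (glap G) v u + mpinv (glap G) v v

/-- `r_G(a)`: the sum of the resistance distances between `a` and all other vertices. -/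
noncomputable def resSum {V : Type} [Fintype V] [DecidableEq V] (G : SimpleGraph V) (a : V) : ℝ :=
  ∑ b ∈ Finset.univ.erase a, resDist G a b

/-- The Kirchhoff index: the sum of resistance distances over all unordered pairs. -/
noncomputable def kirchhoff {V : Type} [Fintype V] (G : SimpleGraph V) : ℝ :=
  (∑ u, ∑ v, resDist G u v) / 2

/-- A weighted graph (electrical network) on `V`, recorded by its symmetric
conductance function: `cond u v` is the reciprocal of the resistance of the edge
`uv` (and `0` if there is no such edge). -/
structure Network (V : Type) where
  cond : V → V → ℝ
  symm : ∀ u v, cond u v = cond v u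
  nonneg : ∀ u v, 0 ≤ cond u v
  loopless : ∀ v, cond v v = 0

/-- The weighted Laplacian of a network. -/
noncomputable def Network.lap {V : Type} [Fintype V] [DecidableEq V] (N : Network V) :
    Matrix V V ℝ :=
  fun u v => if u = v then ∑ t, N.cond u t else -N.cond u v

/-- Effective resistance in a network, via the pseudoinverse of the weighted Laplacian. -/
noncomputable def Network.effRes {V : Type} [Fintype V] [DecidableEq V] (N : Network V)
    (u v : V) : ℝ :=
  mpinv N.lap u u - mpinv N.lap u v - mpinv N.lap v u + mpinv N.lap v v

/-- The underlying simple graph of a network. -/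
def Network.toGraph {V : Type} (N : Network V) : SimpleGraph V :=
  SimpleGraph.fromRel (fun u v => N.cond u v ≠ 0)

/-- An electrical network with multiple edges allowed: a finite edge type, each edge a
non-loop with two endpoints and a positive resistance. -/
structure MultiNetwork (V : Type) where
  E : Type
  [fE : Fintype E]
  ends : E → Sym2 V
  not_loop : ∀ e, ¬ (ends e).IsDiag
  res : E → ℝ
  res_pos : ∀ e, 0 < res e

attribute [instance] MultiNetwork.fE

/-- Total conductance between `u` and `v`: the sum, over all edges joining `u` and `v`,
of the reciprocals of their resistances. -/
noncomputable def MultiNetwork.cond {V : Type} [DecidableEq V] (M : MultiNetwork V)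
    (u v : V) : ℝ :=
  ∑ e ∈ Finset.univ.filter (fun e => M.ends e = s(u, v)), (M.res e)⁻¹

/-- The weighted Laplacian of a multigraph network. -/
noncomputable def MultiNetwork.lap {V : Type} [Fintype V] [DecidableEq V]
    (M : MultiNetwork V) : Matrix V V ℝ :=
  fun u v => if u = v then ∑ t, M.cond u t else -M.cond u v

/-- Effective resistance in a multigraph network. -/
noncomputable def MultiNetwork.effRes {V : Type} [Fintype V] [DecidableEq V]
    (M : MultiNetwork V) (u v : V) : ℝ :=
  mpinv M.lap u u - mpinv M.lap u v - mpinv M.lap v u + mpinv M.lap v v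

/-- The underlying simple graph of a multigraph network. -/
def MultiNetwork.toGraph {V : Type} (M : MultiNetwork V) : SimpleGraph V :=
  SimpleGraph.fromRel (fun u v => ∃ e, M.ends e = s(u, v))

/-!  The octagonal chain `O(w)` with `n` octagons, `w = (w_1, …, w_{n-2})`,
`w_i ∈ {0,1,2,3,4}`.  Its `6n+2` vertices are laid out along the outer boundary
cycle `0, 1, …, 6n+1`: position `0` is the top-left corner, the top boundary runs
rightwards (the top of the octagon `H_i`, `1 ≤ i ≤ n-2`, carries `w_i` inserted
vertices), then the right vertical edge, then the bottom boundary runs leftwards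
back to the bottom-left corner `6n+1`.  The graph is this outer cycle together
with the `n-1` chords `t_k b_k` shared by consecutive octagons. -/

/-- Boundary position of the top vertex `t_k` (`1 ≤ k ≤ n-1`) of the `k`-th shared
vertical edge: `t_k = k + w_1 + ⋯ + w_{k-1}`. -/
def tpos (n : ℕ) (w : Fin (n - 2) → Fin 5) (k : ℕ) : ℕ :=
  k + ∑ j ∈ Finset.univ.filter (fun j : Fin (n - 2) => (j : ℕ) + 1 < k), ((w j : ℕ))

/-- Boundary position of the bottom vertex `b_k` (`1 ≤ k ≤ n-1`) of the `k`-th shared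
vertical edge: `b_k = n + (w_1 + ⋯ + w_{n-2}) + 6 + Σ_{j ≥ k} (5 - w_j)`. -/
def bpos (n : ℕ) (w : Fin (n - 2) → Fin 5) (k : ℕ) : ℕ :=
  n + (∑ j, ((w j : ℕ))) + 6 +
    ∑ j ∈ Finset.univ.filter (fun j : Fin (n - 2) => k ≤ (j : ℕ) + 1), (5 - ((w j : ℕ)))

/-- The octagonal chain `O(w)` with `n` octagons: the outer boundary cycle on
`6n+2` vertices together with the chords `t_k b_k`, `k = 1, …, n-1`. -/
def octChain (n : ℕ) (w : Fin (n - 2) → Fin 5) : SimpleGraph (Fin (6 * n + 2)) :=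
  SimpleGraph.fromRel (fun a b =>
    ((a : ℕ) + 1 = (b : ℕ)) ∨ ((a : ℕ) = 6 * n + 1 ∧ (b : ℕ) = 0) ∨
    ∃ k, 1 ≤ k ∧ k ≤ n - 1 ∧ (a : ℕ) = tpos n w k ∧ (b : ℕ) = bpos n w k)


namespace Oct
open Matrix

lemma exists_mp {n : Type} [Fintype n] (A : Matrix n n ℝ) (hA : A.transpose = A) :
    ∃ M, A.IsMoorePenroseInv M := by
  classical
  have hH : A.IsHermitian := by
    rw [Matrix.IsHermitian, Matrix.conjTranspose_eq_transpose_of_trivial, hA]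
  obtain ⟨U, D, hU1, hU2, hs⟩ : ∃ (U : Matrix n n ℝ) (D : n → ℝ),
      Uᵀ * U = 1 ∧ U * Uᵀ = 1 ∧ A = U * diagonal D * Uᵀ := by
    refine ⟨hH.eigenvectorUnitary, hH.eigenvalues, ?_, ?_, ?_⟩
    · have := Unitary.coe_star_mul_self hH.eigenvectorUnitary
      rwa [Matrix.star_eq_conjTranspose, Matrix.conjTranspose_eq_transpose_of_trivial] at this
    · apply mul_eq_one_comm.mp
      have := Unitary.coe_star_mul_self hH.eigenvectorUnitary
      rwa [Matrix.star_eq_conjTranspose, Matrix.conjTranspose_eq_transpose_of_trivial] at this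
    · have := hH.spectral_theorem
      rw [Unitary.conjStarAlgAut_apply, Matrix.star_eq_conjTranspose,
        Matrix.conjTranspose_eq_transpose_of_trivial] at this
      exact this
  have key : ∀ D E : n → ℝ, (U * diagonal D * Uᵀ) * (U * diagonal E * Uᵀ)
      = U * diagonal (fun i => D i * E i) * Uᵀ := by
    intro D E
    calc _ = U * diagonal D * (Uᵀ * U) * diagonal E * Uᵀ := by simp only [Matrix.mul_assoc]
      _ = _ := by rw [hU1, Matrix.mul_one, Matrix.mul_assoc U, diagonal_mul_diagonal]
  have tr : ∀ D : n → ℝ, (U * diagonal D * Uᵀ)ᵀ = U * diagonal D * Uᵀ := by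
    intro D
    rw [transpose_mul, transpose_mul, transpose_transpose, diagonal_transpose, Matrix.mul_assoc]
  refine ⟨U * diagonal (fun i => (D i)⁻¹) * Uᵀ, ?_, ?_, ?_, ?_⟩
  · rw [hs, key, key]
    congr 3; ext i; by_cases h : D i = 0 <;> simp [h]
  · rw [hs, key, key]
    congr 3; ext i; by_cases h : D i = 0 <;> simp [h]
  · rw [hs, key, tr]
  · rw [hs, key, tr]

lemma mpinv_spec {n : Type} [Fintype n] (A : Matrix n n ℝ) (hA : A.transpose = A) :
    A * mpinv A * A = A := by
  have h := exists_mp A hA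
  unfold mpinv
  rw [dif_pos h]
  exact h.choose_spec.1

lemma glap_symm {V : Type} [Fintype V] (G : SimpleGraph V) : (glap G).transpose = glap G := by
  ext u v
  simp only [transpose_apply, glap]
  by_cases h : u = v
  · subst h; rfl
  · rw [if_neg h, if_neg (Ne.symm h)]; by_cases h2 : G.Adj u v
    · rw [if_pos h2, if_pos h2.symm]
    · rw [if_neg h2, if_neg (fun h => h2 h.symm)]

open Classical in
lemma glap_mulVec {V : Type} [Fintype V] (G : SimpleGraph V) (Y : V → ℝ) (u : V) :
    (glap G *ᵥ Y) u = ∑ v, if G.Adj u v then (Y u - Y v) else 0 := by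
  have : ∀ v, glap G u v * Y v = (if u = v then (∑ t, if G.Adj u t then (1:ℝ) else 0) * Y u else 0)
      - if G.Adj u v then Y v else 0 := by
    intro v
    unfold glap
    by_cases h : u = v
    · subst h; simp
    · by_cases h2 : G.Adj u v <;> simp [h, h2]
  simp only [mulVec, dotProduct, this, Finset.sum_sub_distrib, Finset.sum_ite_eq, Finset.mem_univ,
    if_true]
  rw [Finset.sum_mul, ← Finset.sum_sub_distrib]
  refine Finset.sum_congr rfl fun v _ => ?_
  split_ifs <;> simp

open Classical in
lemma resDist_of_weak {V : Type} [Fintype V] (G : SimpleGraph V) (Y : V → ℝ) (u v : V)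
    (h : ∀ ψ : V → ℝ, (∑ a, ∑ b, if G.Adj a b then (ψ a - ψ b) * (Y a - Y b) else 0)
      = 2 * (ψ u - ψ v)) : resDist G u v = Y u - Y v := by
  have hw : ∀ ψ : V → ℝ, ψ ⬝ᵥ (glap G *ᵥ Y) = ψ u - ψ v := by
    intro ψ
    have e1 : ψ ⬝ᵥ (glap G *ᵥ Y) = ∑ a, ∑ b, if G.Adj a b then ψ a * (Y a - Y b) else 0 := by
      simp only [dotProduct, glap_mulVec, Finset.mul_sum, mul_ite, mul_zero]
    have e2 : ψ ⬝ᵥ (glap G *ᵥ Y) = ∑ a, ∑ b, if G.Adj a b then - ψ b * (Y a - Y b) else 0 := by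
      rw [e1, Finset.sum_comm]
      refine Finset.sum_congr rfl fun a _ => Finset.sum_congr rfl fun b _ => ?_
      simp only [G.adj_comm b a]
      split_ifs <;> ring
    have e3 : 2 * (ψ ⬝ᵥ (glap G *ᵥ Y)) = 2 * (ψ u - ψ v) := by
      rw [← h ψ, two_mul]
      nth_rewrite 1 [e1]
      rw [e2, ← Finset.sum_add_distrib]
      refine Finset.sum_congr rfl fun a _ => ?_
      rw [← Finset.sum_add_distrib]
      refine Finset.sum_congr rfl fun b _ => ?_
      split_ifs <;> ring
    linarith
  set φ : V → ℝ := Pi.single u 1 - Pi.single v 1 with hφ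
  have hd : ∀ ψ : V → ℝ, ψ ⬝ᵥ φ = ψ u - ψ v := by
    intro ψ; simp [hφ, dotProduct_sub]
  have hLY : glap G *ᵥ Y = φ := by
    ext a
    have h1 := hw (Pi.single a 1)
    rw [← hd] at h1
    simpa using h1
  have h1 : φ ⬝ᵥ (mpinv (glap G) *ᵥ φ) = Y ⬝ᵥ φ := by
    nth_rewrite 1 [← hLY]
    rw [← vecMul_transpose, glap_symm, ← dotProduct_mulVec, ← hLY, mulVec_mulVec, mulVec_mulVec,
      mpinv_spec _ (glap_symm G)]
  rw [hd] at h1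
  rw [← h1, hφ]
  unfold resDist
  simp [mulVec_sub, sub_dotProduct, dotProduct_sub, mulVec_single]
  ring

end Oct

namespace Oct
open Finset

def TT (a : ℕ → ℕ) (k : ℕ) : ℕ := ∑ i ∈ range k, a i

lemma TT_succ (a : ℕ → ℕ) (k : ℕ) : TT a (k+1) = TT a k + a k := by
  simp [TT, sum_range_succ]

lemma TT_zero (a : ℕ → ℕ) : TT a 0 = 0 := by simp [TT]

lemma TT_mono (a : ℕ → ℕ) (ha : ∀ i, 1 ≤ a i) {k l : ℕ} (h : k ≤ l) :
    TT a k + (l - k) ≤ TT a l := by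
  induction l, h using Nat.le_induction with
  | base => simp
  | succ l hl ih => rw [TT_succ]; have := ha l; omega

lemma TT_lip (a : ℕ → ℕ) (ha : ∀ i, a i ≤ 5) {k l : ℕ} (h : k ≤ l) :
    TT a l ≤ TT a k + 5 * (l - k) := by
  induction l, h using Nat.le_induction with
  | base => simp
  | succ l hl ih => rw [TT_succ]; have := ha l; omega

def BB (n : ℕ) (a : ℕ → ℕ) (k : ℕ) : ℕ := TT a k + (6 * n + 1 - 6 * k)

def pp (n : ℕ) (a : ℕ → ℕ) (k x : ℕ) : ℝ := ((min (x - TT a k) (6 * n + 1 - 6 * k) : ℕ) : ℝ)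

def adjP (n : ℕ) (a : ℕ → ℕ) (x y : ℕ) : Prop :=
  x + 1 = y ∨ ∃ k, k < n ∧ x = TT a k ∧ y = BB n a k

lemma pp_succ (n : ℕ) (a : ℕ → ℕ) (k x : ℕ) :
    pp n a k (x+1) - pp n a k x = if TT a k ≤ x ∧ x < BB n a k then 1 else 0 := by
  unfold pp BB
  split_ifs with h
  · have : min (x + 1 - TT a k) (6 * n + 1 - 6 * k) = min (x - TT a k) (6 * n + 1 - 6 * k) + 1 := by
      omega
    rw [this]; push_cast; ring
  · have : min (x + 1 - TT a k) (6 * n + 1 - 6 * k) = min (x - TT a k) (6 * n + 1 - 6 * k) := by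
      omega
    rw [this]; ring

lemma tel (ψ : ℕ → ℝ) (m x y : ℕ) (hxy : x ≤ y) (hy : y ≤ m) :
    ∑ e ∈ range m, (ψ (e+1) - ψ e) * (if x ≤ e ∧ e < y then 1 else 0) = ψ y - ψ x := by
  simp only [mul_ite, mul_one, mul_zero]
  rw [← sum_filter, ← Finset.sum_Ico_sub ψ hxy]
  refine sum_congr ?_ fun _ _ => rfl
  ext e; simp; omega

lemma abel (c z D : ℕ → ℝ) (hc0 : c 0 = z 0) (hc : ∀ k, c (k+1) = z (k+1) - z k) (m : ℕ) :
    ∑ k ∈ range (m+1), c k * D k = ∑ k ∈ range m, z k * (D k - D (k+1)) + z m * D m := by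
  induction m with
  | zero => simp [hc0]
  | succ m ih => rw [sum_range_succ, ih, hc, sum_range_succ (fun k => z k * (D k - D (k+1)))]; ring

/-- The face count. -/
def PP (n : ℕ) (a : ℕ → ℕ) (k x : ℕ) : ℝ := pp n a k x - if k + 1 < n then pp n a (k+1) x else 0

lemma pp_overlap (n : ℕ) (a : ℕ → ℕ) (ha1 : ∀ i, 1 ≤ a i) (ha5 : ∀ i, a i ≤ 5) (k l : ℕ)
    (hk : k < n) (hl : l < n) :
    pp n a l (BB n a k) - pp n a l (TT a k) = 6 * n + 1 - 6 * (max k l : ℕ) := by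
  unfold pp BB
  have h2 : min (TT a k + (6 * n + 1 - 6 * k) - TT a l) (6 * n + 1 - 6 * l)
     = min (TT a k - TT a l) (6 * n + 1 - 6 * l) + (6 * n + 1 - 6 * (max k l)) := by
    rcases le_total k l with h | h
    · have := TT_mono a ha1 h
      have := TT_lip a ha5 h
      rw [max_eq_right h]; omega
    · have := TT_mono a ha1 h
      have := TT_lip a ha5 h
      rw [max_eq_left h]; omega
  rw [h2]
  have : 6 * max k l ≤ 6 * n + 1 := by rcases le_total k l with h | h <;> simp [h] <;> omega
  push_cast [Nat.cast_sub this]; ring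

lemma weak_sol (n : ℕ) (hn : 1 ≤ n) (a : ℕ → ℕ) (ha1 : ∀ i, 1 ≤ a i) (ha5 : ∀ i, a i ≤ 5)
    (x y : ℕ) (hxy : x ≤ y) (hy : y < 6 * n + 2) (z : ℕ → ℝ)
    (hz : ∀ k, k < n → 8 * z k - (if k = 0 then 0 else z (k-1)) - (if k + 1 < n then z (k+1) else 0)
      = PP n a k y - PP n a k x) :
    ∃ Y : ℕ → ℝ, (Y y - Y x = (y - x : ℝ) - ∑ k ∈ range n, z k * (PP n a k y - PP n a k x)) ∧
      ∀ ψ : ℕ → ℝ, ∑ e ∈ range (6 * n + 1), (ψ (e+1) - ψ e) * (Y (e+1) - Y e)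
        + ∑ k ∈ range n, (ψ (BB n a k) - ψ (TT a k)) * (Y (BB n a k) - Y (TT a k)) = ψ y - ψ x := by
  set c : ℕ → ℝ := fun k => z k - (if k = 0 then 0 else z (k-1)) with hc
  have hc0 : c 0 = z 0 := by simp [hc]
  have hcs : ∀ k, c (k+1) = z (k+1) - z k := by intro k; simp [hc]
  have hsum : ∀ k, ∑ l ∈ range (k+1), c l = z k := by
    intro k
    induction k with
    | zero => simp [hc0]
    | succ k ih => rw [sum_range_succ, ih, hcs]; ring
  set D : ℕ → ℝ := fun k => pp n a k y - pp n a k x with hD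
  set S : ℕ → ℝ := fun k => ∑ l ∈ range n, c l * (6 * n + 1 - 6 * (max k l : ℕ)) with hS
  have hSs : ∀ k, k + 1 < n → S k - S (k+1) = 6 * z k := by
    intro k hk
    have e : ∀ l, c l * (6 * n + 1 - 6 * (max k l : ℕ) : ℝ)
        - c l * (6 * n + 1 - 6 * (max (k+1) l : ℕ) : ℝ) = if l < k + 1 then 6 * c l else 0 := by
      intro l
      split_ifs with h
      · rw [max_eq_left (by omega), max_eq_left (by omega)]; push_cast; ring
      · rw [max_eq_right (by omega), max_eq_right (by omega)]; ring
    simp only [hS]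
    rw [← sum_sub_distrib, sum_congr rfl (fun l _ => e l), ← sum_filter, ← hsum k, mul_sum]
    refine sum_congr ?_ fun _ _ => rfl
    ext l; simp; omega
  have hSl : S (n-1) = 7 * z (n-1) := by
    simp only [hS]
    obtain ⟨m, rfl⟩ : ∃ m, n = m + 1 := ⟨n-1, by omega⟩
    simp only [Nat.add_sub_cancel]
    rw [← hsum m, mul_sum]
    refine sum_congr rfl fun l hl => ?_
    rw [max_eq_left (by simp at hl; omega)]; push_cast; ring
  have hPP : ∀ k, k + 1 < n → PP n a k y - PP n a k x = D k - D (k+1) := by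
    intro k hk; simp only [PP, if_pos hk, hD]; ring
  have hPPl : PP n a (n-1) y - PP n a (n-1) x = D (n-1) := by
    simp only [PP, hD]; rw [if_neg (by omega), if_neg (by omega)]; ring
  have claim : ∀ j, j < n → c (n-1-j) + S (n-1-j) = D (n-1-j) := by
    intro j
    induction j with
    | zero =>
      intro _
      have := hz (n-1) (by omega)
      rw [hPPl, if_neg (show ¬ (n - 1 + 1 < n) by omega)] at this
      simp only [Nat.sub_zero]; rw [hSl, ← this]; simp only [hc]; ring
    | succ j ih =>
      intro hj
      have ih := ih (by omega)
      obtain ⟨k, hk⟩ : ∃ k, n - 1 - (j+1) = k := ⟨_, rfl⟩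
      have hk' : n - 1 - j = k + 1 := by omega
      rw [hk'] at ih; rw [hk]
      have h1 := hz k (by omega)
      rw [hPP k (by omega), if_pos (show k + 1 < n by omega)] at h1
      have h2 := hSs k (by omega)
      have h3 := hcs k
      have h4 : c k = z k - (if k = 0 then 0 else z (k-1)) := rfl
      linarith
  have claim' : ∀ k, k < n → c k + S k = D k := by
    intro k hk
    have := claim (n-1-k) (by omega)
    rwa [show n - 1 - (n - 1 - k) = k by omega] at this
  set Y : ℕ → ℝ := fun s => ((min s y : ℕ) : ℝ) - ((min s x : ℕ) : ℝ) - ∑ k ∈ range n, c k * pp n a k s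
    with hY
  refine ⟨Y, ?_, ?_⟩
  · have e1 : Y y - Y x = (y - x : ℝ) - ∑ k ∈ range n, c k * D k := by
      simp only [hY, hD, mul_sub, sum_sub_distrib]
      rw [min_self, min_self, min_eq_right hxy, min_eq_left hxy]; ring
    rw [e1]
    congr 1
    obtain ⟨m, rfl⟩ : ∃ m, n = m + 1 := ⟨n-1, by omega⟩
    rw [abel c z D hc0 hcs m, sum_range_succ]
    congr 1
    · refine sum_congr rfl fun k hk => ?_
      rw [hPP k (by simp at hk; omega)]
    · simp only [Nat.add_sub_cancel] at hPPl
      rw [hPPl]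
  · intro ψ
    have hdY : ∀ e, Y (e+1) - Y e = (if x ≤ e ∧ e < y then 1 else 0)
        - ∑ k ∈ range n, c k * (if TT a k ≤ e ∧ e < BB n a k then 1 else 0) := by
      intro e
      have : Y (e+1) - Y e = (((min (e+1) y : ℕ) : ℝ) - ((min (e+1) x : ℕ) : ℝ)
          - (((min e y : ℕ) : ℝ) - ((min e x : ℕ) : ℝ)))
          - ∑ k ∈ range n, c k * (pp n a k (e+1) - pp n a k e) := by
        simp only [hY, mul_sub, sum_sub_distrib]; ring
      rw [this]
      simp only [pp_succ]
      congr 1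
      split_ifs with h
      · rw [min_eq_left (show e + 1 ≤ y by omega), min_eq_left (show e ≤ y by omega),
          min_eq_right (show x ≤ e + 1 by omega), min_eq_right (show x ≤ e by omega)]
        push_cast; ring
      · rcases Nat.lt_or_ge e x with h1 | h1
        · rw [min_eq_left (show e + 1 ≤ y by omega), min_eq_left (show e ≤ y by omega),
            min_eq_left (show e + 1 ≤ x by omega), min_eq_left (show e ≤ x by omega)]
          ring
        · rw [min_eq_right (show y ≤ e + 1 by omega), min_eq_right (show y ≤ e by omega),
            min_eq_right (show x ≤ e + 1 by omega), min_eq_right (show x ≤ e by omega)]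
          ring
    have hYB : ∀ k, k < n → Y (BB n a k) - Y (TT a k) = c k := by
      intro k hk
      have e1 : Y (BB n a k) - Y (TT a k) = ((((min (BB n a k) y : ℕ) : ℝ) - ((min (BB n a k) x : ℕ) : ℝ))
          - (((min (TT a k) y : ℕ) : ℝ) - ((min (TT a k) x : ℕ) : ℝ)))
          - ∑ l ∈ range n, c l * (pp n a l (BB n a k) - pp n a l (TT a k)) := by
        simp only [hY, mul_sub, sum_sub_distrib]; ring
      have e2 : ∑ l ∈ range n, c l * (pp n a l (BB n a k) - pp n a l (TT a k)) = S k := by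
        refine sum_congr rfl fun l hl => ?_
        rw [pp_overlap n a ha1 ha5 k l hk (by simpa using hl)]
      have e3 : ((((min (BB n a k) y : ℕ) : ℝ) - ((min (BB n a k) x : ℕ) : ℝ))
          - (((min (TT a k) y : ℕ) : ℝ) - ((min (TT a k) x : ℕ) : ℝ))) = D k := by
        simp only [hD, pp]
        have f : ∀ s, min (BB n a k) s = min (TT a k) s + min (s - TT a k) (6 * n + 1 - 6 * k) := by
          intro s; unfold BB; omega
        rw [f, f]; push_cast; ring
      rw [e1, e2, e3, ← claim' k hk]; ring
    have hB : ∀ k, k < n → BB n a k ≤ 6 * n + 1 ∧ TT a k ≤ BB n a k := by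
      intro k hk
      have := TT_lip a ha5 (Nat.zero_le k)
      rw [TT_zero] at this
      unfold BB; omega
    have e4 : ∑ e ∈ range (6 * n + 1), (ψ (e+1) - ψ e) * (Y (e+1) - Y e) = (ψ y - ψ x)
        - ∑ k ∈ range n, c k * (ψ (BB n a k) - ψ (TT a k)) := by
      simp only [hdY, mul_sub, sum_sub_distrib]
      have := tel ψ (6*n+1) x y hxy (by omega)
      rw [this]
      congr 1
      simp only [mul_sum]
      rw [sum_comm, ← sum_sub_distrib]
      refine sum_congr rfl fun k hk => ?_
      have hk := hB k (by simpa using hk)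
      have := tel ψ (6*n+1) (TT a k) (BB n a k) hk.2 hk.1
      rw [← mul_sub, ← this, mul_sum]
      refine sum_congr rfl fun e _ => by ring
    rw [e4]
    have e5 : ∑ k ∈ range n, (ψ (BB n a k) - ψ (TT a k)) * (Y (BB n a k) - Y (TT a k))
       = ∑ k ∈ range n, c k * (ψ (BB n a k) - ψ (TT a k)) := by
      refine sum_congr rfl fun k hk => ?_
      rw [hYB k (by simpa using hk)]; ring
    rw [e5]; ring

end Oct

namespace Oct
open Finset

lemma adjP_lt {n : ℕ} {a : ℕ → ℕ} {x y : ℕ} (h : adjP n a x y) : x < y := by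
  rcases h with h | ⟨k, hk, rfl, rfl⟩
  · omega
  · unfold BB; omega

lemma TT_inj (a : ℕ → ℕ) (ha1 : ∀ i, 1 ≤ a i) {k l : ℕ} (h : TT a k = TT a l) : k = l := by
  rcases le_total k l with h1 | h1
  · have := TT_mono a ha1 h1; omega
  · have := TT_mono a ha1 h1; omega

open Classical in
lemma adjP_ind (n : ℕ) (a : ℕ → ℕ) (ha1 : ∀ i, 1 ≤ a i) (x y : ℕ) :
    (if adjP n a x y then (1:ℝ) else 0) = (if x + 1 = y then 1 else 0)
      + ∑ k ∈ range n, (if x = TT a k ∧ y = BB n a k then 1 else 0) := by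
  by_cases h : ∃ k, k < n ∧ x = TT a k ∧ y = BB n a k
  · have hA : adjP n a x y := Or.inr h
    obtain ⟨k, hk, rfl, rfl⟩ := h
    have h1 : ¬ (TT a k + 1 = BB n a k) := by unfold BB; omega
    rw [if_pos hA, if_neg h1, sum_eq_single_of_mem k (by simpa using hk)]
    · simp
    · intro l _ hl
      rw [if_neg]
      rintro ⟨h2, _⟩
      exact hl (TT_inj a ha1 h2).symm
  · have h0 : ∑ k ∈ range n, (if x = TT a k ∧ y = BB n a k then (1:ℝ) else 0) = 0 := by
      refine sum_eq_zero fun k hk => ?_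
      rw [if_neg]
      intro h2
      exact h ⟨k, by simpa using hk, h2⟩
    rw [h0, add_zero]
    unfold adjP
    simp only [h, or_false]

open Classical in
lemma edge_sum_dir (n : ℕ) (a : ℕ → ℕ) (ha1 : ∀ i, 1 ≤ a i) (ha5 : ∀ i, a i ≤ 5)
    (g : ℕ → ℕ → ℝ) :
    ∑ x ∈ range (6*n+2), ∑ y ∈ range (6*n+2), (if adjP n a x y then g x y else 0)
      = ∑ e ∈ range (6*n+1), g e (e+1) + ∑ k ∈ range n, g (TT a k) (BB n a k) := by
  have e1 : ∀ x y, (if adjP n a x y then g x y else 0) = (if x + 1 = y then g x y else 0)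
      + ∑ k ∈ range n, (if x = TT a k ∧ y = BB n a k then g x y else 0) := by
    intro x y
    have := congrArg (· * g x y) (adjP_ind n a ha1 x y)
    simp only [add_mul, sum_mul, ite_mul, one_mul, zero_mul] at this
    exact this
  simp only [e1, sum_add_distrib]
  congr 1
  · rw [sum_range_succ]
    have h0 : ∑ y ∈ range (6*n+2), (if 6*n+1+1 = y then g (6*n+1) y else 0) = 0 := by
      rw [sum_ite_eq]; simp
    rw [h0, add_zero]
    refine sum_congr rfl fun x hx => ?_
    rw [sum_ite_eq, if_pos]
    simp at hx ⊢; omega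
  · have h1 : ∀ x ∈ range (6*n+2), ∑ y ∈ range (6*n+2), ∑ k ∈ range n,
        (if x = TT a k ∧ y = BB n a k then g x y else 0)
        = ∑ k ∈ range n, ∑ y ∈ range (6*n+2), (if x = TT a k ∧ y = BB n a k then g x y else 0) :=
      fun x _ => sum_comm
    rw [sum_congr rfl h1, sum_comm]
    refine sum_congr rfl fun k hk => ?_
    have hk : k < n := by simpa using hk
    have hT := TT_lip a ha5 (Nat.zero_le k)
    rw [TT_zero] at hT
    have hT2 : TT a k ∈ range (6*n+2) := by simp; omega
    have hB2 : BB n a k ∈ range (6*n+2) := by unfold BB; simp; omega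
    rw [sum_eq_single_of_mem _ hT2, sum_eq_single_of_mem _ hB2]
    · simp
    · intro y _ hy; rw [if_neg]; exact fun h => hy h.2
    · intro x _ hx; refine sum_eq_zero fun y _ => ?_
      rw [if_neg]; exact fun h => hx h.1

open Classical in
lemma edge_sum (n : ℕ) (a : ℕ → ℕ) (ha1 : ∀ i, 1 ≤ a i) (ha5 : ∀ i, a i ≤ 5)
    (g : ℕ → ℕ → ℝ) (hg : ∀ x y, g x y = g y x) :
    ∑ x ∈ range (6*n+2), ∑ y ∈ range (6*n+2), (if adjP n a x y ∨ adjP n a y x then g x y else 0)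
      = 2 * (∑ e ∈ range (6*n+1), g e (e+1) + ∑ k ∈ range n, g (TT a k) (BB n a k)) := by
  rw [← edge_sum_dir n a ha1 ha5, two_mul]
  nth_rewrite 3 [sum_comm]
  rw [← sum_add_distrib]
  refine sum_congr rfl fun x _ => ?_
  rw [← sum_add_distrib]
  refine sum_congr rfl fun y _ => ?_
  by_cases h1 : adjP n a x y
  · have h2 : ¬ adjP n a y x := fun h => by have := adjP_lt h; have := adjP_lt h1; omega
    simp [h1, h2]
  · by_cases h2 : adjP n a y x <;> simp [h1, h2, hg x y]

/-- top lengths -/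
def aw (n : ℕ) (w : Fin (n - 2) → Fin 5) (k : ℕ) : ℕ :=
  if h : 1 ≤ k ∧ k - 1 < n - 2 then (w ⟨k - 1, h.2⟩ : ℕ) + 1 else 3

lemma aw_ge (n : ℕ) (w : Fin (n - 2) → Fin 5) (k : ℕ) : 1 ≤ aw n w k := by
  unfold aw; split_ifs <;> omega

lemma aw_le (n : ℕ) (w : Fin (n - 2) → Fin 5) (k : ℕ) : aw n w k ≤ 5 := by
  unfold aw; split_ifs <;> omega

lemma aw_succ (n : ℕ) (w : Fin (n - 2) → Fin 5) (j : Fin (n - 2)) :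
    aw n w (j + 1) = (w j : ℕ) + 1 := by
  unfold aw; rw [dif_pos ⟨by omega, by simp⟩]; simp

lemma aw_zero (n : ℕ) (w : Fin (n - 2) → Fin 5) : aw n w 0 = 3 := by
  unfold aw; rw [dif_neg (by omega)]

lemma aw_top (n : ℕ) (w : Fin (n - 2) → Fin 5) (k : ℕ) (hk : n - 1 ≤ k): aw n w k = 3 := by
  unfold aw; rw [dif_neg (by omega)]

lemma tpos_eq (n : ℕ) (w : Fin (n - 2) → Fin 5) (k : ℕ) (h1 : 1 ≤ k)
    (h2 : k ≤ n - 1) : tpos n w k + 2 = TT (aw n w) k := by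
  have e : ∑ j ∈ Finset.univ.filter (fun j : Fin (n - 2) => (j : ℕ) + 1 < k), ((w j : ℕ))
      = ∑ i ∈ range (k-1), (aw n w (i+1) - 1) := by
    have : ∀ j : Fin (n-2), (w j : ℕ) = aw n w (j + 1) - 1 := fun j => by rw [aw_succ]; omega
    simp only [this]
    rw [sum_filter, Fin.sum_univ_eq_sum_range (fun j => if j + 1 < k then aw n w (j+1) - 1 else 0),
      ← sum_filter]
    refine sum_congr ?_ fun _ _ => rfl
    ext i; simp; omega
  obtain ⟨m, rfl⟩ : ∃ m, k = m + 1 := ⟨k-1, by omega⟩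
  unfold tpos TT
  rw [e, sum_range_succ', aw_zero]
  simp only [Nat.add_sub_cancel]
  have : ∀ m, ∑ i ∈ range m, aw n w (i+1) = m + ∑ i ∈ range m, (aw n w (i+1) - 1) := by
    intro m
    induction m with
    | zero => simp
    | succ m ih => rw [sum_range_succ, ih, sum_range_succ]; have := aw_ge n w (m+1); omega
  rw [this]; ring

lemma bpos_eq (n : ℕ) (hn : 3 ≤ n) (w : Fin (n - 2) → Fin 5) (k : ℕ) (h1 : 1 ≤ k)
    (h2 : k ≤ n - 1) : bpos n w k + 2 = BB n (aw n w) k := by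
  have t := tpos_eq n w k h1 h2
  have h0 : ∑ j ∈ Finset.univ.filter (fun j : Fin (n - 2) => ¬ (j : ℕ) + 1 < k), ((w j : ℕ) + (5 - (w j : ℕ)))
      = 5 * (n - 1 - k) := by
    have : ∀ j : Fin (n-2), (w j : ℕ) + (5 - (w j : ℕ)) = 5 := fun j => by omega
    simp only [this, sum_const, smul_eq_mul]
    rw [mul_comm]; congr 1
    have : (Finset.univ.filter (fun j : Fin (n - 2) => ¬ (j : ℕ) + 1 < k)).card
        = ∑ j : Fin (n-2), if ¬ (j : ℕ) + 1 < k then 1 else 0 := by rw [card_filter]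
    rw [this, Fin.sum_univ_eq_sum_range (fun j => if ¬ j + 1 < k then 1 else 0), ← card_filter]
    have : (range (n-2)).filter (fun j => ¬ j + 1 < k) = Ico (k-1) (n-2) := by
      ext j; simp; omega
    rw [this]; simp; omega
  have h3 := sum_filter_add_sum_filter_not (univ : Finset (Fin (n-2))) (fun j => (j : ℕ) + 1 < k)
    (fun j => (w j : ℕ))
  rw [sum_add_distrib] at h0
  unfold BB
  rw [← t]
  unfold bpos tpos
  have h4 : ∑ j ∈ Finset.univ.filter (fun j : Fin (n - 2) => k ≤ (j : ℕ) + 1), (5 - ((w j : ℕ)))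
     = ∑ j ∈ Finset.univ.filter (fun j : Fin (n - 2) => ¬ (j : ℕ) + 1 < k), (5 - ((w j : ℕ))) := by
    simp only [not_lt]
  rw [h4, ← h3]
  omega

def pos (n : ℕ) (u : ℕ) : ℕ := if u < 6 * n then u + 2 else u - 6 * n

lemma r_pos (n : ℕ) (hn : 3 ≤ n) (w : Fin (n - 2) → Fin 5) (u v : ℕ) (hu : u < 6*n+2)
    (hv : v < 6*n+2) :
    (adjP n (aw n w) (pos n u) (pos n v) ∨ adjP n (aw n w) (pos n v) (pos n u)) ↔
    ((u + 1 = v ∨ (u = 6*n+1 ∧ v = 0) ∨ ∃ k, 1 ≤ k ∧ k ≤ n-1 ∧ u = tpos n w k ∧ v = bpos n w k) ∨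
     (v + 1 = u ∨ (v = 6*n+1 ∧ u = 0) ∨ ∃ k, 1 ≤ k ∧ k ≤ n-1 ∧ v = tpos n w k ∧ u = bpos n w k)) := by
  have hB0 : BB n (aw n w) 0 = 6*n+1 := by unfold BB; rw [TT_zero]; omega
  have hT0 := TT_zero (aw n w)
  have key : ∀ k, 1 ≤ k → k ≤ n-1 → tpos n w k < 6*n ∧ bpos n w k < 6*n ∧
      TT (aw n w) k = tpos n w k + 2 ∧ BB n (aw n w) k = bpos n w k + 2 := by
    intro k h1 h2
    have e1 := tpos_eq n w k h1 h2
    have e2 := bpos_eq n hn w k h1 h2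
    have e3 := TT_lip _ (aw_le n w) (Nat.zero_le k)
    rw [hT0] at e3
    have e4 : BB n (aw n w) k = TT (aw n w) k + (6*n+1-6*k) := rfl
    omega
  have dir : ∀ u v, u < 6*n+2 → v < 6*n+2 → adjP n (aw n w) (pos n u) (pos n v) →
    ((u + 1 = v ∨ (u = 6*n+1 ∧ v = 0) ∨ ∃ k, 1 ≤ k ∧ k ≤ n-1 ∧ u = tpos n w k ∧ v = bpos n w k) ∨
     (v + 1 = u ∨ (v = 6*n+1 ∧ u = 0) ∨ ∃ k, 1 ≤ k ∧ k ≤ n-1 ∧ v = tpos n w k ∧ u = bpos n w k)) := by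
    intro u v hu hv h
    rcases h with h | ⟨k, hk, h1, h2⟩
    · unfold pos at h; split_ifs at h <;> omega
    · rcases Nat.eq_zero_or_pos k with rfl | hk0
      · rw [hT0] at h1; rw [hB0] at h2
        unfold pos at h1 h2; split_ifs at h1 h2 <;> omega
      · obtain ⟨q1, q2, q3, q4⟩ := key k hk0 (by omega)
        rw [q3] at h1; rw [q4] at h2
        left; right; right
        refine ⟨k, hk0, by omega, ?_, ?_⟩
        · unfold pos at h1; split_ifs at h1 <;> omega
        · unfold pos at h2; split_ifs at h2 <;> omega
  have inv : ∀ u v, u < 6*n+2 → v < 6*n+2 →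
    (u + 1 = v ∨ (u = 6*n+1 ∧ v = 0) ∨ ∃ k, 1 ≤ k ∧ k ≤ n-1 ∧ u = tpos n w k ∧ v = bpos n w k) →
    (adjP n (aw n w) (pos n u) (pos n v) ∨ adjP n (aw n w) (pos n v) (pos n u)) := by
    intro u v hu hv h
    rcases h with h | ⟨h1, h2⟩ | ⟨k, h1, h2, h3, h4⟩
    · by_cases hc : u = 6*n-1
      · right; right
        refine ⟨0, by omega, ?_, ?_⟩
        · rw [hT0]; unfold pos; split_ifs <;> omega
        · rw [hB0]; unfold pos; split_ifs <;> omega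
      · left; left; unfold pos; split_ifs <;> omega
    · left; left; unfold pos; split_ifs <;> omega
    · obtain ⟨q1, q2, q3, q4⟩ := key k h1 h2
      left; right
      refine ⟨k, by omega, ?_, ?_⟩
      · rw [q3]; unfold pos; split_ifs <;> omega
      · rw [q4]; unfold pos; split_ifs <;> omega
  constructor
  · rintro (h | h)
    · exact dir u v hu hv h
    · exact (dir v u hv hu h).symm
  · rintro (h | h)
    · exact inv u v hu hv h
    · exact (inv v u hv hu h).symm

lemma adj_iff (n : ℕ) (hn : 3 ≤ n) (w : Fin (n - 2) → Fin 5) (u v : Fin (6*n+2)) :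
    (octChain n w).Adj u v ↔
      (adjP n (aw n w) (pos n u) (pos n v) ∨ adjP n (aw n w) (pos n v) (pos n u)) := by
  rw [r_pos n hn w u v u.2 v.2]
  unfold octChain
  rw [SimpleGraph.fromRel_adj]
  constructor
  · exact fun h => h.2
  · intro h
    refine ⟨?_, h⟩
    rintro rfl
    rw [← r_pos n hn w u u u.2 u.2] at h
    rcases h with h | h <;> exact absurd (adjP_lt h) (lt_irrefl _)

def posE (n : ℕ) : Fin (6*n+2) ≃ Fin (6*n+2) where
  toFun u := ⟨pos n u, by unfold pos; split_ifs <;> omega⟩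
  invFun x := ⟨if (x : ℕ) < 2 then x + 6*n else x - 2, by split_ifs <;> omega⟩
  left_inv u := by
    ext; simp only [pos]; split_ifs <;> omega
  right_inv u := by
    ext; simp only [pos]; split_ifs <;> omega

lemma sum_pos (n : ℕ) (f : ℕ → ℝ) :
    ∑ u : Fin (6*n+2), f (pos n u) = ∑ x ∈ range (6*n+2), f x := by
  rw [← Fin.sum_univ_eq_sum_range]
  exact (posE n).sum_comp (fun x : Fin (6*n+2) => f x)

lemma resDist_chain (n : ℕ) (hn : 3 ≤ n) (w : Fin (n - 2) → Fin 5) (u v : Fin (6*n+2))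
    (huv : pos n v ≤ pos n u) (z : ℕ → ℝ)
    (hz : ∀ k, k < n → 8 * z k - (if k = 0 then 0 else z (k-1)) - (if k + 1 < n then z (k+1) else 0)
      = PP n (aw n w) k (pos n u) - PP n (aw n w) k (pos n v)) :
    resDist (octChain n w) u v = (pos n u - pos n v : ℝ) -
      ∑ k ∈ range n, z k * (PP n (aw n w) k (pos n u) - PP n (aw n w) k (pos n v)) := by
  classical
  obtain ⟨Y, hY1, hY2⟩ := weak_sol n (by omega) (aw n w) (aw_ge n w) (aw_le n w) (pos n v) (pos n u)
    huv (posE n u).2 z hz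
  rw [← hY1]
  apply resDist_of_weak (octChain n w) (fun a => Y (pos n a)) u v
  intro ψ
  set ψ' : ℕ → ℝ := fun x => if h : x < 6*n+2 then ψ ((posE n).symm ⟨x, h⟩) else 0 with hψ'
  have hψ : ∀ a : Fin (6*n+2), ψ a = ψ' (pos n a) := by
    intro a
    have h : pos n a < 6*n+2 := (posE n a).2
    simp only [hψ', dif_pos h]
    congr 1
    exact ((posE n).symm_apply_apply a).symm
  have e1 := edge_sum n (aw n w) (aw_ge n w) (aw_le n w)
    (fun x y => (ψ' y - ψ' x) * (Y y - Y x)) (fun x y => by ring)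
  have e2 : ∀ x y, (ψ' x - ψ' y) * (Y x - Y y) = (ψ' y - ψ' x) * (Y y - Y x) := fun x y => by ring
  have e3 := hY2 ψ'
  simp only [hψ, adj_iff n hn w]
  rw [← e3]
  rw [← e1, ← sum_pos]
  refine sum_congr rfl fun a _ => ?_
  rw [← sum_pos]
  refine sum_congr rfl fun b _ => ?_
  simp only [e2 (pos n a)]

end Oct

namespace Oct
open Finset

abbrev V := ℕ → ℝ

def Mop (n : ℕ) (z : V) : V := fun k =>
  8 * z k - (if k = 0 then 0 else z (k-1)) - (if k + 1 < n then z (k+1) else 0)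

def D (n : ℕ) (u v : V) : ℝ := ∑ k ∈ range n, u k * v k

lemma D_Mop (m : ℕ) (u v : V) : D (m+1) u (Mop (m+1) v) =
    8 * D (m+1) u v - ∑ k ∈ range m, (u (k+1) * v k + u k * v (k+1)) := by
  unfold D Mop
  have e : ∀ k, u k * (8 * v k - (if k = 0 then 0 else v (k-1)) - (if k + 1 < m+1 then v (k+1) else 0))
    = 8 * (u k * v k) - (if k = 0 then 0 else u k * v (k-1)) - (if k < m then u k * v (k+1) else 0) := by
    intro k
    simp only [add_lt_add_iff_right]
    split_ifs <;> ring
  simp only [e, sum_sub_distrib, ← mul_sum, sum_add_distrib]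
  rw [sum_range_succ' (fun k => if k = 0 then 0 else u k * v (k-1)),
    sum_range_succ (fun k => if k < m then u k * v (k+1) else 0)]
  simp only [Nat.add_sub_cancel, Nat.succ_ne_zero, if_true, if_false, lt_irrefl, add_zero]
  rw [sum_congr rfl (fun k hk => if_pos (by simpa using hk : k < m))]
  simp only [sub_sub]

lemma D_comm (n : ℕ) (u v : V) : D n u v = D n v u := by
  unfold D; simp only [mul_comm]

lemma D_Mop_symm (m : ℕ) (u v : V) : D (m+1) u (Mop (m+1) v) = D (m+1) v (Mop (m+1) u) := by
  rw [D_Mop, D_Mop, D_comm]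
  congr 1
  refine sum_congr rfl fun k _ => by ring

lemma sq_shift (m : ℕ) (z : V) : ∑ k ∈ range m, (z k ^ 2 + z (k+1) ^ 2) ≤ 2 * D (m+1) z z := by
  unfold D
  rw [sum_add_distrib, two_mul]
  have h1 := sum_range_succ (fun k => z k * z k) m
  have h2 := sum_range_succ' (fun k => z k * z k) m
  simp only [← pow_two] at *
  have := sq_nonneg (z 0); have := sq_nonneg (z m)
  linarith

lemma Mop_lower (m : ℕ) (z : V) : 6 * D (m+1) z z ≤ D (m+1) z (Mop (m+1) z) := by
  rw [D_Mop]
  have h := sq_shift m z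
  have : ∑ k ∈ range m, (z (k+1) * z k + z k * z (k+1)) ≤ ∑ k ∈ range m, (z k ^ 2 + z (k+1) ^ 2) :=
    sum_le_sum fun k _ => by nlinarith [sq_nonneg (z k - z (k+1))]
  linarith

lemma Mop_upper (m : ℕ) (z : V) : D (m+1) z (Mop (m+1) z) ≤ 10 * D (m+1) z z := by
  rw [D_Mop]
  have h := sq_shift m z
  have : - ∑ k ∈ range m, (z k ^ 2 + z (k+1) ^ 2) ≤ ∑ k ∈ range m, (z (k+1) * z k + z k * z (k+1)) := by
    rw [← sum_neg_distrib]
    exact sum_le_sum fun k _ => by nlinarith [sq_nonneg (z k + z (k+1))]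
  linarith

lemma D_self_nonneg (n : ℕ) (z : V) : 0 ≤ D n z z := sum_nonneg fun k _ => mul_self_nonneg _

/-- The abstract properties of the form `B u v = uᵀ M⁻¹ v`. -/
structure IsB (n : ℕ) (B : V →ₗ[ℝ] V →ₗ[ℝ] ℝ) : Prop where
  symm : ∀ u v, B u v = B v u
  mop : ∀ z v, B (Mop n z) v = D n z v
  surj : ∀ v : V, ∃ z, ∀ k < n, Mop n z k = v k
  supp : ∀ u v : V, (∀ k < n, u k = 0) → B u v = 0

def ext (n : ℕ) : (Fin n → ℝ) →ₗ[ℝ] V where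
  toFun z k := if h : k < n then z ⟨k, h⟩ else 0
  map_add' x y := by ext k; simp only [Pi.add_apply]; split_ifs <;> simp
  map_smul' c x := by ext k; simp only [Pi.smul_apply, smul_eq_mul, RingHom.id_apply]; split_ifs <;> simp

def res (n : ℕ) : V →ₗ[ℝ] (Fin n → ℝ) where
  toFun z k := z k
  map_add' x y := rfl
  map_smul' c x := rfl

def MopL (n : ℕ) : V →ₗ[ℝ] V where
  toFun := Mop n
  map_add' x y := by ext k; simp only [Mop, Pi.add_apply]; split_ifs <;> ring
  map_smul' c x := by
    ext k; simp only [Mop, Pi.smul_apply, smul_eq_mul, RingHom.id_apply]; split_ifs <;> ring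

lemma ext_res (n : ℕ) (z : V) (k : ℕ) (hk : k < n) : ext n (res n z) k = z k := by
  simp [ext, res, hk]

lemma res_ext (n : ℕ) (z : Fin n → ℝ) : res n (ext n z) = z := by
  funext k; simp [ext, res]

lemma D_congr (n : ℕ) {u u' v v' : V} (hu : ∀ k < n, u k = u' k) (hv : ∀ k < n, v k = v' k) :
    D n u v = D n u' v' := by
  unfold D
  refine sum_congr rfl fun k hk => ?_
  rw [hu k (by simpa using hk), hv k (by simpa using hk)]

lemma Mop_congr (n : ℕ) {z z' : V} (hz : ∀ k < n, z k = z' k) : ∀ k < n, Mop n z k = Mop n z' k := by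
  intro k hk
  unfold Mop
  rw [hz k hk]
  split_ifs with h1 h2 h2
  · rw [hz _ h2]
  · rfl
  · rw [hz _ h2, hz (k-1) (by omega)]
  · rw [hz (k-1) (by omega)]

def Dlin (n : ℕ) : V →ₗ[ℝ] V →ₗ[ℝ] ℝ :=
  LinearMap.mk₂ ℝ (D n) (fun a b c => by simp [D, add_mul, sum_add_distrib])
    (fun a b c => by simp [D, mul_sum, mul_assoc])
    (fun a b c => by simp [D, mul_add, sum_add_distrib])
    (fun a b c => by simp [D, mul_sum, mul_left_comm])

lemma exists_B (m : ℕ) : ∃ B, IsB (m+1) B := by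
  let T : (Fin (m+1) → ℝ) →ₗ[ℝ] (Fin (m+1) → ℝ) := (res (m+1)).comp ((MopL (m+1)).comp (ext (m+1)))
  have hT : ∀ z, ∀ k < m+1, ext (m+1) (T z) k = Mop (m+1) (ext (m+1) z) k := fun z k hk =>
    ext_res (m+1) (Mop (m+1) (ext (m+1) z)) k hk
  have hinj : Function.Injective T := by
    rw [← LinearMap.ker_eq_bot, LinearMap.ker_eq_bot']
    intro z hz
    have h1 := Mop_lower m (ext (m+1) z)
    have h2 : D (m+1) (ext (m+1) z) (Mop (m+1) (ext (m+1) z)) = 0 := by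
      rw [← D_congr (m+1) (fun _ _ => rfl) (hT z), hz, map_zero]
      simp [D]
    have h3 : D (m+1) (ext (m+1) z) (ext (m+1) z) = 0 := le_antisymm (by linarith) (D_self_nonneg _ _)
    unfold D at h3
    rw [sum_eq_zero_iff_of_nonneg (fun k _ => mul_self_nonneg _)] at h3
    funext k
    have hk : (k:ℕ) ≤ m := by omega
    have := h3 k (mem_range.2 k.2)
    simpa [ext, hk] using this
  let E := LinearEquiv.ofInjectiveEndo T hinj
  have hE : ∀ z, T (E.symm z) = z := fun z => E.apply_symm_apply z
  have hE' : ∀ z, E.symm (T z) = z := fun z => E.symm_apply_apply z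
  let A : V →ₗ[ℝ] V := (ext (m+1)).comp (E.symm.toLinearMap.comp (res (m+1)))
  have hA : ∀ v : V, ∀ k < m+1, Mop (m+1) (A v) k = v k := by
    intro v k hk
    show Mop (m+1) (ext (m+1) (E.symm (res (m+1) v))) k = v k
    rw [← hT _ k hk, hE, ext_res _ _ _ hk]
  have hA' : ∀ v : V, ∀ k < m+1, A (Mop (m+1) v) k = v k := by
    intro v k hk
    have : res (m+1) (Mop (m+1) v) = T (res (m+1) v) := by
      funext j
      exact (Mop_congr (m+1) (ext_res (m+1) v) j j.2).symm
    show ext (m+1) (E.symm (res (m+1) (Mop (m+1) v))) k = v k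
    rw [this, hE', ext_res _ _ _ hk]
  refine ⟨(Dlin (m+1)).comp A, ?_, ?_, fun v => ⟨A v, hA v⟩, ?_⟩
  · intro u v
    show D (m+1) (A u) v = D (m+1) (A v) u
    rw [← D_congr (m+1) (fun _ _ => rfl) (hA v), D_Mop_symm, D_congr (m+1) (fun _ _ => rfl) (hA u)]
  · intro z v
    show D (m+1) (A (Mop (m+1) z)) v = _
    exact D_congr _ (hA' z) (fun _ _ => rfl)
  · intro u v hu
    show D (m+1) (ext (m+1) (E.symm (res (m+1) u))) v = 0
    have : res (m+1) u = 0 := by funext k; exact hu k k.2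
    rw [this, map_zero, map_zero]
    simp [D]

section
variable {m : ℕ} {B : V →ₗ[ℝ] V →ₗ[ℝ] ℝ}

lemma B_congr_left (hB : IsB (m+1) B) {u u' : V} (v : V) (h : ∀ k < m+1, u k = u' k) : B u v = B u' v := by
  have := hB.supp (u - u') v (fun k hk => by simp [h k hk])
  rw [map_sub, LinearMap.sub_apply] at this
  linarith

lemma B_congr (hB : IsB (m+1) B) {u u' v v' : V} (h : ∀ k < m+1, u k = u' k) (h' : ∀ k < m+1, v k = v' k) :
    B u v = B u' v' := by
  rw [B_congr_left hB v h, hB.symm, B_congr_left hB _ h', hB.symm]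

lemma Q_nonneg (hB : IsB (m+1) B) (v : V) : 0 ≤ B v v := by
  obtain ⟨z, hz⟩ := hB.surj v
  rw [← B_congr hB hz hz, hB.mop]
  have := Mop_lower m z; have := D_self_nonneg (m+1) z
  linarith

lemma Q_lower (hB : IsB (m+1) B) (v : V) : D (m+1) v v / 10 ≤ B v v := by
  have h := Q_nonneg hB (v - Mop (m+1) ((1/10 : ℝ) • v))
  have e : Mop (m+1) ((1/10 : ℝ) • v) = (1/10 : ℝ) • Mop (m+1) v := (MopL (m+1)).map_smul _ _
  have h1 := hB.mop v v
  have h2 := hB.mop v (Mop (m+1) v)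
  have h3 := Mop_upper m v
  simp only [e, map_sub, map_smul, LinearMap.sub_apply, LinearMap.smul_apply, smul_eq_mul,
    hB.symm v (Mop (m+1) v), h1, h2] at h
  linarith

lemma Q_upper (hB : IsB (m+1) B) (v : V) : B v v ≤ D (m+1) v v / 6 := by
  obtain ⟨z, hz⟩ := hB.surj v
  have h1 : B v v = D (m+1) z v := by
    rw [← hB.mop]; exact B_congr hB (fun k hk => (hz k hk).symm) fun _ _ => rfl
  have h2 : B v v = D (m+1) z (Mop (m+1) z) := by
    rw [← hB.mop]; exact (B_congr hB hz hz).symm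
  have h3 := Mop_lower m z
  have h4 := D_self_nonneg (m+1) (v - (6:ℝ) • z)
  have h5 : D (m+1) (v - (6:ℝ) • z) (v - (6:ℝ) • z) = D (m+1) v v - 12 * D (m+1) z v + 36 * D (m+1) z z := by
    unfold D
    rw [mul_sum, mul_sum, ← sum_sub_distrib, ← sum_add_distrib]
    refine sum_congr rfl fun k _ => ?_
    simp; ring
  linarith
end

end Oct

namespace Oct
open Finset

lemma pair_sum {ι : Type*} (s : Finset ι) (c : ι → ℝ) (f : ι → V) (B : V →ₗ[ℝ] V →ₗ[ℝ] ℝ)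
    (hs : ∀ u v, B u v = B v u) :
    ∑ x ∈ s, ∑ y ∈ s, c x * c y * B (f x - f y) (f x - f y)
      = 2 * ((∑ x ∈ s, c x) * ∑ x ∈ s, c x * B (f x) (f x)
        - B (∑ x ∈ s, c x • f x) (∑ x ∈ s, c x • f x)) := by
  have e : ∀ x y, c x * c y * B (f x - f y) (f x - f y) =
      c y * (c x * B (f x) (f x)) + c x * (c y * B (f y) (f y)) - 2 * (c x * (c y * B (f x) (f y))) := by
    intro x y
    simp only [map_sub, LinearMap.sub_apply, hs (f y) (f x)]; ring
  simp only [e, sum_sub_distrib, sum_add_distrib, ← mul_sum, ← sum_mul, map_sum, map_smul,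
    LinearMap.sum_apply, LinearMap.smul_apply, smul_eq_mul]
  have : ∑ x ∈ s, c x * ∑ y ∈ s, c y * B (f x) (f y) = ∑ x ∈ s, c x * ∑ y ∈ s, c y * B (f y) (f x) := by
    refine sum_congr rfl fun x _ => ?_
    simp only [hs (f x)]
  rw [this]
  ring

lemma jensen {ι : Type*} (s : Finset ι) (c : ι → ℝ) (f : ι → V) (B : V →ₗ[ℝ] V →ₗ[ℝ] ℝ)
    (hs : ∀ u v, B u v = B v u) (hp : ∀ v, 0 ≤ B v v) (hc : ∀ x ∈ s, 0 ≤ c x) (N : ℝ)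
    (hN : ∑ x ∈ s, c x ≤ N) :
    B (∑ x ∈ s, c x • f x) (∑ x ∈ s, c x • f x) ≤ N * ∑ x ∈ s, c x * B (f x) (f x) := by
  have h1 := pair_sum s c f B hs
  have h2 : 0 ≤ ∑ x ∈ s, ∑ y ∈ s, c x * c y * B (f x - f y) (f x - f y) :=
    sum_nonneg fun x hx => sum_nonneg fun y hy =>
      mul_nonneg (mul_nonneg (hc x hx) (hc y hy)) (hp _)
  have h3 : 0 ≤ ∑ x ∈ s, c x * B (f x) (f x) := sum_nonneg fun x hx => mul_nonneg (hc x hx) (hp _)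
  nlinarith

/-- basis vector -/
def ee (i : ℕ) : V := fun k => if k = i then 1 else 0
def al (d : V) (i : ℕ) : V := fun k => if k < i then d k else 0
noncomputable def uu (m i : ℕ) : V := fun k => if i < k ∧ k < m + 1 then (if k = m then 7/6 else 1) else 0
noncomputable def ph (d : V) (a : ℕ) : V := fun k => (if k < a then d k else 0) +
  d a * ((if k = a then 1/2 else 0) + (if k = a + 1 then 1/12 else 0) - (if k + 1 = a then 1/12 else 0))
noncomputable def yy (a : ℕ) : V := fun k => if a < k then 1 else if k = a then 1/2 else 0
def RR (m a : ℕ) : ℝ := 6 * ((m : ℝ) - a) + 1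
def one (i : ℕ) : V := fun k => if i < k then 1 else 0

lemma Mop_yy (m a k : ℕ) (ha : 1 ≤ a) (ham : a < m) (hk : k < m + 1) :
    Mop (m+1) (yy a) k = if k + 1 < a then 0 else if k + 1 = a then -1/2 else if k = a then 3
      else if k = a + 1 then (if k = m then 15/2 else 13/2) else (if k = m then 7 else 6) := by
  unfold Mop yy
  rcases lt_trichotomy (k+1) a with h | h | h
  · simp (disch := omega) only [if_pos, if_neg]; split_ifs <;> first | omega | norm_num
  · simp (disch := omega) only [if_pos, if_neg]; split_ifs <;> first | omega | norm_num
  rcases Nat.lt_trichotomy k (a+1) with h1 | h1 | h1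
  · obtain rfl : k = a := by omega
    simp (disch := omega) only [if_pos, if_neg]; norm_num
  · simp (disch := omega) only [if_pos, if_neg]; split_ifs <;> first | omega | norm_num
  · simp (disch := omega) only [if_pos, if_neg]; split_ifs <;> first | omega | norm_num

lemma Mop_one (m i k : ℕ) (him : i < m) (hk : k < m + 1) :
    Mop (m+1) (one i) k = if k < i then 0 else if k = i then -1
      else if k = i + 1 then (if k = m then 8 else 7) else (if k = m then 7 else 6) := by
  unfold Mop one
  rcases lt_trichotomy k i with h | h | h
  · simp (disch := omega) only [if_pos, if_neg]; split_ifs <;> first | omega | norm_num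
  · simp (disch := omega) only [if_pos, if_neg]; split_ifs <;> first | omega | norm_num
  rcases Nat.lt_trichotomy k (i+1) with h1 | h1 | h1
  · omega
  · simp (disch := omega) only [if_pos, if_neg]; split_ifs <;> first | omega | norm_num
  · simp (disch := omega) only [if_pos, if_neg]; split_ifs <;> first | omega | norm_num

lemma pa_gauge (m : ℕ) (d : V) (a k : ℕ) (ha : 1 ≤ a) (ham : a < m) (hk : k < m+1) :
    (al d a - d a • uu m a) k = (ph d a - (d a / 6) • Mop (m+1) (yy a)) k := by
  simp only [Pi.sub_apply, Pi.smul_apply, smul_eq_mul, Mop_yy m a k ha ham hk]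
  unfold al uu ph
  rcases lt_trichotomy (k+1) a with h | h | h
  · simp (disch := omega) only [if_pos, if_neg]; ring
  · simp (disch := omega) only [if_pos, if_neg]; ring
  rcases Nat.lt_trichotomy k (a+1) with h1 | h1 | h1
  · obtain rfl : k = a := by omega
    simp (disch := omega) only [if_pos, if_neg]; norm_num; ring
  · simp (disch := omega) only [if_pos, if_neg]; split_ifs <;> first | omega | (ring)
  · simp (disch := omega) only [if_pos, if_neg]; split_ifs <;> first | omega | (ring)

lemma u_gauge (m i k : ℕ) (him : i < m) (hk : k < m+1) :
    ((6:ℝ) • uu m i) k = (Mop (m+1) (one i) + ee i - ee (i+1)) k := by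
  simp only [Pi.sub_apply, Pi.add_apply, Pi.smul_apply, smul_eq_mul, Mop_one m i k him hk]
  unfold uu ee
  split_ifs <;> first | omega | norm_num

end Oct

namespace Oct
open Finset

lemma sum_ind_eq (n a : ℕ) (c : ℝ) (h : a < n) : ∑ k ∈ range n, (if k = a then c else 0) = c := by
  rw [sum_ite_eq']; simp [h]

lemma sum_ind_gt (m a : ℕ) (c : ℝ) (h : a ≤ m) :
    ∑ k ∈ range (m+1), (if a < k then c else 0) = (m - a) * c := by
  induction m, h using Nat.le_induction with
  | base => 
    rw [sum_eq_zero]; · ring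
    intro k hk; rw [if_neg]; simp at hk; omega
  | succ m hm ih => rw [sum_range_succ, ih, if_pos (by omega)]; push_cast; ring

lemma D_yMy (m a : ℕ) (ha : 1 ≤ a) (ham : a < m) :
    D (m+1) (yy a) (Mop (m+1) (yy a)) = RR m a + 2 := by
  have : D (m+1) (yy a) (Mop (m+1) (yy a)) = ∑ k ∈ range (m+1), ((if k = a then 3/2 else 0) +
      (if k = a+1 then 1/2 else 0) + (if a < k then 6 else 0) + (if k = m then (1:ℝ) else 0)) := by
    refine sum_congr rfl fun k hk => ?_
    rw [Mop_yy m a k ha ham (by simpa using hk)]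
    unfold yy
    split_ifs <;> first | omega | norm_num
  rw [this]
  simp only [sum_add_distrib]
  rw [sum_ind_eq _ _ _ (by omega), sum_ind_eq _ _ _ (by omega), sum_ind_eq _ _ _ (by omega),
    sum_ind_gt _ _ _ (by omega)]
  unfold RR; ring

lemma D_yph (m a : ℕ) (d : V) (ham : a < m) :
    D (m+1) (yy a) (ph d a) = d a / 3 := by
  have : D (m+1) (yy a) (ph d a) = ∑ k ∈ range (m+1), ((if k = a then d a / 4 else 0) +
      (if k = a+1 then d a / 12 else 0)) := by
    refine sum_congr rfl fun k hk => ?_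
    unfold yy ph
    split_ifs <;> first | omega | (ring)
  rw [this]
  simp only [sum_add_distrib]
  rw [sum_ind_eq _ _ _ (by omega), sum_ind_eq _ _ _ (by omega)]
  ring

lemma D_oMo (m i : ℕ) (him : i < m) :
    D (m+1) (one i) (Mop (m+1) (one i)) = RR m i + 1 := by
  have : D (m+1) (one i) (Mop (m+1) (one i)) = ∑ k ∈ range (m+1), (
      (if k = i+1 then 1 else 0) + (if i < k then 6 else 0) + (if k = m then (1:ℝ) else 0)) := by
    refine sum_congr rfl fun k hk => ?_
    rw [Mop_one m i k him (by simpa using hk)]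
    unfold one
    split_ifs <;> first | omega | norm_num
  rw [this]
  simp only [sum_add_distrib]
  rw [sum_ind_eq _ _ _ (by omega), sum_ind_eq _ _ _ (by omega), 
    sum_ind_gt _ _ _ (by omega)]
  unfold RR; ring

lemma D_ee (n i : ℕ) (v : V) (h : i < n) : D n v (ee i) = v i := by
  unfold D ee
  simp only [mul_ite, mul_one, mul_zero]
  rw [sum_ite_eq']; simp [h]

section
variable {m : ℕ} {B : V →ₗ[ℝ] V →ₗ[ℝ] ℝ}

lemma Q_pa (hB : IsB (m+1) B) (d : V) (a : ℕ) (ha : 1 ≤ a) (ham : a < m) :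
    B (al d a - d a • uu m a) (al d a - d a • uu m a) =
      B (ph d a) (ph d a) + (d a)^2 * (RR m a - 2) / 36 := by
  rw [B_congr hB (fun k hk => pa_gauge m d a k ha ham hk) (fun k hk => pa_gauge m d a k ha ham hk)]
  simp only [map_sub, map_smul, LinearMap.sub_apply, LinearMap.smul_apply, smul_eq_mul,
    hB.symm (ph d a) (Mop (m+1) (yy a)), hB.mop, D_yMy m a ha ham, D_yph m a d ham]
  ring

lemma Q_u (hB : IsB (m+1) B) (i : ℕ) (him : i < m) :
    36 * (B (uu m i) (uu m i) + B (ee i) (uu m i)) =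
      RR m i - 1 + (7 * B (ee i) (ee i) - 8 * B (ee i) (ee (i+1)) + B (ee (i+1)) (ee (i+1))) := by
  have h1 : B ((6:ℝ) • uu m i) ((6:ℝ) • uu m i) + 6 * B (ee i) ((6:ℝ) • uu m i) = 
      36 * (B (uu m i) (uu m i) + B (ee i) (uu m i)) := by
    simp only [map_smul, LinearMap.smul_apply, smul_eq_mul]; ring
  rw [← h1, B_congr hB (fun k hk => u_gauge m i k him hk) (fun k hk => u_gauge m i k him hk),
    B_congr hB (fun k hk => rfl) (fun k hk => u_gauge m i k him hk)]
  simp only [map_sub, map_add, LinearMap.sub_apply, LinearMap.add_apply, 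
    hB.symm (ee _) (Mop (m+1) (one i)), hB.mop, D_oMo m i him]
  rw [D_ee _ _ _ (by omega), D_ee _ _ _ (by omega), hB.symm (ee (i+1)) (ee i)]
  simp [one]
  ring

lemma K_le (hB : IsB (m+1) B) (i : ℕ) (him : i < m) :
    7 * B (ee i) (ee i) - 8 * B (ee i) (ee (i+1)) + B (ee (i+1)) (ee (i+1)) ≤ 3/2 := by
  have h1 := Q_upper hB ((2:ℝ) • ee i - ee (i+1))
  have h2 := Q_nonneg hB (ee i + (2:ℝ) • ee (i+1))
  have h3 : D (m+1) ((2:ℝ) • ee i - ee (i+1)) ((2:ℝ) • ee i - ee (i+1)) = 5 := by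
    have : D (m+1) ((2:ℝ) • ee i - ee (i+1)) ((2:ℝ) • ee i - ee (i+1)) = 
      ∑ k ∈ range (m+1), ((if k = i then 4 else 0) + (if k = i+1 then (1:ℝ) else 0)) := by
      refine sum_congr rfl fun k hk => ?_
      simp only [Pi.sub_apply, Pi.smul_apply, smul_eq_mul]
      unfold ee
      split_ifs <;> first | omega | norm_num
    rw [this, sum_add_distrib, sum_ind_eq _ _ _ (by omega), sum_ind_eq _ _ _ (by omega)]
    norm_num
  rw [h3] at h1
  simp only [map_sub, map_add, map_smul, LinearMap.sub_apply, LinearMap.add_apply,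
    LinearMap.smul_apply, smul_eq_mul, hB.symm (ee (i+1)) (ee i)] at h1 h2
  linarith

lemma term_bound (hB : IsB (m+1) B) (d : V) (hd0 : d 0 = 0) (i : ℕ) (him : i < m) :
    6 * B (ph d i) (ph d i) - 5/12 * (d i)^2 ≤ 
      6 * B (al d i) (al d i) - 12 * d i * B (al d i) (uu m i) - 6 * (d i)^2 * B (ee i) (uu m i) := by
  by_cases h : d i = 0
  · have : ph d i = al d i := by
      funext k; simp [ph, al, h]
    rw [this, h]; simp
  · have hi : 1 ≤ i := by
      rcases Nat.eq_zero_or_pos i with rfl | h'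
      · exact absurd hd0 h
      · exact h'
    have h1 := Q_pa hB d i hi him
    have h2 := Q_u hB i him
    have h3 := K_le hB i him
    simp only [map_sub, map_smul, LinearMap.sub_apply, LinearMap.smul_apply, smul_eq_mul,
      hB.symm (uu m i) (al d i)] at h1
    have h4 := mul_le_mul_of_nonneg_left h3 (sq_nonneg (d i))
    have h5 := congrArg (fun x => (d i)^2 * x) h2
    linarith
end

noncomputable def sg (d : V) : V := fun k => ∑ j ∈ range k, d j + d k / 2
def wt (m a : ℕ) : ℝ := if a = m then 7 else 6
noncomputable def gh (m : ℕ) (d : V) : V := ∑ a ∈ range (m+1), wt m a • ph d a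

lemma gh_apply (m : ℕ) (d : V) (hd : ∀ k, m ≤ k → d k = 0) (k : ℕ) (hk : k < m+1) :
    gh m d k = d k * (RR m k + 3) + ((if k = 0 then 0 else d (k-1)) - d (k+1)) / 2 := by
  unfold gh
  rw [Finset.sum_apply]
  have h6 : ∀ a, wt m a * d a = 6 * d a := by
    intro a
    unfold wt
    split_ifs with h
    · rw [hd a (by omega)]; ring
    · rfl
  have h1 : ∀ a ∈ range (m+1), wt m a * (if k < a then d k else 0) =
      (if k < a then 6 * d k else 0) + (if a = m then d k else 0) := by
    intro a ha
    simp only [mem_range] at ha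
    unfold wt
    split_ifs with h h2 h3
    · ring
    · rw [hd k (by omega)]; ring
    · ring
    · ring
  have : ∀ a ∈ range (m+1), (wt m a • ph d a) k = 
      (if k < a then 6 * d k else 0) + (if a = m then d k else 0) + (if a = k then 3 * d k else 0)
      + (if k = a + 1 then d a / 2 else 0) - (if a = k+1 then d (k+1)/2 else 0) := by
    intro a ha
    rw [← h1 a ha]
    simp only [Pi.smul_apply, smul_eq_mul]
    unfold ph
    rw [mul_add, ← mul_assoc (wt m a) (d a), h6]
    have e1 : (if a = k then 3 * d k else 0) = 6 * d a * (if k = a then 1/2 else 0) := by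
      by_cases h : a = k
      · subst h; simp; ring
      · rw [if_neg h, if_neg (Ne.symm h)]; ring
    have e2 : (if k = a + 1 then d a / 2 else 0) = 6 * d a * (if k = a + 1 then 1/12 else 0) := by
      split_ifs <;> ring
    have e3 : (if a = k+1 then d (k+1)/2 else 0) = 6 * d a * (if k + 1 = a then 1/12 else 0) := by
      by_cases h : a = k + 1
      · subst h; simp; ring
      · rw [if_neg h, if_neg (Ne.symm h)]; ring
    rw [e1, e2, e3]; ring
  rw [sum_congr rfl this, sum_sub_distrib, sum_add_distrib, sum_add_distrib, sum_add_distrib,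
    sum_ind_gt m k _ (by omega), sum_ind_eq _ _ _ (by omega), sum_ind_eq _ _ _ hk]
  have h2 : ∑ a ∈ range (m+1), (if k = a + 1 then d a / 2 else 0) = (if k = 0 then 0 else d (k-1)) / 2 := by
    rcases k with _ | j
    · simp
    · simp only [Nat.add_right_cancel_iff]
      rw [sum_ite_eq]; simp; omega
  have h3 : ∑ a ∈ range (m+1), (if a = k+1 then d (k+1)/2 else 0) = d (k+1) / 2 := by
    rw [sum_ite_eq']
    split_ifs with h
    · rfl
    · rw [hd (k+1) (by simp at h; omega)]; ring
  rw [h2, h3]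
  unfold RR; ring

end Oct

namespace Oct
open Finset

noncomputable def gg (m : ℕ) (d : V) : V :=
  ∑ a ∈ range m, (6:ℝ) • (al d a - d a • uu m a) + (7:ℝ) • al d m

lemma gg_apply (m : ℕ) (d : V) (hd : ∀ k, m ≤ k → d k = 0) (k : ℕ) (hk : k < m+1) :
    gg m d k = d k * RR m k - wt m k * ∑ j ∈ range k, d j := by
  unfold gg
  rw [Pi.add_apply, Finset.sum_apply]
  have e : ∀ a ∈ range m, ((6:ℝ) • (al d a - d a • uu m a)) k = 
      (if k < a then 6 * d k else 0) - wt m k * (if a < k then d a else 0) := by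
    intro a ha
    simp only [Pi.smul_apply, Pi.sub_apply, smul_eq_mul]
    unfold al uu wt
    split_ifs <;> first | omega | ring
  have e2 : ∑ a ∈ range m, (if a < k then d a else 0) = ∑ j ∈ range k, d j := by
    rw [← sum_filter]
    refine sum_congr ?_ fun _ _ => rfl
    ext a; simp; omega
  have e3 := sum_ind_gt m k (6 * d k) (by omega)
  rw [sum_range_succ] at e3
  rw [sum_congr rfl e, sum_sub_distrib, ← mul_sum, e2]
  have e4 : ((7:ℝ) • al d m) k = (if k < m then 6 * d k else 0) + d k := by
    simp only [Pi.smul_apply, smul_eq_mul]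
    unfold al
    split_ifs
    · ring
    · rw [hd k (by omega)]; ring
  rw [e4]
  unfold RR
  linarith

lemma sg_succ (d : V) (k : ℕ) : sg d (k+1) = sg d k + d k / 2 + d (k+1) / 2 := by
  unfold sg; rw [sum_range_succ]; ring

lemma Mop_sg (m : ℕ) (hm : 1 ≤ m) (d : V) (hd0 : d 0 = 0) (hd : ∀ k, m ≤ k → d k = 0) (k : ℕ) (hk : k < m+1) :
    Mop (m+1) (sg d) k = wt m k * sg d k + ((if k = 0 then 0 else d (k-1)) - d (k+1)) / 2 := by
  unfold Mop wt
  rcases k with _ | j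
  · have : sg d 0 = 0 := by simp [sg, hd0]
    rw [sg_succ, this]
    simp [hd0]
    split_ifs <;> first | omega | ring
  · simp only [Nat.succ_ne_zero, if_false, Nat.add_sub_cancel]
    rw [sg_succ d (j+1), sg_succ d j]
    split_ifs with h1 h2 h2
    · omega
    · ring
    · rw [hd (j+1) (by omega), hd (j+1+1) (by omega)]; ring
    · omega

lemma g_gauge (m : ℕ) (hm : 1 ≤ m) (d : V) (hd0 : d 0 = 0) (hd : ∀ k, m ≤ k → d k = 0) (k : ℕ) (hk : k < m+1) :
    gg m d k = (gh m d - Mop (m+1) (sg d)) k := by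
  rw [Pi.sub_apply, gg_apply m d hd k hk, gh_apply m d hd k hk, Mop_sg m hm d hd0 hd k hk]
  have : wt m k * d k = 6 * d k := by
    unfold wt
    split_ifs with h
    · rw [hd k (by omega)]; ring
    · rfl
  unfold sg
  linear_combination this / 2

lemma tele (m : ℕ) (d : V) (hd0 : d 0 = 0) (j : ℕ) :
    ∑ k ∈ range j, (sg d (k+1) * (2 * d (k+1) * (RR m (k+1) + 3) + d k - d (k+2))
      - 8 * sg d (k+1) ^ 2 + 2 * sg d k * sg d (k+1) - 2 * d (k+1)^2 - 1/2 * d k * d (k+1))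
    = (RR m (j+1) + 6) * (∑ i ∈ range (j+1), d i) ^ 2 - sg d (j+1) ^ 2 + 1/4 * d (j+1)^2
      + 1/2 * d j * d (j+1) := by
  induction j with
  | zero => simp [sg, hd0]; ring
  | succ j ih =>
    rw [sum_range_succ, ih, sg_succ d (j+1)]
    unfold sg RR
    rw [sum_range_succ _ (j+1), sum_range_succ _ j]
    push_cast
    ring

lemma D_sg (m : ℕ) (d : V) (hd0 : d 0 = 0) (hd : ∀ k, m ≤ k → d k = 0) :
    2 * D (m+1) (sg d) (gh m d) - D (m+1) (sg d) (Mop (m+1) (sg d)) =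
      2 * ∑ k ∈ range m, d (k+1)^2 + 1/2 * ∑ k ∈ range m, d k * d (k+1) := by
  have h0 : sg d 0 = 0 := by simp [sg, hd0]
  have h1 : D (m+1) (sg d) (gh m d) = ∑ k ∈ range m,
      sg d (k+1) * (d (k+1) * (RR m (k+1) + 3) + (d k - d (k+2)) / 2) := by
    unfold D
    rw [sum_congr rfl (fun k hk => by rw [gh_apply m d hd k (by simpa using hk)]), sum_range_succ', h0]
    simp
  have h2 : D (m+1) (sg d) (sg d) = ∑ k ∈ range m, sg d (k+1) ^ 2 := by
    unfold D
    rw [sum_range_succ', h0]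
    simp [pow_two]
  have h3 := tele m d hd0 m
  rw [hd m le_rfl, hd (m+1) (by omega)] at h3
  have h4 : sg d (m+1) = ∑ i ∈ range (m+1), d i := by
    unfold sg; rw [hd (m+1) (by omega)]; ring
  have h5 : RR m (m+1) + 6 = 1 := by unfold RR; push_cast; ring
  rw [D_Mop, h1, h2]
  rw [h4] at h3
  have h6 : ∑ k ∈ range m, (sg d (k+1) * (2 * d (k+1) * (RR m (k+1) + 3) + d k - d (k+2))
      - 8 * sg d (k+1) ^ 2 + 2 * sg d k * sg d (k+1) - 2 * d (k+1)^2 - 1/2 * d k * d (k+1)) = 0 := by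
    have h5' : RR m (m+1 : ℕ) + 6 = 1 := h5
    rw [h3, h5']; ring
  rw [← sub_eq_zero, ← h6]
  simp only [mul_sum, ← sum_sub_distrib, ← sum_add_distrib]
  refine sum_congr rfl fun k _ => by ring

lemma Q_gg {m : ℕ} {B : V →ₗ[ℝ] V →ₗ[ℝ] ℝ} (hB : IsB (m+1) B) (hm : 1 ≤ m) (d : V) (hd0 : d 0 = 0)
    (hd : ∀ k, m ≤ k → d k = 0) :
    B (gg m d) (gg m d) = B (gh m d) (gh m d) - (2 * ∑ k ∈ range m, d (k+1)^2 + 1/2 * ∑ k ∈ range m, d k * d (k+1)) := by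
  rw [← D_sg m d hd0 hd, B_congr hB (g_gauge m hm d hd0 hd) (g_gauge m hm d hd0 hd)]
  simp only [map_sub, LinearMap.sub_apply, hB.symm (gh m d) (Mop (m+1) (sg d)), hB.mop]
  ring

lemma D_gh (m : ℕ) (d : V) (hd0 : d 0 = 0) (hd : ∀ k, m ≤ k → d k = 0) :
    D (m+1) (gh m d) (gh m d) ≤ ∑ k ∈ range m, d (k+1)^2 * ((RR m (k+1) + 3)^2 + 1) 
      - 6 * ∑ k ∈ range m, d k * d (k+1) := by
  have h1 : D (m+1) (gh m d) (gh m d) = ∑ k ∈ range m,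
      (d (k+1) * (RR m (k+1) + 3) + (d k - d (k+2)) / 2)^2 + d 1 ^2 / 4 := by
    unfold D
    rw [sum_congr rfl (fun k hk => by rw [gh_apply m d hd k (by simpa using hk)]), sum_range_succ']
    simp only [hd0, Nat.succ_ne_zero, if_true, if_false, Nat.add_sub_cancel, pow_two]
    push_cast
    ring_nf
  have h2 : ∀ j, ∑ k ∈ range j, ((RR m (k+1) + 3) * (d (k+1) * (d k - d (k+2))) + 6 * (d k * d (k+1)))
      = - (RR m j + 3) * (d j * d (j+1)) := by
    intro j
    induction j with
    | zero => simp [hd0]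
    | succ j ih => rw [sum_range_succ, ih]; unfold RR; push_cast; ring
  have h3 : ∀ j, ∑ k ∈ range j, ((d k^2 + d (k+2)^2)/2 - d (k+1)^2)
      = 1/2 * (d (j+1)^2 - d j^2) - 1/2 * d 1 ^2 := by
    intro j
    induction j with
    | zero => simp [hd0]
    | succ j ih => rw [sum_range_succ, ih]; ring
  have h2 := h2 m
  have h3 := h3 m
  rw [hd m le_rfl, hd (m+1) (by omega)] at h2 h3
  have h4 : ∑ k ∈ range m, (d (k+1) * (RR m (k+1) + 3) + (d k - d (k+2)) / 2)^2 ≤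
     ∑ k ∈ range m, (d (k+1)^2 * ((RR m (k+1) + 3)^2 + 1) 
       + ((RR m (k+1) + 3) * (d (k+1) * (d k - d (k+2))) + 6 * (d k * d (k+1)))
       - 6 * (d k * d (k+1)) + ((d k^2 + d (k+2)^2)/2 - d (k+1)^2)) := by
    refine sum_le_sum fun k _ => ?_
    nlinarith [sq_nonneg (d k + d (k+2))]
  rw [sum_add_distrib, sum_sub_distrib, sum_add_distrib, h2, h3, ← mul_sum] at h4
  rw [h1]
  have := sq_nonneg (d 1)
  linarith

lemma D_ph_one (m : ℕ) (d : V) (hd0 : d 0 = 0) (hd : ∀ k, m ≤ k → d k = 0) (a : ℕ) (ha : a < m+1) :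
    D (m+1) (ph d a) (ph d a) = ∑ k ∈ range a, d k ^2 + 19/72 * d a ^2
      - d a * d (a-1) / 6 := by
  have e0 : ∑ k ∈ range (m+1), (if k < a then d k ^2 else 0) = ∑ k ∈ range a, d k ^2 := by
    rw [← sum_filter]
    refine sum_congr ?_ fun _ _ => rfl
    ext k; simp; omega
  by_cases h : d a = 0
  · rw [h, ← e0]
    unfold D ph
    rw [h]
    simp [← pow_two]
  · have ha1 : 1 ≤ a := by
      rcases Nat.eq_zero_or_pos a with rfl | h'
      · exact absurd hd0 h
      · exact h'
    have ham : a < m := by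
      by_contra h'
      exact h (hd a (by omega))
    have : D (m+1) (ph d a) (ph d a) = ∑ k ∈ range (m+1), ((if k < a then d k ^2 else 0) +
      (if k = a then d a ^2 / 4 else 0) + (if k = a + 1 then d a ^2 / 144 else 0) +
      (if k = a - 1 then d a ^2 / 144 - d a * d (a-1) / 6 else 0)) := by
      refine sum_congr rfl fun k hk => ?_
      unfold ph
      by_cases hk1 : k = a - 1
      · have : k + 1 = a := by omega
        subst this
        simp only [Nat.add_sub_cancel]
        simp (disch := omega) only [if_pos, if_neg]
        simp only [if_true]
        ring
      · split_ifs <;> first | omega | ring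
    rw [this]
    simp only [sum_add_distrib]
    rw [e0, sum_ind_eq _ _ _ (by omega), sum_ind_eq _ _ _ (by omega), sum_ind_eq _ _ _ (by omega)]
    ring

lemma D_ph (m : ℕ) (d : V) (hd0 : d 0 = 0) (hd : ∀ k, m ≤ k → d k = 0) :
    ∑ a ∈ range (m+1), wt m a * D (m+1) (ph d a) (ph d a) =
     ∑ k ∈ range m, d (k+1)^2 * (RR m (k+1) + 19/12) - ∑ k ∈ range m, d k * d (k+1) := by
  have h1 : ∀ m, ∑ a ∈ range m, 6 * ∑ k ∈ range a, d k ^2 + 7 * ∑ k ∈ range m, d k ^2 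
      = ∑ k ∈ range m, RR m k * d k ^ 2 := by
    intro m
    induction m with
    | zero => simp
    | succ m ih =>
      have : ∀ k, RR (m+1) k * d k ^2 = RR m k * d k^2 + 6 * d k^2 := by
        intro k; unfold RR; push_cast; ring
      simp only [this, sum_add_distrib, ← mul_sum]
      rw [sum_range_succ _ m, sum_range_succ _ m, sum_range_succ _ m, ← ih]
      have : RR m m = 1 := by unfold RR; ring
      rw [this, ← mul_sum]; ring
  have sh : ∀ f : ℕ → ℝ, f 0 = 0 → f m = 0 → ∑ k ∈ range m, f k = ∑ k ∈ range m, f (k+1) := by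
    intro f h0 hm
    have a1 := sum_range_succ f m
    have a2 := sum_range_succ' f m
    rw [h0] at a2; rw [hm] at a1
    linarith
  rw [sum_congr rfl (fun a ha => by rw [D_ph_one m d hd0 hd a (by simpa using ha)]), sum_range_succ,
    sum_congr rfl (fun a ha => by
      rw [show wt m a = 6 by unfold wt; rw [if_neg]; simp at ha; omega])]
  rw [show wt m m = 7 by unfold wt; simp, hd m le_rfl]
  have h2 : ∑ x ∈ range m, 6 * (∑ k ∈ range x, d k ^ 2 + 19 / 72 * d x ^ 2 - d x * d (x - 1) / 6)
     = ∑ x ∈ range m, 6 * ∑ k ∈ range x, d k ^ 2 + ∑ x ∈ range m, (19 / 12 * d x ^ 2 - d x * d (x - 1)) := by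
    rw [← sum_add_distrib]
    refine sum_congr rfl fun x _ => by ring
  rw [h2]
  have h3 := h1 m
  rw [sh (fun x => 19 / 12 * d x ^ 2 - d x * d (x - 1)) (by simp [hd0]) (by simp [hd])]
  rw [sh (fun k => RR m k * d k ^2) (by simp [hd0]) (by simp [hd])] at h3
  have h4 : ∑ k ∈ range m, d (k+1)^2 * (RR m (k+1) + 19/12) - ∑ k ∈ range m, d k * d (k+1)
     = ∑ k ∈ range m, RR m (k+1) * d (k+1)^2 + ∑ k ∈ range m, (19 / 12 * d (k+1) ^ 2 - d (k+1) * d k) := by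
    rw [← sum_sub_distrib, ← sum_add_distrib]
    refine sum_congr rfl fun x _ => by ring
  rw [h4]
  simp only [Nat.add_sub_cancel]
  linarith

end Oct

namespace Oct
open Finset

noncomputable def DF (m : ℕ) (B : V →ₗ[ℝ] V →ₗ[ℝ] ℝ) (d : V) : ℝ :=
  (6 * m + 8) * (∑ i ∈ range m, (6 * B (al d i) (al d i) - 12 * d i * B (al d i) (uu m i)
    - 6 * (d i)^2 * B (ee i) (uu m i)) + 7 * B (al d m) (al d m)) - B (gg m d) (gg m d)

lemma DF_pos {m : ℕ} {B : V →ₗ[ℝ] V →ₗ[ℝ] ℝ} (hB : IsB (m+1) B) (hm : 2 ≤ m) (d : V) (hd0 : d 0 = 0)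
    (hd : ∀ k, m ≤ k → d k = 0) (hne : ∃ k, d k ≠ 0) : 0 < DF m B d := by
  have hsh : ∑ k ∈ range m, d k ^ 2 = ∑ k ∈ range m, d (k+1) ^ 2 := by
    have a1 := sum_range_succ (fun k => d k ^2) m
    have a2 := sum_range_succ' (fun k => d k ^2) m
    simp only [hd0, hd m le_rfl] at a1 a2
    linarith
  have hS : 0 < ∑ k ∈ range m, d (k+1) ^ 2 := by
    obtain ⟨k, hk⟩ := hne
    rw [← hsh]
    have hkm : k < m := by
      by_contra h'
      exact hk (hd k (by omega))
    exact Finset.sum_pos' (fun i _ => sq_nonneg _) ⟨k, by simpa using hkm, by positivity⟩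
  have h1 : ∑ a ∈ range (m+1), wt m a * B (ph d a) (ph d a) - 5/12 * ∑ k ∈ range m, d (k+1) ^ 2 ≤
     ∑ i ∈ range m, (6 * B (al d i) (al d i) - 12 * d i * B (al d i) (uu m i)
    - 6 * (d i)^2 * B (ee i) (uu m i)) + 7 * B (al d m) (al d m) := by
    have hp : ph d m = al d m := by
      funext k; simp [ph, al, hd m le_rfl]
    rw [sum_range_succ, show wt m m = 7 by unfold wt; simp, hp, ← hsh, mul_sum]
    have : ∑ a ∈ range m, wt m a * B (ph d a) (ph d a) - ∑ k ∈ range m, 5/12 * d k ^ 2 ≤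
       ∑ i ∈ range m, (6 * B (al d i) (al d i) - 12 * d i * B (al d i) (uu m i)
        - 6 * (d i)^2 * B (ee i) (uu m i)) := by
      rw [← sum_sub_distrib]
      refine sum_le_sum fun a ha => ?_
      rw [show wt m a = 6 by unfold wt; rw [if_neg]; simp at ha; omega]
      exact term_bound hB d hd0 a (by simpa using ha)
    linarith
  have hw : ∑ a ∈ range (m+1), wt m a ≤ 6 * m + 8 := by
    rw [sum_range_succ, show wt m m = 7 by unfold wt; simp, sum_congr rfl (fun a ha => by
      rw [show wt m a = 6 by unfold wt; rw [if_neg]; simp at ha; omega])]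
    simp; linarith
  have h2 := jensen (range (m+1)) (wt m) (ph d) (B - (1/10 : ℝ) • Dlin (m+1))
    (fun u v => by
      show B u v - 1/10 * D (m+1) u v = B v u - 1/10 * D (m+1) v u
      rw [hB.symm, D_comm])
    (fun v => by
      show 0 ≤ B v v - 1/10 * D (m+1) v v
      have := Q_lower hB v
      linarith)
    (fun a _ => by unfold wt; split_ifs <;> norm_num) (6 * m + 8) hw
  have h3 : B (gh m d) (gh m d) - 1/10 * D (m+1) (gh m d) (gh m d) ≤ (6 * m + 8) *
     ∑ a ∈ range (m+1), wt m a * (B (ph d a) (ph d a) - 1/10 * D (m+1) (ph d a) (ph d a)) := h2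
  have h4 : ∑ a ∈ range (m+1), wt m a * (B (ph d a) (ph d a) - 1/10 * D (m+1) (ph d a) (ph d a)) =
      ∑ a ∈ range (m+1), wt m a * B (ph d a) (ph d a) - 
      1/10 * ∑ a ∈ range (m+1), wt m a * D (m+1) (ph d a) (ph d a) := by
    rw [mul_sum, ← sum_sub_distrib]
    refine sum_congr rfl fun a _ => by ring
  rw [h4, D_ph m d hd0 hd] at h3
  have h5 := D_gh m d hd0 hd
  have h6 := Q_gg hB (by omega) d hd0 hd
  have h7 : (53/120 * (6 * m + 8) - 81/10 : ℝ) * ∑ k ∈ range m, d (k+1) ^ 2 ≤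
     1/10 * ((6 * m + 8) * ∑ k ∈ range m, d (k+1)^2 * (RR m (k+1) + 19/12)
        - ∑ k ∈ range m, d (k+1)^2 * ((RR m (k+1) + 3)^2 + 1)) + (2 - 5/12 * (6 * m + 8)) * ∑ k ∈ range m, d (k+1) ^ 2 := by
    rw [mul_sum, mul_sum, mul_sum, ← sum_sub_distrib, mul_sum, ← sum_add_distrib]
    refine sum_le_sum fun k hk => ?_
    by_cases hkm : k + 1 = m
    · rw [hd (k+1) (by omega)]; simp
    · have hk2 : k + 2 ≤ m := by simp at hk; omega
      have hk3 : (k:ℝ) + 2 ≤ m := by exact_mod_cast hk2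
      have hk0 : (0:ℝ) ≤ k := Nat.cast_nonneg k
      have : 0 ≤ (RR m (k+1) + 3 - 10) * ((6 * m + 8 - 10) - (RR m (k+1) + 3)) := by
        apply mul_nonneg <;> unfold RR <;> push_cast <;> linarith
      have := mul_nonneg (sq_nonneg (d (k+1))) this
      nlinarith
  have hN : (0:ℝ) ≤ 6 * m + 8 := by positivity
  have h8 := mul_le_mul_of_nonneg_left h1 hN
  have h9 : (53/120 * (6 * m + 8) - 81/10 : ℝ) * ∑ k ∈ range m, d (k+1) ^ 2 - 
     ((6 * m + 8) - 11) / 10 * ∑ k ∈ range m, d k * d (k+1) ≤ DF m B d := by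
    unfold DF
    rw [h6]
    nlinarith
  refine lt_of_lt_of_le ?_ h9
  rcases Nat.eq_or_lt_of_le hm with rfl | hm3
  · have : ∑ k ∈ range 2, d k * d (k+1) = 0 := by
      simp [sum_range_succ, hd0, hd 2 le_rfl]
    rw [this]
    push_cast
    linarith
  · have hm3' : (3:ℝ) ≤ m := by exact_mod_cast hm3
    have : ∑ k ∈ range m, d k * d (k+1) ≤ ∑ k ∈ range m, d (k+1) ^ 2 := by
      have : ∑ k ∈ range m, d k * d (k+1) ≤ ∑ k ∈ range m, (d k ^ 2 / 2 + d (k+1) ^ 2 / 2) :=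
        sum_le_sum fun k _ => by nlinarith [sq_nonneg (d k - d (k+1))]
      rw [sum_add_distrib, ← sum_div, ← sum_div, hsh] at this
      linarith
    nlinarith
end Oct

namespace Oct
open Finset

noncomputable def fv (m : ℕ) (a : ℕ → ℕ) (x : ℕ) : V := fun k =>
  if k < m + 1 then PP (m+1) a k x - (if k = m then 7/2 else 3) else 0

def dv (a : ℕ → ℕ) : V := fun k => (a k : ℝ) - 3

lemma PP_val (m : ℕ) (a : ℕ → ℕ) (k x c : ℕ) (h : min (x - TT a k) (6 * (m+1) + 1 - 6 * k) =
    c + (if k + 1 < m + 1 then min (x - TT a (k+1)) (6 * (m+1) + 1 - 6 * (k+1)) else 0)) :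
    PP (m+1) a k x = c := by
  unfold PP pp
  rw [h]
  split_ifs <;> push_cast <;> ring

lemma fv_top (m : ℕ) (a : ℕ → ℕ) (ha1 : ∀ i, 1 ≤ a i) (ha5 : ∀ i, a i ≤ 5) (i r : ℕ) (hi : i < m)
    (hr : r ≤ a i) : fv m a (TT a i + r) = al (dv a) i + ((r:ℝ) - 3) • ee i - (3:ℝ) • uu m i := by
  funext k
  simp only [Pi.sub_apply, Pi.add_apply, Pi.smul_apply, smul_eq_mul]
  unfold fv al uu ee dv
  have h5 := ha5 i
  have hs := TT_succ a k
  have hsi := TT_succ a i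
  by_cases hk : k < m + 1
  swap
  · split_ifs <;> first | omega | ring
  rcases lt_trichotomy k i with h | h | h
  · rw [PP_val m a k _ (a k)]
    · split_ifs <;> first | omega | ring
    · have := TT_lip a ha5 h.le
      have := TT_lip a ha5 (show k + 1 ≤ i by omega)
      have := TT_mono a ha1 (show k + 1 ≤ i by omega)
      split_ifs <;> omega
  · subst h
    rw [PP_val m a k _ r]
    · split_ifs <;> first | omega | ring
    · split_ifs <;> omega
  · rw [PP_val m a k _ 0]
    · split_ifs <;> first | omega | (push_cast; ring)
    · have := TT_mono a ha1 (show i + 1 ≤ k by omega)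
      split_ifs <;> omega

lemma fv_bot (m : ℕ) (a : ℕ → ℕ) (ha1 : ∀ i, 1 ≤ a i) (ha5 : ∀ i, a i ≤ 5) (i r : ℕ) (hi : i < m)
    (hr : r ≤ 6 - a i) : fv m a (BB (m+1) a (i+1) + r) =
      al (dv a) i + ((a i : ℝ) + r - 3) • ee i + (3:ℝ) • uu m i := by
  funext k
  simp only [Pi.add_apply, Pi.smul_apply, smul_eq_mul]
  unfold fv al uu ee dv BB
  have h5 := ha5 i
  have hs := TT_succ a k
  have hsi := TT_succ a i
  by_cases hk : k < m + 1
  swap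
  · split_ifs <;> first | omega | ring
  rcases lt_trichotomy k i with h | h | h
  · rw [PP_val m a k _ (a k)]
    · split_ifs <;> first | omega | ring
    · have := TT_lip a ha5 h.le
      have := TT_lip a ha5 (show k + 1 ≤ i by omega)
      have := TT_mono a ha1 (show k + 1 ≤ i by omega)
      split_ifs <;> omega
  · subst h
    rw [PP_val m a k _ (a k + r)]
    · split_ifs <;> first | omega | (push_cast; ring)
    · split_ifs <;> omega
  · have := TT_lip a ha5 (show i + 1 ≤ k by omega)
    have := TT_mono a ha1 (show i + 1 ≤ k by omega)
    rw [PP_val m a k _ (if k = m then 7 else 6)]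
    · split_ifs <;> first | omega | (push_cast; ring)
    · have := ha5 k
      split_ifs <;> omega

lemma fv_mid (m : ℕ) (a : ℕ → ℕ) (ha1 : ∀ i, 1 ≤ a i) (ha5 : ∀ i, a i ≤ 5) (r : ℕ)
    (hr : r ≤ 7) : fv m a (TT a m + r) = al (dv a) m + ((r:ℝ) - 7/2) • ee m := by
  funext k
  simp only [Pi.add_apply, Pi.smul_apply, smul_eq_mul]
  unfold fv al ee dv
  have hs := TT_succ a k
  by_cases hk : k < m + 1
  swap
  · split_ifs <;> first | omega | ring
  rcases Nat.lt_or_ge k m with h | h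
  · rw [PP_val m a k _ (a k)]
    · split_ifs <;> first | omega | ring
    · have := TT_lip a ha5 h.le
      have := TT_lip a ha5 (show k + 1 ≤ m by omega)
      have := TT_mono a ha1 (show k + 1 ≤ m by omega)
      split_ifs <;> omega
  · obtain rfl : k = m := by omega
    rw [PP_val k a k _ r]
    · split_ifs <;> first | omega | ring
    · split_ifs <;> omega

lemma seg_split {E : Type*} [AddCommGroup E] (m : ℕ) (a : ℕ → ℕ) (ha5 : ∀ i, a i ≤ 5) (ψ : ℕ → E) (j : ℕ) (hj : j ≤ m) :
    ∑ e ∈ range (6*(m+1)+1), ψ e = ∑ i ∈ range j, (∑ r ∈ range (a i), ψ (TT a i + r)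
      + ∑ r ∈ range (6 - a i), ψ (BB (m+1) a (i+1) + r)) + ∑ r ∈ range (6*(m+1)+1-6*j), ψ (TT a j + r) := by
  induction j with
  | zero => simp [TT_zero]
  | succ j ih =>
    rw [ih (by omega), sum_range_succ _ j, add_assoc]
    congr 1
    have h5 := ha5 j
    have e1 : 6*(m+1)+1-6*j = a j + ((6*(m+1)+1-6*(j+1)) + (6 - a j)) := by omega
    rw [e1, sum_range_add, sum_range_add]
    have e2 : ∀ r, TT a j + (a j + r) = TT a (j+1) + r := fun r => by rw [TT_succ]; ring
    have e3 : ∀ r, TT a (j+1) + ((6*(m+1)+1-6*(j+1)) + r) = BB (m+1) a (j+1) + r := fun r => by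
      unfold BB; ring
    simp only [e2, e3]
    abel

lemma trap {E : Type*} [AddCommGroup E] (φ : ℕ → E) (n : ℕ) :
    ∑ x ∈ range (n+1), φ x + ∑ x ∈ range (n+1), φ x = φ 0 + φ n + ∑ e ∈ range n, (φ e + φ (e+1)) := by
  nth_rewrite 1 [sum_range_succ]
  rw [sum_range_succ', sum_add_distrib]
  abel

lemma group_Q (B : V →ₗ[ℝ] V →ₗ[ℝ] ℝ) (hs : ∀ u v, B u v = B v u) (α e u : V) (a : ℕ) (h1 : 1 ≤ a) (h5 : a ≤ 5) :
    ∑ r ∈ range a, (B (α + ((r:ℝ) - 3) • e - (3:ℝ) • u) (α + ((r:ℝ) - 3) • e - (3:ℝ) • u) +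
      B (α + (((r+1:ℕ):ℝ) - 3) • e - (3:ℝ) • u) (α + (((r+1:ℕ):ℝ) - 3) • e - (3:ℝ) • u)) +
    ∑ r ∈ range (6 - a), (B (α + ((a:ℝ) + r - 3) • e + (3:ℝ) • u) (α + ((a:ℝ) + r - 3) • e + (3:ℝ) • u) +
      B (α + ((a:ℝ) + ((r+1:ℕ):ℝ) - 3) • e + (3:ℝ) • u) (α + ((a:ℝ) + ((r+1:ℕ):ℝ) - 3) • e + (3:ℝ) • u))
    = 2 * (6 * B α α - 12 * ((a:ℝ) - 3) * B α u + 19 * B e e + (54 - 6 * ((a:ℝ)-3)^2) * B e u + 54 * B u u) := by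
  simp only [map_add, map_sub, map_smul, LinearMap.add_apply, LinearMap.sub_apply, LinearMap.smul_apply,
    smul_eq_mul, hs u e, hs u α, hs e α]
  interval_cases a <;> simp [sum_range_succ] <;> ring

lemma group_v (α e u : V) (a : ℕ) (h1 : 1 ≤ a) (h5 : a ≤ 5) :
    ∑ r ∈ range a, ((α + ((r:ℝ) - 3) • e - (3:ℝ) • u) + (α + (((r+1:ℕ):ℝ) - 3) • e - (3:ℝ) • u)) +
    ∑ r ∈ range (6 - a), ((α + ((a:ℝ) + r - 3) • e + (3:ℝ) • u) + (α + ((a:ℝ) + ((r+1:ℕ):ℝ) - 3) • e + (3:ℝ) • u))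
    = (2:ℝ) • (6:ℝ) • (α - ((a:ℝ) - 3) • u) := by
  funext k
  simp only [Pi.add_apply, Finset.sum_apply, Pi.sub_apply, Pi.smul_apply, smul_eq_mul]
  interval_cases a <;> simp [sum_range_succ] <;> ring

lemma mid_Q (B : V →ₗ[ℝ] V →ₗ[ℝ] ℝ) (hs : ∀ u v, B u v = B v u) (α e : V) :
    ∑ r ∈ range 7, (B (α + ((r:ℝ) - 7/2) • e) (α + ((r:ℝ) - 7/2) • e) +
      B (α + (((r+1:ℕ):ℝ) - 7/2) • e) (α + (((r+1:ℕ):ℝ) - 7/2) • e)) = 2 * (7 * B α α + 119/4 * B e e) := by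
  simp only [map_add, map_sub, map_smul, LinearMap.add_apply, LinearMap.sub_apply, LinearMap.smul_apply,
    smul_eq_mul, hs e α]
  simp [sum_range_succ]; ring

lemma mid_v (α e : V) :
    ∑ r ∈ range 7, ((α + ((r:ℝ) - 7/2) • e) + (α + (((r+1:ℕ):ℝ) - 7/2) • e)) = (2:ℝ) • (7:ℝ) • α := by
  funext k
  simp only [Pi.add_apply, Finset.sum_apply, Pi.smul_apply, smul_eq_mul]
  simp [sum_range_succ]; ring

end Oct

namespace Oct
open Finset

noncomputable def CQ (m : ℕ) (B : V →ₗ[ℝ] V →ₗ[ℝ] ℝ) : ℝ :=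
  B ((3:ℝ) • ee 0 + (3:ℝ) • uu m 0) ((3:ℝ) • ee 0 + (3:ℝ) • uu m 0) +
    ∑ i ∈ range m, (19 * B (ee i) (ee i) + 54 * B (ee i) (uu m i) + 54 * B (uu m i) (uu m i))
    + 119/4 * B (ee m) (ee m)

lemma fv_start (m : ℕ) (hm : 1 ≤ m) (a : ℕ → ℕ) (ha1 : ∀ i, 1 ≤ a i) (ha5 : ∀ i, a i ≤ 5) :
    fv m a 0 = - ((3:ℝ) • ee 0 + (3:ℝ) • uu m 0) := by
  have h := fv_top m a ha1 ha5 0 0 (by omega) (by omega)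
  rw [TT_zero] at h
  rw [h]
  funext k
  simp [al]; ring

lemma fv_end (m : ℕ) (hm : 1 ≤ m) (a : ℕ → ℕ) (ha1 : ∀ i, 1 ≤ a i) (ha5 : ∀ i, a i ≤ 5) :
    fv m a (6*(m+1)+1) = ((3:ℝ) • ee 0 + (3:ℝ) • uu m 0) := by
  have h := fv_bot m a ha1 ha5 0 (6 - a 0) (by omega) (by omega)
  have h5 := ha5 0
  have e : BB (m+1) a (0+1) + (6 - a 0) = 6*(m+1)+1 := by
    unfold BB; rw [TT_succ, TT_zero]; omega
  rw [e] at h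
  rw [h]
  funext k
  have h6 : ((6 - a 0 : ℕ) : ℝ) = 6 - a 0 := by rw [Nat.cast_sub (by omega)]; norm_num
  simp only [Pi.add_apply, Pi.smul_apply, smul_eq_mul, h6, al, Nat.not_lt_zero, if_false]
  ring

lemma sum_Q (m : ℕ) (hm : 1 ≤ m) (a : ℕ → ℕ) (ha1 : ∀ i, 1 ≤ a i) (ha5 : ∀ i, a i ≤ 5)
    (B : V →ₗ[ℝ] V →ₗ[ℝ] ℝ) (hs : ∀ u v, B u v = B v u) :
    ∑ x ∈ range (6*(m+1)+2), B (fv m a x) (fv m a x) = CQ m B +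
      (∑ i ∈ range m, (6 * B (al (dv a) i) (al (dv a) i) - 12 * dv a i * B (al (dv a) i) (uu m i)
    - 6 * (dv a i)^2 * B (ee i) (uu m i)) + 7 * B (al (dv a) m) (al (dv a) m)) := by
  have h1 := trap (fun x => B (fv m a x) (fv m a x)) (6*(m+1)+1)
  simp only [fv_start m hm a ha1 ha5, fv_end m hm a ha1 ha5] at h1
  rw [seg_split m a ha5 _ m le_rfl, show 6*(m+1)+1-6*m = 7 by omega] at h1
  have h2 : ∑ r ∈ range 7, (B (fv m a (TT a m + r)) (fv m a (TT a m + r)) + 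
      B (fv m a (TT a m + r + 1)) (fv m a (TT a m + r + 1))) = 
      2 * (7 * B (al (dv a) m) (al (dv a) m) + 119/4 * B (ee m) (ee m)) := by
    rw [← mid_Q B hs]
    refine sum_congr rfl fun r hr => ?_
    have hr : r < 7 := by simpa using hr
    rw [add_assoc (TT a m), fv_mid m a ha1 ha5 r (by omega), fv_mid m a ha1 ha5 (r+1) (by omega)]
  have h3 : ∀ i ∈ range m, (∑ r ∈ range (a i), (B (fv m a (TT a i + r)) (fv m a (TT a i + r)) + 
      B (fv m a (TT a i + r + 1)) (fv m a (TT a i + r + 1))) +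
      ∑ r ∈ range (6 - a i), (B (fv m a (BB (m+1) a (i+1) + r)) (fv m a (BB (m+1) a (i+1) + r)) + 
      B (fv m a (BB (m+1) a (i+1) + r + 1)) (fv m a (BB (m+1) a (i+1) + r + 1)))) = 
      2 * ((6 * B (al (dv a) i) (al (dv a) i) - 12 * dv a i * B (al (dv a) i) (uu m i)
        - 6 * (dv a i)^2 * B (ee i) (uu m i)) + 
        (19 * B (ee i) (ee i) + 54 * B (ee i) (uu m i) + 54 * B (uu m i) (uu m i))) := by
    intro i hi
    have hi : i < m := by simpa using hi
    have := group_Q B hs (al (dv a) i) (ee i) (uu m i) (a i) (ha1 i) (ha5 i)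
    have e1 : ∀ r ∈ range (a i), (B (fv m a (TT a i + r)) (fv m a (TT a i + r)) + 
      B (fv m a (TT a i + r + 1)) (fv m a (TT a i + r + 1))) = _ := fun r hr => by
      have hr : r < a i := by simpa using hr
      rw [add_assoc (TT a i), fv_top m a ha1 ha5 i r hi (by omega), fv_top m a ha1 ha5 i (r+1) hi (by omega)]
    have e2 : ∀ r ∈ range (6 - a i), (B (fv m a (BB (m+1) a (i+1) + r)) (fv m a (BB (m+1) a (i+1) + r)) + 
      B (fv m a (BB (m+1) a (i+1) + r + 1)) (fv m a (BB (m+1) a (i+1) + r + 1))) = _ := fun r hr => by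
      have hr : r < 6 - a i := by simpa using hr
      rw [add_assoc (BB (m+1) a (i+1)), fv_bot m a ha1 ha5 i r hi (by omega), fv_bot m a ha1 ha5 i (r+1) hi (by omega)]
    rw [sum_congr rfl e1, sum_congr rfl e2, this]
    unfold dv
    ring
  rw [h2, sum_congr rfl h3, ← mul_sum, sum_add_distrib] at h1
  simp only [map_neg, LinearMap.neg_apply, neg_neg] at h1
  unfold CQ
  linarith

lemma sum_v (m : ℕ) (hm : 1 ≤ m) (a : ℕ → ℕ) (ha1 : ∀ i, 1 ≤ a i) (ha5 : ∀ i, a i ≤ 5) :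
    ∑ x ∈ range (6*(m+1)+2), fv m a x = gg m (dv a) := by
  have h1 := trap (fun x => fv m a x) (6*(m+1)+1)
  simp only [fv_start m hm a ha1 ha5, fv_end m hm a ha1 ha5] at h1
  rw [seg_split m a ha5 _ m le_rfl, show 6*(m+1)+1-6*m = 7 by omega] at h1
  have h2 : ∑ r ∈ range 7, (fv m a (TT a m + r) + fv m a (TT a m + r + 1)) = 
      (2:ℝ) • (7:ℝ) • al (dv a) m := by
    rw [← mid_v _ (ee m)]
    refine sum_congr rfl fun r hr => ?_
    have hr : r < 7 := by simpa using hr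
    rw [add_assoc (TT a m), fv_mid m a ha1 ha5 r (by omega), fv_mid m a ha1 ha5 (r+1) (by omega)]
  have h3 : ∀ i ∈ range m, (∑ r ∈ range (a i), (fv m a (TT a i + r) + fv m a (TT a i + r + 1)) +
      ∑ r ∈ range (6 - a i), (fv m a (BB (m+1) a (i+1) + r) + fv m a (BB (m+1) a (i+1) + r + 1))) = 
      (2:ℝ) • (6:ℝ) • (al (dv a) i - dv a i • uu m i) := by
    intro i hi
    have hi : i < m := by simpa using hi
    have := group_v (al (dv a) i) (ee i) (uu m i) (a i) (ha1 i) (ha5 i)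
    have e1 : ∀ r ∈ range (a i), (fv m a (TT a i + r) + fv m a (TT a i + r + 1)) = _ := fun r hr => by
      have hr : r < a i := by simpa using hr
      rw [add_assoc (TT a i), fv_top m a ha1 ha5 i r hi (by omega), fv_top m a ha1 ha5 i (r+1) hi (by omega)]
    have e2 : ∀ r ∈ range (6 - a i), (fv m a (BB (m+1) a (i+1) + r) + 
      fv m a (BB (m+1) a (i+1) + r + 1)) = _ := fun r hr => by
      have hr : r < 6 - a i := by simpa using hr
      rw [add_assoc (BB (m+1) a (i+1)), fv_bot m a ha1 ha5 i r hi (by omega), fv_bot m a ha1 ha5 i (r+1) hi (by omega)]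
    rw [sum_congr rfl e1, sum_congr rfl e2, this]
    rfl
  rw [h2, sum_congr rfl h3, ← smul_sum, neg_add_cancel, zero_add, ← two_smul ℝ, ← smul_add] at h1
  exact smul_right_injective V (two_ne_zero) h1

lemma resDist_comm' {W : Type} [Fintype W] (G : SimpleGraph W) (u v : W) : resDist G u v = resDist G v u := by
  unfold resDist; ring

lemma resDist_Q {m : ℕ} (hm : 2 ≤ m) {B : V →ₗ[ℝ] V →ₗ[ℝ] ℝ} (hB : IsB (m+1) B)
    (w : Fin (m + 1 - 2) → Fin 5) (u v : Fin (6*(m+1)+2)) :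
    resDist (octChain (m+1) w) u v = |(pos (m+1) u : ℝ) - pos (m+1) v| -
      B (fv m (aw (m+1) w) (pos (m+1) u) - fv m (aw (m+1) w) (pos (m+1) v))
        (fv m (aw (m+1) w) (pos (m+1) u) - fv m (aw (m+1) w) (pos (m+1) v)) := by
  have key : ∀ u v : Fin (6*(m+1)+2), pos (m+1) v ≤ pos (m+1) u → 
    resDist (octChain (m+1) w) u v = ((pos (m+1) u : ℝ) - pos (m+1) v) -
      B (fv m (aw (m+1) w) (pos (m+1) u) - fv m (aw (m+1) w) (pos (m+1) v))
        (fv m (aw (m+1) w) (pos (m+1) u) - fv m (aw (m+1) w) (pos (m+1) v)) := by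
    intro u v h
    obtain ⟨z, hz⟩ := hB.surj (fv m (aw (m+1) w) (pos (m+1) u) - fv m (aw (m+1) w) (pos (m+1) v))
    have hz' : ∀ k < m+1, (fv m (aw (m+1) w) (pos (m+1) u) - fv m (aw (m+1) w) (pos (m+1) v)) k
       = PP (m+1) (aw (m+1) w) k (pos (m+1) u) - PP (m+1) (aw (m+1) w) k (pos (m+1) v) := by
      intro k hk
      simp only [Pi.sub_apply, fv, if_pos hk]; ring
    rw [resDist_chain (m+1) (by omega) w u v h z (fun k hk => by
      rw [← hz' k hk, ← hz k hk]; rfl)]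
    congr 1
    have e1 : B (fv m (aw (m+1) w) (pos (m+1) u) - fv m (aw (m+1) w) (pos (m+1) v))
        (fv m (aw (m+1) w) (pos (m+1) u) - fv m (aw (m+1) w) (pos (m+1) v)) = D (m+1) z 
        (fv m (aw (m+1) w) (pos (m+1) u) - fv m (aw (m+1) w) (pos (m+1) v)) := by
      rw [← hB.mop]
      exact B_congr_left hB _ (fun k hk => (hz k hk).symm)
    rw [e1]
    unfold D
    refine sum_congr rfl fun k hk => ?_
    rw [hz' k (by simpa using hk)]
  rcases le_total (pos (m+1) v) (pos (m+1) u) with h | h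
  · have h' : (pos (m+1) v : ℝ) ≤ pos (m+1) u := by exact_mod_cast h
    rw [abs_of_nonneg (by linarith), key u v h]
  · have h' : (pos (m+1) u : ℝ) ≤ pos (m+1) v := by exact_mod_cast h
    rw [abs_of_nonpos (by linarith), resDist_comm', key v u h]
    simp only [map_sub, LinearMap.sub_apply]
    ring

lemma kirchhoff_eq {m : ℕ} (hm : 2 ≤ m) {B : V →ₗ[ℝ] V →ₗ[ℝ] ℝ} (hB : IsB (m+1) B)
    (w : Fin (m + 1 - 2) → Fin 5) :
    kirchhoff (octChain (m+1) w) = 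
      (∑ x ∈ range (6*(m+1)+2), ∑ y ∈ range (6*(m+1)+2), |(x:ℝ) - y|) / 2 - (6 * m + 8) * CQ m B
        - DF m B (dv (aw (m+1) w)) := by
  unfold kirchhoff
  simp only [resDist_Q hm hB w]
  have e : ∀ F : ℕ → ℕ → ℝ, ∑ u : Fin (6*(m+1)+2), ∑ v : Fin (6*(m+1)+2), F (pos (m+1) u) (pos (m+1) v)
      = ∑ x ∈ range (6*(m+1)+2), ∑ y ∈ range (6*(m+1)+2), F x y := by
    intro F
    rw [← sum_pos]
    refine sum_congr rfl fun u _ => ?_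
    exact sum_pos (m+1) (fun y => F (pos (m+1) u) y)
  rw [e (fun x y => |(x:ℝ) - y| - B (fv m (aw (m+1) w) x - fv m (aw (m+1) w) y)
        (fv m (aw (m+1) w) x - fv m (aw (m+1) w) y))]
  simp only [sum_sub_distrib]
  have h := pair_sum (range (6*(m+1)+2)) (fun _ => 1) (fv m (aw (m+1) w)) B hB.symm
  simp only [one_mul, one_smul, sum_v m (by omega) _ (aw_ge (m+1) w) (aw_le (m+1) w),
    sum_Q m (by omega) _ (aw_ge (m+1) w) (aw_le (m+1) w) B hB.symm] at h
  rw [h]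
  unfold DF
  simp only [sum_const, card_range, nsmul_eq_mul]
  push_cast
  ring

end Oct

/-- Theorem 1 of the paper. Among all octagonal chains with `n ≥ 3`
octagons, the linear octagonal chain `L_n = O(2,2,…,2)` is the unique chain with maximum
Kirchhoff index: for every `w ≠ (2,…,2)`, `Kf(O(w)) < Kf(L_n)`. -/
theorem linear_chain_unique_max_kirchhoff (n : ℕ) (hn : 3 ≤ n)
    (w : Fin (n - 2) → Fin 5) (hw : w ≠ fun _ => (2 : Fin 5)) :
    kirchhoff (octChain n w) < kirchhoff (octChain n fun _ => (2 : Fin 5)) := by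
  obtain ⟨m, rfl⟩ : ∃ m, n = m + 1 := ⟨n - 1, by omega⟩
  have hm : 2 ≤ m := by omega
  obtain ⟨B, hB⟩ := Oct.exists_B m
  rw [Oct.kirchhoff_eq hm hB, Oct.kirchhoff_eq hm hB]
  have h0 : Oct.dv (Oct.aw (m+1) (fun _ => (2 : Fin 5))) = 0 := by
    funext k
    have : Oct.aw (m+1) (fun _ => (2 : Fin 5)) k = 3 := by
      unfold Oct.aw; split_ifs <;> rfl
    simp only [Oct.dv, this, Pi.zero_apply]; norm_num
  have h1 : Oct.DF m B 0 = 0 := by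
    have ha : ∀ i, Oct.al 0 i = 0 := by intro i; funext k; simp [Oct.al]
    have hg : Oct.gg m 0 = 0 := by simp [Oct.gg, ha]
    simp [Oct.DF, ha, hg]
  have h2 : 0 < Oct.DF m B (Oct.dv (Oct.aw (m+1) w)) := by
    refine Oct.DF_pos hB hm _ ?_ ?_ ?_
    · simp [Oct.dv, Oct.aw_zero]
    · intro k hk
      simp only [Oct.dv, Oct.aw_top (m+1) w k (by omega)]; norm_num
    · by_contra hc
      push Not at hc
      apply hw
      funext j
      have h3 := hc (j + 1)
      simp only [Oct.dv, Oct.aw_succ] at h3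
      have h4 : ((w j : ℕ) : ℝ) = 2 := by push_cast at h3; linarith
      have h5 : (w j : ℕ) = 2 := by exact_mod_cast h4
      exact Fin.ext h5
  rw [h0, h1]
  linarith
end

section
/- Among all octagonal chains with n octagons (n ≥ 3), the helicene octagonal chain D_n = O(0,0,...,0) is the unique chain (up to graph isomorphism) with minimum Kirchhoff index: for every vector w = (w_1,...,w_{n−2}) with each w_i ∈ {0,1,2,3,4} other than (0,0,...,0) and (4,4,...,4), one has Kf(O(w)) > Kf(D_n), and Kf(O(4,4,...,4)) = Kf(D_n). -/
section HelperA
open Finset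

lemma mp_exists {V : Type} [Fintype V] [DecidableEq V] (L : Matrix V V ℝ)
    (hL : L.IsHermitian) : ∃ M, L.IsMoorePenroseInv M := by
  have hs := hL.spectral_theorem
  set U : Matrix V V ℝ := (hL.eigenvectorUnitary : Matrix V V ℝ) with hU
  set d : V → ℝ := hL.eigenvalues with hd
  have hUU : U.transpose * U = 1 := by
    have := (Matrix.mem_unitaryGroup_iff').1 hL.eigenvectorUnitary.2
    simpa [Matrix.star_eq_conjTranspose, hU] using this
  have hLd : L = U * Matrix.diagonal d * U.transpose := by
    rw [hs]
    simp [Unitary.conjStarAlgAut_apply, Matrix.star_eq_conjTranspose, hU, hd]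
  have key : ∀ x y : V → ℝ, (U * Matrix.diagonal x * U.transpose) *
      (U * Matrix.diagonal y * U.transpose) =
      U * Matrix.diagonal (fun i => x i * y i) * U.transpose := by
    intro x y
    calc _ = U * Matrix.diagonal x * (U.transpose * U) * Matrix.diagonal y * U.transpose := by
          simp only [Matrix.mul_assoc]
      _ = _ := by
          rw [hUU, Matrix.mul_one, Matrix.mul_assoc U, Matrix.diagonal_mul_diagonal]
  have kt : ∀ x : V → ℝ, (U * Matrix.diagonal x * U.transpose).transpose =
      U * Matrix.diagonal x * U.transpose := by
    intro x
    simp [Matrix.transpose_mul, Matrix.mul_assoc]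
  refine ⟨U * Matrix.diagonal (fun i => (d i)⁻¹) * U.transpose, ?_, ?_, ?_, ?_⟩
  · rw [hLd, key, key]; congr; ext i; by_cases h : d i = 0 <;> simp [h]
  · rw [hLd, key, key]; congr; ext i; by_cases h : d i = 0 <;> simp [h]
  · rw [hLd, key, kt]
  · rw [hLd, key, kt]

lemma glap_symm {V : Type} [Fintype V] (G : SimpleGraph V) (u v : V) :
    glap G u v = glap G v u := by
  unfold glap
  by_cases h : u = v
  · subst h; rfl
  · have : G.Adj u v ↔ G.Adj v u := G.adj_comm u v
    by_cases h2 : G.Adj u v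
    · simp [h, Ne.symm h, h2, this.1 h2]
    · have h3 : ¬ G.Adj v u := fun h3 => h2 (this.2 h3)
      simp [h, Ne.symm h, h2, h3]

lemma resDist_eq {V : Type} [Fintype V] [DecidableEq V] (G : SimpleGraph V)
    (X : V → V → ℝ) (ℓ : (V → ℝ) → ℝ)
    (h : ∀ f v, ∑ u, f u * ∑ w, glap G u w * X w v = f v + ℓ f) (u v : V) :
    resDist G u v = X u u - X u v - X v u + X v v := by
  have hH : (glap G).IsHermitian := by
    ext i j; simp [glap_symm G i j]
  have hM : (glap G).IsMoorePenroseInv (mpinv (glap G)) := by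
    unfold mpinv
    rw [dif_pos (mp_exists _ hH)]
    exact (mp_exists _ hH).choose_spec
  have hLT : (glap G).transpose = glap G := by
    ext i j; simp [glap_symm G i j]
  set L := glap G
  set M := mpinv L
  set d : V → ℝ := Pi.single u 1 - Pi.single v 1 with hd
  set x : V → ℝ := fun w => X w u - X w v with hx
  have hLx : L.mulVec x = d := by
    ext i
    have h1 := h (Pi.single i 1) u
    have h2 := h (Pi.single i 1) v
    simp only [Pi.single_apply, ite_mul, one_mul, zero_mul, Finset.sum_ite_eq',
      Finset.mem_univ, if_true] at h1 h2
    simp only [Matrix.mulVec, dotProduct, hx, mul_sub, Finset.sum_sub_distrib, hd, Pi.sub_apply,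
      Pi.single_apply]
    rw [h1, h2]
    simp [eq_comm]
  have e1 : d ⬝ᵥ M.mulVec d = M u u - M u v - M v u + M v v := by
    simp [hd, Matrix.mulVec_sub, sub_dotProduct, dotProduct_sub]
    ring
  have e2 : d ⬝ᵥ M.mulVec d = x ⬝ᵥ d := by
    have hv : Matrix.vecMul x L = d := by rw [← hLx, ← Matrix.vecMul_transpose, hLT]
    calc d ⬝ᵥ M.mulVec d = Matrix.vecMul x L ⬝ᵥ M.mulVec (L.mulVec x) := by rw [hv, hLx]
      _ = x ⬝ᵥ d := by
        rw [← Matrix.dotProduct_mulVec, Matrix.mulVec_mulVec, Matrix.mulVec_mulVec,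
          hM.1, hLx]
  have e3 : x ⬝ᵥ d = X u u - X u v - X v u + X v v := by
    simp [hd, hx, dotProduct_sub]
    ring
  show M u u - M u v - M v u + M v v = _
  rw [← e1, e2, e3]

lemma glap_quad {V : Type} [Fintype V] [DecidableEq V] (G : SimpleGraph V)
    (E : V → V → ℝ) (hE : ∀ u v, (G.Adj u v → E u v + E v u = 1) ∧ (¬ G.Adj u v → E u v + E v u = 0))
    (f g : V → ℝ) :
    ∑ u, f u * ∑ w, glap G u w * g w = ∑ u, ∑ w, E u w * ((f w - f u) * (g w - g u)) := by
  classical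
  have h1 : ∀ u, ∑ w, glap G u w * g w = ∑ w, (E u w + E w u) * (g u - g w) := by
    intro u
    have hE' : ∀ w, E u w + E w u = if G.Adj u w then 1 else 0 := by
      intro w
      by_cases hh : G.Adj u w
      · simp [hh, (hE u w).1 hh]
      · simp [hh, (hE u w).2 hh]
    have h2 : ∀ w, glap G u w * g w =
        (if u = w then (∑ t, (if G.Adj u t then (1:ℝ) else 0)) * g u else 0)
          - (if G.Adj u w then 1 else 0) * g w := by
      intro w
      unfold glap
      by_cases hh : u = w
      · subst hh; simp
      · by_cases h3 : G.Adj u w <;> simp [hh, h3]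
    simp only [h2, hE', Finset.sum_sub_distrib, Finset.sum_ite_eq, Finset.mem_univ, if_true, mul_sub,
      Finset.sum_mul]
  simp only [h1, Finset.mul_sum]
  have h3 : ∑ u, ∑ w, f u * ((E u w + E w u) * (g u - g w)) =
      ∑ u, ∑ w, E u w * (f u * (g u - g w)) + ∑ u, ∑ w, E w u * (f u * (g u - g w)) := by
    simp only [← Finset.sum_add_distrib]
    refine Finset.sum_congr rfl fun u _ => Finset.sum_congr rfl fun w _ => by ring
  rw [h3, Finset.sum_comm (f := fun u w => E w u * (f u * (g u - g w)))]
  simp only [← Finset.sum_add_distrib]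
  refine Finset.sum_congr rfl fun u _ => Finset.sum_congr rfl fun w _ => by ring

end HelperA
section HelperB
open Finset

/-- top positions -/
def oT (t : ℕ → ℕ) (k : ℕ) : ℕ := ∑ j ∈ range k, t j
/-- bottom positions -/
def oB (n : ℕ) (s t : ℕ → ℕ) (k : ℕ) : ℕ := oT t k + ∑ j ∈ Ico k n, s j
/-- octagon containing a boundary edge -/
def oO (n : ℕ) (s t : ℕ → ℕ) (e : ℕ) : ℕ :=
  Nat.findGreatest (fun k => oT t k ≤ e ∧ e < oB n s t k) n

variable {n : ℕ} {s t : ℕ → ℕ}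

lemma oT_succ (k : ℕ) : oT t (k+1) = oT t k + t k := by simp [oT, sum_range_succ]

lemma oT_mono {i j : ℕ} (h : i ≤ j) : oT t i ≤ oT t j := by
  induction j, h using Nat.le_induction with
  | base => rfl
  | succ j _ ih => rw [oT_succ]; omega

lemma oB_succ {k : ℕ} (hk : k < n) : oB n s t (k+1) + s k = oB n s t k + t k := by
  unfold oB
  rw [oT_succ, sum_eq_sum_Ico_succ_bot hk]; omega

lemma oB_n : oB n s t n = oT t n := by simp [oB]

lemma oB_anti (hts : ∀ k, t k ≤ s k) {i j : ℕ} (h : i ≤ j) (hj : j ≤ n) :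
    oB n s t j ≤ oB n s t i := by
  induction j, h using Nat.le_induction with
  | base => rfl
  | succ j _ ih =>
    have := ih (by omega)
    have := oB_succ (s := s) (t := t) (k := j) (n := n) (by omega)
    have := hts j
    omega

lemma oT_le_oB (k : ℕ) : oT t k ≤ oB n s t k := by simp [oB]

lemma oO_lt (hn : 0 < n) (e : ℕ) : oO n s t e < n := by
  have h1 : oO n s t e ≤ n := Nat.findGreatest_le n
  rcases Nat.lt_or_ge (oO n s t e) n with h | h
  · exact h
  · have h2 : oO n s t e = n := by omega
    have h3 := (Nat.findGreatest_eq_iff.1 h2).2.1 (by omega)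
    rw [oB_n] at h3
    omega

lemma le_oO (hts : ∀ k, t k ≤ s k) {e k : ℕ} (he : e < oB n s t 0) (hk : k ≤ n) :
    k ≤ oO n s t e ↔ (oT t k ≤ e ∧ e < oB n s t k) := by
  constructor
  · intro h
    have h3 : oT t (oO n s t e) ≤ e ∧ e < oB n s t (oO n s t e) := by
      have h4 := Nat.findGreatest_spec (P := fun k => oT t k ≤ e ∧ e < oB n s t k) (m := 0)
        (Nat.zero_le n) ⟨by simp [oT], he⟩
      exact h4
    have h5 : oO n s t e ≤ n := Nat.findGreatest_le n
    exact ⟨(oT_mono h).trans h3.1, h3.2.trans_le (oB_anti hts h h5)⟩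
  · intro h
    exact Nat.le_findGreatest hk h

lemma oO_eq (hts : ∀ k, t k ≤ s k) {e k : ℕ} (hk : k < n)
    (h : (oT t k ≤ e ∧ e < oT t (k+1)) ∨ (oB n s t (k+1) ≤ e ∧ e < oB n s t k)) :
    oO n s t e = k := by
  have a1 := oB_anti (n := n) hts (Nat.zero_le k) hk.le
  have a2 := oB_anti (n := n) hts (Nat.le_succ k) hk
  have a3 := oT_le_oB (n := n) (s := s) (t := t) (k+1)
  have a4 := oT_mono (t := t) (Nat.le_succ k)
  simp only [Nat.succ_eq_add_one] at *
  have he : e < oB n s t 0 := by omega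
  have h1 := le_oO hts he hk.le
  have h2 := le_oO hts he (k := k+1) hk
  have : k ≤ oO n s t e := h1.2 (by omega)
  have : ¬ (k + 1 ≤ oO n s t e) := fun h => by
    have := h2.1 h
    omega
  omega

lemma groupk (hts : ∀ k, t k ≤ s k) (F : ℕ → ℕ → ℝ) {j : ℕ} (hj : j ≤ n) :
    ∑ e ∈ Ico (oT t j) (oB n s t j), F e (oO n s t e) =
      ∑ k ∈ Ico j n, (∑ e ∈ Ico (oT t k) (oT t (k+1)), F e k +
        ∑ e ∈ Ico (oB n s t (k+1)) (oB n s t k), F e k) := by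
  induction hj using Nat.decreasingInduction with
  | self => simp [oB_n]
  | of_succ k hk ih =>
    rw [sum_eq_sum_Ico_succ_bot hk, ← ih]
    have a2 := oB_anti (n := n) hts (Nat.le_succ k) hk
    have a3 := oT_le_oB (n := n) (s := s) (t := t) (k+1)
    have a4 := oT_mono (t := t) (Nat.le_succ k)
    simp only [Nat.succ_eq_add_one] at *
    rw [← sum_Ico_consecutive _ a4 (a3.trans a2), ← sum_Ico_consecutive _ a3 a2]
    have e1 : ∑ e ∈ Ico (oT t k) (oT t (k+1)), F e (oO n s t e) =
        ∑ e ∈ Ico (oT t k) (oT t (k+1)), F e k :=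
      sum_congr rfl fun e he => by
        rw [oO_eq hts hk (Or.inl (by simpa using he))]
    have e2 : ∑ e ∈ Ico (oB n s t (k+1)) (oB n s t k), F e (oO n s t e) =
        ∑ e ∈ Ico (oB n s t (k+1)) (oB n s t k), F e k :=
      sum_congr rfl fun e he => by
        rw [oO_eq hts hk (Or.inr (by simpa using he))]
    rw [e1, e2]; ring

lemma group0 (hts : ∀ k, t k ≤ s k) (F : ℕ → ℕ → ℝ) :
    ∑ e ∈ range (oB n s t 0), F e (oO n s t e) =
      ∑ k ∈ range n, (∑ e ∈ Ico (oT t k) (oT t (k+1)), F e k +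
        ∑ e ∈ Ico (oB n s t (k+1)) (oB n s t k), F e k) := by
  have := groupk hts F (Nat.zero_le n)
  rw [range_eq_Ico, range_eq_Ico, ← this]; simp [oT]

/-- prefix sums -/
noncomputable def oDel (s : ℕ → ℕ) (a : ℕ → ℝ) (k : ℕ) : ℝ := ∑ j ∈ range k, s j * a j
/-- suffix sums -/
noncomputable def oGam (n : ℕ) (s : ℕ → ℕ) (b : ℕ → ℝ) (k : ℕ) : ℝ := ∑ j ∈ Ico k n, s j * b j
/-- the inverse of the cycle matrix -/
noncomputable def oP (a b : ℕ → ℝ) (W : ℝ) (i j : ℕ) : ℝ := a (min i j) * b (max i j) / W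
/-- tail sums of the rows -/
noncomputable def oE (n : ℕ) (s : ℕ → ℕ) (a b : ℕ → ℝ) (W : ℝ) (k j : ℕ) : ℝ :=
  if k ≤ j then - oDel s a k * b j / W else a j * oGam n s b k / W

/-- The hypotheses on the sequences. -/
structure OH (n : ℕ) (s : ℕ → ℕ) (a b : ℕ → ℝ) (W : ℝ) : Prop where
  W0 : W ≠ 0
  row : ∀ k, k < n → b k * oDel s a k + a k * oGam n s b k = W
  del : ∀ k, k + 1 < n → oDel s a (k+1) = a (k+1) - a k
  gam : ∀ k, k + 1 < n → oGam n s b (k+1) = b k - b (k+1)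

variable {a b : ℕ → ℝ} {W : ℝ}

lemma oDel_succ (k : ℕ) : oDel s a (k+1) = oDel s a k + s k * a k := by
  simp [oDel, sum_range_succ]

lemma oGam_succ {k : ℕ} (hk : k < n) : oGam n s b k = oGam n s b (k+1) + s k * b k := by
  unfold oGam
  rw [sum_eq_sum_Ico_succ_bot hk]; ring

lemma oE_diff (H : OH n s a b W) {k j : ℕ} (hk : k < n) :
    s k * oP a b W k j = (if k = j then 1 else 0) + oE n s a b W k j - oE n s a b W (k+1) j := by
  have hW := H.W0
  rcases lt_trichotomy k j with h | h | h
  · have h1 : k ≤ j := h.le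
    have h2 : k + 1 ≤ j := h
    simp only [oP, oE, h1, h2, if_true, h.ne, if_false, min_eq_left h1, max_eq_right h1, oDel_succ]
    field_simp; ring
  · subst h
    have := H.row k hk
    rw [oGam_succ hk] at this
    have h2 : ¬ (k + 1 ≤ k) := by omega
    simp only [oP, oE, le_refl, h2, if_true, if_false, min_self, max_self]
    field_simp; linarith
  · have h1 : ¬ (k ≤ j) := by omega
    have h2 : ¬ (k + 1 ≤ j) := by omega
    simp only [oP, oE, h1, h2, h.ne', if_false, min_eq_right h.le, max_eq_left h.le, oGam_succ hk]
    field_simp; ring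

lemma oE_tail (H : OH n s a b W) {k j : ℕ} (hk : k ≤ n) (hj : j < n) :
    ∑ i ∈ Ico k n, s i * oP a b W i j = (if k ≤ j then 1 else 0) + oE n s a b W k j := by
  induction hk using Nat.decreasingInduction with
  | self => simp [oE, oGam, not_le.2 hj]
  | of_succ k hk ih =>
    rw [sum_eq_sum_Ico_succ_bot hk, ih, oE_diff H hk]
    rcases lt_trichotomy k j with h | h | h
    · have h2 : k + 1 ≤ j := h
      simp [h.ne, h.le, h2]; ring
    · subst h; simp
    · have h1 : ¬ (k ≤ j) := by omega
      have h2 : ¬ (k + 1 ≤ j) := by omega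
      simp [h1, h2, h.ne']

lemma oE_eq (H : OH n s a b W) {k j : ℕ} (hk : k + 1 < n) :
    oE n s a b W (k+1) j = oP a b W k j - oP a b W (k+1) j := by
  have hW := H.W0
  unfold oE oP
  split_ifs with h
  · rw [H.del k hk, min_eq_left (by omega), min_eq_left h, max_eq_right (by omega),
      max_eq_right h]
    field_simp; ring
  · rw [H.gam k hk, min_eq_right (by omega), min_eq_right (by omega), max_eq_left (by omega),
      max_eq_left (by omega)]
    field_simp

lemma oE_zero (j : ℕ) : oE n s a b W 0 j = 0 := by simp [oE, oDel]

lemma count_clamp (x y v : ℕ) (hxy : x ≤ y) :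
    (∑ f ∈ range v, if x ≤ f ∧ f < y then (1:ℝ) else 0) =
      ((x:ℝ) + y + |(x:ℝ) - v| - |(y:ℝ) - v|) / 2 - x := by
  induction v with
  | zero => simp; ring
  | succ v ih =>
    rw [sum_range_succ, ih]
    push_cast
    have hxy' : (x:ℝ) ≤ y := by exact_mod_cast hxy
    rcases Nat.lt_or_ge v x with h | h
    · have h' : (v:ℝ) + 1 ≤ x := by exact_mod_cast h
      rw [if_neg (by omega), abs_of_nonneg (by linarith), abs_of_nonneg (by linarith),
        abs_of_nonneg (by linarith), abs_of_nonneg (by linarith)]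
      ring
    · have h0 : (x:ℝ) ≤ v := by exact_mod_cast h
      rcases Nat.lt_or_ge v y with h1 | h1
      · have h' : (v:ℝ) + 1 ≤ y := by exact_mod_cast h1
        rw [if_pos ⟨h, h1⟩, abs_of_nonpos (by linarith), abs_of_nonneg (by linarith),
          abs_of_nonpos (by linarith), abs_of_nonneg (by linarith)]
        ring
      · have h' : (y:ℝ) ≤ v := by exact_mod_cast h1
        rw [if_neg (by omega), abs_of_nonpos (by linarith), abs_of_nonpos (by linarith),
          abs_of_nonpos (by linarith), abs_of_nonpos (by linarith)]
        ring

lemma oct_sign_sum (f : ℕ → ℝ) (v m : ℕ) (hv : v ≤ m) :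
    ∑ u ∈ range m, (f (u+1) - f u) * (if v ≤ u then (1:ℝ) else -1) = f m - 2 * f v + f 0 := by
  induction m, hv using Nat.le_induction with
  | base =>
    have : ∀ u ∈ range v, (f (u+1) - f u) * (if v ≤ u then (1:ℝ) else -1) = -(f (u+1) - f u) := by
      intro u hu
      rw [if_neg (by simpa using hu)]; ring
    rw [sum_congr rfl this, sum_neg_distrib, sum_range_sub]; ring
  | succ m hm ih => rw [sum_range_succ, ih, if_pos hm]; ring

lemma abs_step (u v : ℕ) : |((u+1:ℕ):ℝ) - v| - |(u:ℝ) - v| = if v ≤ u then 1 else -1 := by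
  push_cast
  split_ifs with h
  · have h' : (v:ℝ) ≤ u := by exact_mod_cast h
    rw [abs_of_nonneg (by linarith), abs_of_nonneg (by linarith)]; ring
  · have h' : (u:ℝ) + 1 ≤ v := by exact_mod_cast (not_le.1 h)
    rw [abs_of_nonpos (by linarith), abs_of_nonpos (by linarith)]; ring

/-- Green function -/
noncomputable def oX (n : ℕ) (s t : ℕ → ℕ) (a b : ℕ → ℝ) (W : ℝ) (u v : ℕ) : ℝ :=
  - |(u:ℝ) - v| / 2 - ∑ e ∈ range u, ∑ f ∈ range v, oP a b W (oO n s t e) (oO n s t f)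

lemma weak {m : ℕ} (hts : ∀ k, t k ≤ s k) (H : OH (m+1) s a b W) (M v : ℕ)
    (hM : oB (m+1) s t 0 = M + 1) (hv : v ≤ M) (h0 : oO (m+1) s t M = 0)
    (f : ℕ → ℝ) (hf : f (M+1) = f M) :
    ∑ u ∈ range M, (f (u+1) - f u) * (oX (m+1) s t a b W (u+1) v - oX (m+1) s t a b W u v)
      + (f M - f 0) * (oX (m+1) s t a b W M v - oX (m+1) s t a b W 0 v)
      + ∑ k ∈ range m, (f (oB (m+1) s t (k+1)) - f (oT t (k+1))) *
        (oX (m+1) s t a b W (oB (m+1) s t (k+1)) v - oX (m+1) s t a b W (oT t (k+1)) v)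
    = f v + (-(f M + f 0)/2 - (f M - f 0) * M / 2 -
      ∑ k ∈ range m, (f (oB (m+1) s t (k+1)) - f (oT t (k+1))) *
        ((oB (m+1) s t (k+1) : ℝ) - oT t (k+1)) / 2) := by
  set ψ : ℕ → ℝ := fun i => ∑ f ∈ range v, oP a b W i (oO (m+1) s t f) with hψ
  have hX : ∀ u, oX (m+1) s t a b W u v = - |(u:ℝ) - v| / 2 - ∑ e ∈ range u, ψ (oO (m+1) s t e) :=
    fun u => rfl
  have hstep : ∀ u, oX (m+1) s t a b W (u+1) v - oX (m+1) s t a b W u v =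
      - (if v ≤ u then (1:ℝ) else -1) / 2 - ψ (oO (m+1) s t u) := by
    intro u
    rw [hX, hX, sum_range_succ, ← abs_step]; ring
  set h : ℕ → ℝ := fun k => f (oB (m+1) s t k) - f (oT t k) with hh
  have hhn : h (m+1) = 0 := by simp [hh, oB_n]
  have hh0 : h 0 = f M - f 0 := by simp [hh, hM, hf, oT]
  -- path part
  have p1 : ∑ u ∈ range M, (f (u+1) - f u) * (oX (m+1) s t a b W (u+1) v - oX (m+1) s t a b W u v)
      = -(f M - 2 * f v + f 0) / 2 - ∑ k ∈ range (m+1), ψ k * (h k - h (k+1)) := by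
    have e0 : ∑ u ∈ range (M+1), (f (u+1) - f u) * ψ (oO (m+1) s t u) =
        ∑ k ∈ range (m+1), ψ k * (h k - h (k+1)) := by
      rw [← hM, group0 hts (fun e k => (f (e+1) - f e) * ψ k)]
      refine sum_congr rfl fun k hk => ?_
      have hk' : k < m + 1 := by simpa using hk
      rw [← sum_mul, ← sum_mul, sum_Ico_sub f (oT_mono (Nat.le_succ k)),
        sum_Ico_sub f (oB_anti hts (Nat.le_succ k) hk')]
      simp only [hh, Nat.succ_eq_add_one]; ring
    rw [sum_range_succ, hf, sub_self, zero_mul, add_zero] at e0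
    rw [← e0, ← oct_sign_sum f v M hv, neg_div, sum_div, ← sum_neg_distrib, ← sum_sub_distrib]
    refine sum_congr rfl fun u _ => ?_
    rw [hstep]; ring
  have tail : ∀ k, k ≤ m + 1 → ∑ e ∈ range (oB (m+1) s t k), ψ (oO (m+1) s t e) -
      ∑ e ∈ range (oT t k), ψ (oO (m+1) s t e) =
      ∑ f ∈ range v, ((if k ≤ oO (m+1) s t f then 1 else 0) + oE (m+1) s a b W k (oO (m+1) s t f)) := by
    intro k hk
    rw [← sum_Ico_eq_sub _ (oT_le_oB k), groupk hts (fun _ k => ψ k) hk]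
    have : ∀ i ∈ Ico k (m+1), (∑ e ∈ Ico (oT t i) (oT t (i+1)), ψ i +
        ∑ e ∈ Ico (oB (m+1) s t (i+1)) (oB (m+1) s t i), ψ i) = s i * ψ i := by
      intro i hi
      have hi' : i < m + 1 := (mem_Ico.1 hi).2
      have a2 := oB_anti (n := m+1) hts (Nat.le_succ i) hi'
      have a5 := oB_succ (s := s) (t := t) hi'
      simp only [sum_const, Nat.card_Ico, nsmul_eq_mul]
      rw [← add_mul]
      congr 1
      rw [← Nat.cast_add]
      congr 1
      rw [oT_succ]
      simp only [Nat.succ_eq_add_one] at *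
      omega
    rw [sum_congr rfl this]
    simp only [hψ, mul_sum]
    rw [sum_comm]
    exact sum_congr rfl fun f _ => oE_tail H hk (oO_lt (by omega) f)
  have c1 : ∀ k ∈ range m, (f (oB (m+1) s t (k+1)) - f (oT t (k+1))) *
        (oX (m+1) s t a b W (oB (m+1) s t (k+1)) v - oX (m+1) s t a b W (oT t (k+1)) v) =
      - (f (oB (m+1) s t (k+1)) - f (oT t (k+1))) *
        ((oB (m+1) s t (k+1) : ℝ) - oT t (k+1)) / 2 + h (k+1) * (ψ (k+1) - ψ k) := by
    intro k hk
    have hk' : k < m := by simpa using hk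
    have t1 := tail (k+1) (by omega)
    have t2 : ∑ f ∈ range v, (if k+1 ≤ oO (m+1) s t f then (1:ℝ) else 0) =
        ∑ f ∈ range v, if oT t (k+1) ≤ f ∧ f < oB (m+1) s t (k+1) then (1:ℝ) else 0 := by
      refine sum_congr rfl fun f hf => ?_
      have : f < v := by simpa using hf
      simp only [le_oO hts (n := m+1) (e := f) (k := k+1) (by omega) (by omega)]
    rw [sum_add_distrib, t2, count_clamp _ _ _ (oT_le_oB _)] at t1
    have t3 : ∑ f ∈ range v, oE (m+1) s a b W (k+1) (oO (m+1) s t f) = ψ k - ψ (k+1) := by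
      simp only [hψ, ← sum_sub_distrib]
      exact sum_congr rfl fun f _ => oE_eq H (by omega)
    rw [t3] at t1
    have t4 : oX (m+1) s t a b W (oB (m+1) s t (k+1)) v - oX (m+1) s t a b W (oT t (k+1)) v =
      - ((oB (m+1) s t (k+1) : ℝ) - oT t (k+1)) / 2 + (ψ (k+1) - ψ k) := by
      rw [hX, hX]; linarith
    rw [t4]; simp only [hh]; ring
  have c0 : oX (m+1) s t a b W M v - oX (m+1) s t a b W 0 v = - (M:ℝ) / 2 + ψ 0 := by
    have t1 := tail 0 (by omega)
    simp only [oE_zero, Nat.zero_le, if_true, add_zero, sum_const, card_range, nsmul_eq_mul,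
      mul_one, hM, sum_range_succ, h0] at t1
    rw [hX, hX]
    simp only [oT, range_zero, sum_empty, sub_zero] at t1 ⊢
    have hv' : (v:ℝ) ≤ M := by exact_mod_cast hv
    rw [abs_of_nonneg (by linarith)]
    have : |((0:ℕ):ℝ) - v| = v := by simp
    rw [this]; linarith
  rw [p1, c0, sum_congr rfl c1, sum_add_distrib]
  have fin : ∑ k ∈ range (m+1), ψ k * (h k - h (k+1)) =
      h 0 * ψ 0 + ∑ k ∈ range m, h (k+1) * (ψ (k+1) - ψ k) := by
    have e1 : ∑ k ∈ range (m+1), ψ k * (h k - h (k+1)) =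
      ∑ k ∈ range (m+1), ψ k * h k - ∑ k ∈ range (m+1), ψ k * h (k+1) := by
      rw [← sum_sub_distrib]; exact sum_congr rfl fun k _ => by ring
    rw [e1, sum_range_succ', sum_range_succ (fun k => ψ k * h (k+1)), hhn]
    have e2 : ∑ k ∈ range m, h (k+1) * (ψ (k+1) - ψ k) =
      ∑ k ∈ range m, ψ (k+1) * h (k+1) - ∑ k ∈ range m, ψ k * h (k+1) := by
      rw [← sum_sub_distrib]; exact sum_congr rfl fun k _ => by ring
    rw [e2]; ring
  rw [fin, hh0]
  have : ∑ x ∈ range m, -(f (oB (m+1) s t (x+1)) - f (oT t (x+1))) *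
        ((oB (m+1) s t (x+1) : ℝ) - oT t (x+1)) / 2 = -
      ∑ k ∈ range m, (f (oB (m+1) s t (k+1)) - f (oT t (k+1))) *
        ((oB (m+1) s t (k+1) : ℝ) - oT t (k+1)) / 2 := by
    rw [← sum_neg_distrib]; exact sum_congr rfl fun k _ => by ring
  rw [this]; ring

end HelperB
section HelperC
open Finset

/-- oriented edge indicator -/
noncomputable def oInd (M m : ℕ) (τ β : ℕ → ℕ) (u v : ℕ) : ℝ :=
  (if u + 1 = v then 1 else 0) + (if u = 0 ∧ v = M then 1 else 0) +
    ∑ k ∈ range m, if u = τ k ∧ v = β k then 1 else 0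

lemma oInd_chord (m : ℕ) (τ β : ℕ → ℕ) (hinj : ∀ i j, i < m → j < m → τ i = τ j → i = j)
    (u v : ℕ) [Decidable (∃ k, k < m ∧ u = τ k ∧ v = β k)] :
    (∑ k ∈ range m, if u = τ k ∧ v = β k then (1:ℝ) else 0) =
      if ∃ k, k < m ∧ u = τ k ∧ v = β k then 1 else 0 := by
  split_ifs with h
  · obtain ⟨k, hk, h1, h2⟩ := h
    rw [sum_eq_single k]
    · simp [h1, h2]
    · intro j hj hjk
      rw [if_neg]
      rintro ⟨h3, -⟩
      exact hjk (hinj j k (by simpa using hj) hk (by omega))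
    · intro h; exact absurd (mem_range.2 hk) h
  · refine sum_eq_zero fun k hk => ?_
    rw [if_neg]
    intro h3
    exact h ⟨k, by simpa using hk, h3⟩

lemma oInd_aux (p q : Prop) [Decidable p] [Decidable q] (x y M : ℕ) (hM : 2 ≤ M)
    (hx : x < M + 1) (hy : y < M + 1) (h1 : p → 0 < x ∧ x + 1 < y) (h2 : q → 0 < y ∧ y + 1 < x) :
    ((¬ x = y ∧ ((x + 1 = y ∨ (x = M ∧ y = 0) ∨ p) ∨ (y + 1 = x ∨ (y = M ∧ x = 0) ∨ q))) →
      (if x + 1 = y then (1:ℝ) else 0) + (if x = 0 ∧ y = M then 1 else 0) + (if p then 1 else 0) +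
      ((if y + 1 = x then (1:ℝ) else 0) + (if y = 0 ∧ x = M then 1 else 0) + (if q then 1 else 0))
        = 1) ∧
    (¬ (¬ x = y ∧ ((x + 1 = y ∨ (x = M ∧ y = 0) ∨ p) ∨ (y + 1 = x ∨ (y = M ∧ x = 0) ∨ q))) →
      (if x + 1 = y then (1:ℝ) else 0) + (if x = 0 ∧ y = M then 1 else 0) + (if p then 1 else 0) +
      ((if y + 1 = x then (1:ℝ) else 0) + (if y = 0 ∧ x = M then 1 else 0) + (if q then 1 else 0))
        = 0) := by
  by_cases hp : p
  · have g1 := h1 hp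
    have hq : ¬ q := fun hq => by have := h2 hq; omega
    rw [if_pos hp, if_neg hq, if_neg (show ¬ x + 1 = y by omega),
      if_neg (show ¬ (x = 0 ∧ y = M) by omega), if_neg (show ¬ y + 1 = x by omega),
      if_neg (show ¬ (y = 0 ∧ x = M) by omega)]
    refine ⟨fun _ => by norm_num, fun h => ?_⟩
    exact absurd ⟨by omega, Or.inl (Or.inr (Or.inr hp))⟩ h
  · by_cases hq : q
    · have g1 := h2 hq
      rw [if_pos hq, if_neg hp, if_neg (show ¬ x + 1 = y by omega),
        if_neg (show ¬ (x = 0 ∧ y = M) by omega), if_neg (show ¬ y + 1 = x by omega),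
        if_neg (show ¬ (y = 0 ∧ x = M) by omega)]
      refine ⟨fun _ => by norm_num, fun h => ?_⟩
      exact absurd ⟨by omega, Or.inr (Or.inr (Or.inr hq))⟩ h
    · clear h1 h2
      simp only [hp, hq, or_false, if_false]
      constructor
      · intro h
        split_ifs <;> first | omega | norm_num
      · intro h
        split_ifs <;> first | omega | norm_num

lemma oInd_spec (M m : ℕ) (hM : 2 ≤ M) (τ β : ℕ → ℕ)
    (hinj : ∀ i j, i < m → j < m → τ i = τ j → i = j)
    (hpos : ∀ k, k < m → 0 < τ k ∧ τ k + 1 < β k)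
    (G : SimpleGraph (Fin (M+1)))
    (hG : ∀ u v, G.Adj u v ↔ (u ≠ v ∧ (((u:ℕ) + 1 = v ∨ ((u:ℕ) = M ∧ (v:ℕ) = 0) ∨
      ∃ k, k < m ∧ (u:ℕ) = τ k ∧ (v:ℕ) = β k) ∨ ((v:ℕ) + 1 = u ∨ ((v:ℕ) = M ∧ (u:ℕ) = 0) ∨
      ∃ k, k < m ∧ (v:ℕ) = τ k ∧ (u:ℕ) = β k)))) (u v : Fin (M+1)) :
    (G.Adj u v → oInd M m τ β u v + oInd M m τ β v u = 1) ∧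
    (¬ G.Adj u v → oInd M m τ β u v + oInd M m τ β v u = 0) := by
  classical
  rw [hG]
  unfold oInd
  rw [oInd_chord m τ β hinj, oInd_chord m τ β hinj]
  have h1 : (∃ k, k < m ∧ (u:ℕ) = τ k ∧ (v:ℕ) = β k) → 0 < (u:ℕ) ∧ (u:ℕ) + 1 < v := by
    rintro ⟨k, hk, e1, e2⟩
    have := hpos k hk
    omega
  have h2 : (∃ k, k < m ∧ (v:ℕ) = τ k ∧ (u:ℕ) = β k) → 0 < (v:ℕ) ∧ (v:ℕ) + 1 < u := by
    rintro ⟨k, hk, e1, e2⟩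
    have := hpos k hk
    omega
  rw [ne_eq, Fin.ext_iff]
  exact oInd_aux _ _ _ _ M hM (by omega) (by omega) h1 h2

lemma oInd_sum (M m : ℕ) (τ β : ℕ → ℕ)
    (hpos : ∀ k, k < m → τ k < M + 1 ∧ β k < M + 1) (F : ℕ → ℕ → ℝ) :
    ∑ u : Fin (M+1), ∑ v : Fin (M+1), oInd M m τ β u v * F u v =
      ∑ u ∈ range M, F u (u+1) + F 0 M + ∑ k ∈ range m, F (τ k) (β k) := by
  have e0 : ∑ u : Fin (M+1), ∑ v : Fin (M+1), oInd M m τ β u v * F u v =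
      ∑ u ∈ range (M+1), ∑ v ∈ range (M+1), oInd M m τ β u v * F u v := by
    rw [← Fin.sum_univ_eq_sum_range (fun u => ∑ v ∈ range (M+1), oInd M m τ β u v * F u v)]
    refine sum_congr rfl fun u _ => ?_
    rw [← Fin.sum_univ_eq_sum_range (fun v => oInd M m τ β u v * F u v)]
  rw [e0]
  unfold oInd
  simp only [add_mul, sum_add_distrib]
  congr 1
  · congr 1
    · rw [sum_range_succ]
      have z : ∑ v ∈ range (M+1), (if M + 1 = v then (1:ℝ) else 0) * F M v = 0 := by
        refine sum_eq_zero fun v hv => ?_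
        rw [if_neg (by simp at hv; omega), zero_mul]
      rw [z, add_zero]
      refine sum_congr rfl fun u hu => ?_
      have hu' : u < M := by simpa using hu
      rw [sum_eq_single (u+1)]
      · simp
      · intro v _ hv; rw [if_neg (by omega), zero_mul]
      · intro h; simp at h; omega
    · rw [sum_eq_single 0]
      · rw [sum_eq_single M]
        · simp
        · intro v _ hv; rw [if_neg (by omega), zero_mul]
        · intro h; simp at h
      · intro v _ hv; exact sum_eq_zero fun w _ => by rw [if_neg (by omega), zero_mul]
      · intro h; simp at h
  · simp only [sum_mul]
    have : ∀ u ∈ range (M+1), ∑ v ∈ range (M+1), ∑ k ∈ range m,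
        (if u = τ k ∧ v = β k then (1:ℝ) else 0) * F u v = ∑ k ∈ range m, ∑ v ∈ range (M+1),
        (if u = τ k ∧ v = β k then (1:ℝ) else 0) * F u v := fun u _ => sum_comm
    rw [sum_congr rfl this, sum_comm]
    refine sum_congr rfl fun k hk => ?_
    obtain ⟨h1, h2⟩ := hpos k (by simpa using hk)
    rw [sum_eq_single (τ k)]
    · rw [sum_eq_single (β k)]
      · simp
      · intro v _ hv; rw [if_neg (by omega), zero_mul]
      · intro h; simp at h; omega
    · intro v _ hv; exact sum_eq_zero fun w _ => by rw [if_neg (by omega), zero_mul]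
    · intro h; simp at h; omega

lemma sum_pre (M : ℕ) (F : ℕ → ℝ) :
    ∑ u ∈ range (M+1), ∑ e ∈ range u, F e = ∑ e ∈ range (M+1), ((M:ℝ) - e) * F e := by
  induction M with
  | zero => simp
  | succ M ih =>
    rw [sum_range_succ, ih, sum_range_succ _ (M+1)]
    push_cast
    rw [sub_self, zero_mul, add_zero, ← sum_add_distrib]
    exact sum_congr rfl fun e _ => by ring

lemma sum_pre2 (M : ℕ) (Q : ℕ → ℕ → ℝ) :
    ∑ u ∈ range (M+1), ∑ e ∈ range u, ∑ f ∈ range u, Q e f =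
      ∑ e ∈ range (M+1), ∑ f ∈ range (M+1), ((M:ℝ) - (max e f : ℕ)) * Q e f := by
  induction M with
  | zero => simp
  | succ M ih =>
    rw [sum_range_succ, ih, sum_range_succ _ (M+1)]
    have z : ∑ f ∈ range (M+1+1), (((M+1:ℕ):ℝ) - (max (M+1) f : ℕ)) * Q (M+1) f = 0 := by
      refine sum_eq_zero fun f hf => ?_
      rw [max_eq_left (by simp at hf; omega)]; simp
    rw [z, add_zero, ← sum_add_distrib]
    refine sum_congr rfl fun e he => ?_
    rw [sum_range_succ _ (M+1), max_eq_right (by simp at he; omega), sub_self, zero_mul, add_zero,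
      ← sum_add_distrib]
    exact sum_congr rfl fun f _ => by push_cast; ring

lemma kf_of_green (M : ℕ) (G : SimpleGraph (Fin (M+1))) (Q : ℕ → ℕ → ℝ)
    (h : ∀ u v : Fin (M+1), resDist G u v =
      |((u:ℕ):ℝ) - (v:ℕ)| - (∑ e ∈ range u, ∑ f ∈ range u, Q e f - ∑ e ∈ range u, ∑ f ∈ range v, Q e f
        - ∑ e ∈ range v, ∑ f ∈ range u, Q e f + ∑ e ∈ range v, ∑ f ∈ range v, Q e f)) :
    kirchhoff G = (∑ u ∈ range (M+1), ∑ v ∈ range (M+1), |(u:ℝ) - v|) / 2 -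
      ∑ e ∈ range (M+1), ∑ f ∈ range (M+1),
        Q e f * (((M:ℝ)+1) * (M - (max e f : ℕ)) - (M - e) * (M - f)) := by
  unfold kirchhoff
  simp only [h]
  have e0 : ∀ F : ℕ → ℕ → ℝ, ∑ u : Fin (M+1), ∑ v : Fin (M+1), F u v =
      ∑ u ∈ range (M+1), ∑ v ∈ range (M+1), F u v := by
    intro F
    rw [← Fin.sum_univ_eq_sum_range (fun u => ∑ v ∈ range (M+1), F u v)]
    refine sum_congr rfl fun u _ => ?_
    rw [← Fin.sum_univ_eq_sum_range (fun v => F u v)]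
  rw [e0 (fun u v => |(u:ℝ) - v| - (∑ e ∈ range u, ∑ f ∈ range u, Q e f -
      ∑ e ∈ range u, ∑ f ∈ range v, Q e f
        - ∑ e ∈ range v, ∑ f ∈ range u, Q e f + ∑ e ∈ range v, ∑ f ∈ range v, Q e f))]
  simp only [sum_sub_distrib, sum_add_distrib, sum_const, card_range, nsmul_eq_mul, ← mul_sum]
  have c1 : ∑ u ∈ range (M+1), ∑ v ∈ range (M+1), ∑ e ∈ range u, ∑ f ∈ range v, Q e f =
      ∑ e ∈ range (M+1), ∑ f ∈ range (M+1), Q e f * (((M:ℝ) - e) * (M - f)) := by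
    have : ∀ u ∈ range (M+1), ∑ v ∈ range (M+1), ∑ e ∈ range u, ∑ f ∈ range v, Q e f =
      ∑ e ∈ range u, ∑ f ∈ range (M+1), ((M:ℝ) - f) * Q e f := by
      intro u _
      rw [sum_comm]
      exact sum_congr rfl fun e _ => sum_pre M (Q e)
    rw [sum_congr rfl this, sum_pre]
    refine sum_congr rfl fun e _ => ?_
    rw [mul_sum]
    exact sum_congr rfl fun f _ => by ring
  have c2 : ∑ u ∈ range (M+1), ∑ v ∈ range (M+1), ∑ e ∈ range v, ∑ f ∈ range u, Q e f =
      ∑ e ∈ range (M+1), ∑ f ∈ range (M+1), Q e f * (((M:ℝ) - e) * (M - f)) := by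
    rw [sum_comm, c1]
  rw [c1, c2, sum_pre2]
  have c3 : ∑ e ∈ range (M+1), ∑ f ∈ range (M+1),
        Q e f * (((M:ℝ)+1) * (M - (max e f : ℕ)) - (M - e) * (M - f)) =
      ((M:ℝ)+1) * ∑ e ∈ range (M+1), ∑ f ∈ range (M+1), ((M:ℝ) - (max e f : ℕ)) * Q e f -
      ∑ e ∈ range (M+1), ∑ f ∈ range (M+1), Q e f * (((M:ℝ) - e) * (M - f)) := by
    rw [mul_sum, ← sum_sub_distrib]
    refine sum_congr rfl fun e _ => ?_
    rw [mul_sum, ← sum_sub_distrib]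
    exact sum_congr rfl fun f _ => by ring
  rw [c3]
  push_cast
  ring

lemma kf_chain {m : ℕ} {s t : ℕ → ℕ} {a b : ℕ → ℝ} {W : ℝ}
    (hts : ∀ k, t k ≤ s k) (H : OH (m+1) s a b W) (M : ℕ) (hM2 : 2 ≤ M)
    (hM : oB (m+1) s t 0 = M + 1) (h0 : oO (m+1) s t M = 0)
    (htp : ∀ k, 0 < t k) (hB : ∀ k, k < m → oT t (k+1) + 1 < oB (m+1) s t (k+1))
    (hB1 : ∀ k, k < m → oB (m+1) s t (k+1) ≤ M)
    (G : SimpleGraph (Fin (M+1)))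
    (hG : ∀ u v, G.Adj u v ↔ (u ≠ v ∧ (((u:ℕ) + 1 = v ∨ ((u:ℕ) = M ∧ (v:ℕ) = 0) ∨
      ∃ k, k < m ∧ (u:ℕ) = oT t (k+1) ∧ (v:ℕ) = oB (m+1) s t (k+1)) ∨
      ((v:ℕ) + 1 = u ∨ ((v:ℕ) = M ∧ (u:ℕ) = 0) ∨
      ∃ k, k < m ∧ (v:ℕ) = oT t (k+1) ∧ (u:ℕ) = oB (m+1) s t (k+1))))) :
    kirchhoff G = (∑ u ∈ range (M+1), ∑ v ∈ range (M+1), |(u:ℝ) - v|) / 2 -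
      ∑ e ∈ range (M+1), ∑ f ∈ range (M+1),
        oP a b W (oO (m+1) s t e) (oO (m+1) s t f) *
          (((M:ℝ)+1) * (M - (max e f : ℕ)) - (M - e) * (M - f)) := by
  apply kf_of_green
  have hstrict : ∀ i j, i < j → oT t i < oT t j := by
    intro i j hij
    have h1 := oT_mono (t := t) (show i + 1 ≤ j from hij)
    rw [oT_succ] at h1
    have := htp i
    omega
  have hinj : ∀ i j, i < m → j < m → oT t (i+1) = oT t (j+1) → i = j := by
    intro i j _ _ h
    rcases lt_trichotomy i j with h1 | h1 | h1
    · have := hstrict (i+1) (j+1) (by omega); omega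
    · exact h1
    · have := hstrict (j+1) (i+1) (by omega); omega
  have hpos : ∀ k, k < m → 0 < oT t (k+1) ∧ oT t (k+1) + 1 < oB (m+1) s t (k+1) := by
    intro k hk
    have := hstrict 0 (k+1) (by omega)
    exact ⟨by omega, hB k hk⟩
  have hE := oInd_spec M m hM2 (fun k => oT t (k+1)) (fun k => oB (m+1) s t (k+1)) hinj hpos G hG
  intro u v
  have key := resDist_eq G (fun u v => oX (m+1) s t a b W u v)
    (fun f => (fun f : ℕ → ℝ => (-(f M + f 0)/2 - (f M - f 0) * M / 2 -
      ∑ k ∈ range m, (f (oB (m+1) s t (k+1)) - f (oT t (k+1))) *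
        ((oB (m+1) s t (k+1) : ℝ) - oT t (k+1)) / 2))
        (fun i => f ⟨min i M, by omega⟩)) (by
      intro f v
      rw [glap_quad G (fun u v => oInd M m (fun k => oT t (k+1)) (fun k => oB (m+1) s t (k+1)) u v) hE]
      set f' : ℕ → ℝ := fun i => f ⟨min i M, by omega⟩ with hf'
      have ff : ∀ u : Fin (M+1), f u = f' u := by
        intro u
        simp only [hf']
        congr 1
        ext
        simp; omega
      have hw := weak hts H M v hM (by omega) h0 f' (by simp [hf'])
      have hs := oInd_sum M m (fun k => oT t (k+1)) (fun k => oB (m+1) s t (k+1))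
        (fun k hk => ⟨by have := hB k hk; have := hB1 k hk; omega, by have := hB1 k hk; omega⟩)
        (fun x y => (f' y - f' x) * (oX (m+1) s t a b W y v - oX (m+1) s t a b W x v))
      simp only [ff]
      rw [hs, hw]) u v
  rw [key]
  simp only [oX]
  rw [abs_sub_comm ((v:ℕ):ℝ) ((u:ℕ):ℝ)]
  simp only [sub_self, abs_zero]
  ring

end HelperC
section HelperD
open Finset

/-- the kernel -/
noncomputable def oK (M e f : ℕ) : ℝ := ((M:ℝ)+1) * (M - (max e f : ℕ)) - (M - e) * (M - f)

lemma oK_symm (M e f : ℕ) : oK M e f = oK M f e := by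
  unfold oK; rw [max_comm]; ring

lemma sumIco_id (p q : ℕ) (h : p ≤ q) :
    ∑ e ∈ Ico p q, (e:ℝ) = ((q:ℝ)*(q-1) - p*(p-1))/2 := by
  induction q, h using Nat.le_induction with
  | base => simp
  | succ q hq ih => rw [sum_Ico_succ_top hq, ih]; push_cast; ring

lemma sumIco_max (p q : ℕ) (h : p ≤ q) :
    ∑ e ∈ Ico p q, ∑ f ∈ Ico p q, ((max e f : ℕ):ℝ) =
      p * ((q:ℝ)-p)^2 + ((q:ℝ)-p)*((q:ℝ)-p-1)*(4*((q:ℝ)-p)+1)/6 := by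
  induction q, h using Nat.le_induction with
  | base => simp
  | succ q hq ih =>
    have e1 : ∀ e ∈ Ico p q, ∑ f ∈ Ico p (q+1), ((max e f : ℕ):ℝ) =
        ∑ f ∈ Ico p q, ((max e f : ℕ):ℝ) + q := by
      intro e he
      rw [sum_Ico_succ_top hq, max_eq_right (mem_Ico.1 he).2.le]
    have e2 : ∑ f ∈ Ico p (q+1), ((max q f : ℕ):ℝ) = ∑ f ∈ Ico p (q+1), (q:ℝ) :=
      sum_congr rfl fun f hf => by rw [max_eq_left (by have := (mem_Ico.1 hf).2; omega)]
    rw [sum_Ico_succ_top hq, sum_congr rfl e1, sum_add_distrib, ih, e2]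
    simp only [sum_const, Nat.card_Ico, nsmul_eq_mul]
    rw [Nat.cast_sub hq, Nat.cast_sub (by omega)]
    push_cast
    ring

/-- first moment -/
noncomputable def oE1 (p q : ℝ) : ℝ := (q*(q+1) - p*(p+1))/2
/-- second moment -/
noncomputable def oF1 (N p q : ℝ) : ℝ := (N-1)*(q-p) - (q*(q-1) - p*(p-1))/2
/-- diagonal moment -/
noncomputable def oD1 (N p q : ℝ) : ℝ :=
  N * ((N-1)*(q-p)^2 - (p * (q-p)^2 + (q-p)*(q-p-1)*(4*(q-p)+1)/6)) - (oF1 N p q)^2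

lemma sum_Fpart (M p q : ℕ) (h : p ≤ q) :
    ∑ f ∈ Ico p q, ((M:ℝ) - f) = oF1 (M+1) p q := by
  rw [sum_sub_distrib, sumIco_id p q h]
  simp only [sum_const, Nat.card_Ico, nsmul_eq_mul, oF1]
  rw [Nat.cast_sub h]; ring

lemma rect_off (M p q p' q' : ℕ) (h : p ≤ q) (h' : p' ≤ q') (hq : q ≤ p') :
    ∑ e ∈ Ico p q, ∑ f ∈ Ico p' q', oK M e f = oE1 p q * oF1 (M+1) p' q' := by
  have e1 : ∀ e ∈ Ico p q, ∀ f ∈ Ico p' q', oK M e f = ((e:ℝ)+1) * ((M:ℝ) - f) := by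
    intro e he f hf
    rw [mem_Ico] at he hf
    unfold oK
    rw [max_eq_right (by omega)]; ring
  rw [sum_congr rfl fun e he => sum_congr rfl (e1 e he), ← sum_mul_sum, sum_Fpart M p' q' h',
    sum_add_distrib, sumIco_id p q h]
  simp only [sum_const, Nat.card_Ico, nsmul_eq_mul, oE1]
  rw [Nat.cast_sub h]; ring

lemma rect_off2 (M p q p' q' : ℕ) (h : p ≤ q) (h' : p' ≤ q') (hq : q ≤ p') :
    ∑ e ∈ Ico p' q', ∑ f ∈ Ico p q, oK M e f = oE1 p q * oF1 (M+1) p' q' := by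
  rw [← rect_off M p q p' q' h h' hq, sum_comm]
  exact sum_congr rfl fun e _ => sum_congr rfl fun f _ => oK_symm _ _ _

lemma rect_diag (M p q : ℕ) (h : p ≤ q) :
    ∑ e ∈ Ico p q, ∑ f ∈ Ico p q, oK M e f = oD1 (M+1) p q := by
  have e1 : ∑ e ∈ Ico p q, ∑ f ∈ Ico p q, oK M e f =
      ((M:ℝ)+1) * (∑ e ∈ Ico p q, ∑ f ∈ Ico p q, (M:ℝ) -
        ∑ e ∈ Ico p q, ∑ f ∈ Ico p q, ((max e f : ℕ):ℝ)) -
      (∑ e ∈ Ico p q, ((M:ℝ) - e)) * (∑ f ∈ Ico p q, ((M:ℝ) - f)) := by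
    rw [sum_mul_sum, ← sum_sub_distrib, mul_sum, ← sum_sub_distrib]
    refine sum_congr rfl fun e _ => ?_
    rw [← sum_sub_distrib, mul_sum, ← sum_sub_distrib]
    rfl
  rw [e1, sumIco_max p q h, sum_Fpart M p q h]
  simp only [sum_const, Nat.card_Ico, nsmul_eq_mul, oD1]
  rw [Nat.cast_sub h]; ring

lemma sum_symm (n : ℕ) (S : ℕ → ℕ → ℝ) (hS : ∀ k l, S k l = S l k) :
    ∑ k ∈ range n, ∑ l ∈ range n, S k l = ∑ l ∈ range n, (S l l + 2 * ∑ k ∈ range l, S k l) := by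
  induction n with
  | zero => simp
  | succ n ih =>
    rw [sum_range_succ, sum_range_succ (fun l => S l l + 2 * ∑ k ∈ range l, S k l), ← ih]
    simp only [sum_range_succ _ n, sum_add_distrib]
    rw [sum_congr rfl fun l _ => hS n l]; ring

/-- real prefix lengths -/
noncomputable def oS (s : ℕ → ℕ) (k : ℕ) : ℝ := ∑ j ∈ range k, (s j : ℝ)
/-- the imbalance -/
noncomputable def oY (s t : ℕ → ℕ) (k : ℕ) : ℝ := oS s k - 1 - 2 * (oT t k : ℝ)

/-- off-diagonal coefficient -/
noncomputable def oGo (s t : ℕ → ℕ) (N : ℝ) (k l : ℕ) : ℝ :=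
  N * s l / 8 * (oS s (k+1)^2 + oY s t (k+1)^2 - oS s k^2 - oY s t k^2) +
    (oS s (k+1) * oY s t (k+1) - oS s k * oY s t k) *
      ((N - oS s (l+1)) * oY s t (l+1) - (N - oS s l) * oY s t l) / 4

/-- diagonal coefficient -/
noncomputable def oGd (s t : ℕ → ℕ) (N : ℝ) (l : ℕ) : ℝ :=
  N * (oS s (l+1) * (oY s t (l+1) - oY s t l)^2/4 + s l * oY s t l * (oY s t (l+1) - oY s t l) / 2
    + oS s l * (s l)^2/4 + (s l:ℝ)^3/12 + s l/6)
    - (oS s (l+1) * oY s t (l+1) - oS s l * oY s t l)^2/4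

variable {n : ℕ} {s t : ℕ → ℕ}

lemma oS_succ (k : ℕ) : oS s (k+1) = oS s k + s k := by simp [oS, sum_range_succ]

lemma oB_real {k : ℕ} (hk : k ≤ n) : (oB n s t k : ℝ) = oS s n - oS s k + oT t k := by
  unfold oB oS
  push_cast
  rw [← sum_range_add_sum_Ico (fun j => (s j : ℝ)) hk]; ring

lemma G_off (hts : ∀ k, t k ≤ s k) (M : ℕ) (hM : oB n s t 0 = M + 1) {k l : ℕ} (hkl : k < l)
    (hl : l < n) :
    (∑ e ∈ Ico (oT t k) (oT t (k+1)), (∑ f ∈ Ico (oT t l) (oT t (l+1)), oK M e f +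
        ∑ f ∈ Ico (oB n s t (l+1)) (oB n s t l), oK M e f) +
      ∑ e ∈ Ico (oB n s t (k+1)) (oB n s t k), (∑ f ∈ Ico (oT t l) (oT t (l+1)), oK M e f +
        ∑ f ∈ Ico (oB n s t (l+1)) (oB n s t l), oK M e f)) = oGo s t (M+1) k l := by
  have a1 := oT_mono (t := t) (Nat.le_succ k)
  have a2 := oT_mono (t := t) (Nat.le_succ l)
  have a3 := oT_mono (t := t) hkl
  have a4 := oB_anti (n := n) hts (Nat.le_succ k) (by omega)
  have a5 := oB_anti (n := n) hts (Nat.le_succ l) (by omega)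
  have a6 := oB_anti (n := n) hts (show k+1 ≤ l from hkl) (by omega)
  have a7 := oT_le_oB (n := n) (s := s) (t := t) (l+1)
  simp only [Nat.succ_eq_add_one] at *
  have hN : (M:ℝ) + 1 = oS s n := by
    have := oB_real (n := n) (s := s) (t := t) (Nat.zero_le n)
    rw [hM] at this
    simpa [oS, oT] using this
  rw [sum_add_distrib, sum_add_distrib, rect_off _ _ _ _ _ a1 a2 a3,
    rect_off _ _ _ _ _ a1 a5 (by omega), rect_off2 _ _ _ _ _ a2 a4 (by omega),
    rect_off2 _ _ _ _ _ a5 a4 (by omega), oB_real (by omega), oB_real (by omega),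
    oB_real (by omega), oB_real (by omega), hN]
  unfold oGo oY oE1 oF1
  simp only [oS_succ, oT_succ]
  push_cast
  ring

lemma G_diag (hts : ∀ k, t k ≤ s k) (M : ℕ) (hM : oB n s t 0 = M + 1) {l : ℕ}
    (hl : l < n) :
    (∑ e ∈ Ico (oT t l) (oT t (l+1)), (∑ f ∈ Ico (oT t l) (oT t (l+1)), oK M e f +
        ∑ f ∈ Ico (oB n s t (l+1)) (oB n s t l), oK M e f) +
      ∑ e ∈ Ico (oB n s t (l+1)) (oB n s t l), (∑ f ∈ Ico (oT t l) (oT t (l+1)), oK M e f +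
        ∑ f ∈ Ico (oB n s t (l+1)) (oB n s t l), oK M e f)) = oGd s t (M+1) l := by
  have a2 := oT_mono (t := t) (Nat.le_succ l)
  have a5 := oB_anti (n := n) hts (Nat.le_succ l) (by omega)
  have a7 := oT_le_oB (n := n) (s := s) (t := t) (l+1)
  simp only [Nat.succ_eq_add_one] at *
  have hN : (M:ℝ) + 1 = oS s n := by
    have := oB_real (n := n) (s := s) (t := t) (Nat.zero_le n)
    rw [hM] at this
    simpa [oS, oT] using this
  rw [sum_add_distrib, sum_add_distrib, rect_diag _ _ _ a2,
    rect_off _ _ _ _ _ a2 a5 (by omega), rect_off2 _ _ _ _ _ a2 a5 (by omega),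
    rect_diag _ _ _ a5, oB_real (by omega), oB_real (by omega), hN]
  unfold oGd oY oD1 oE1 oF1
  simp only [oS_succ, oT_succ]
  push_cast
  ring

lemma oP_symm (a b : ℕ → ℝ) (W : ℝ) (i j : ℕ) : oP a b W i j = oP a b W j i := by
  unfold oP; rw [min_comm, max_comm]

lemma phi_group (hts : ∀ k, t k ≤ s k) (a b : ℕ → ℝ) (W : ℝ) (M : ℕ) (hM : oB n s t 0 = M + 1) :
    ∑ e ∈ range (M+1), ∑ f ∈ range (M+1),
        oP a b W (oO n s t e) (oO n s t f) *
          (((M:ℝ)+1) * (M - (max e f : ℕ)) - (M - e) * (M - f)) =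
    ∑ l ∈ range n, (a l * b l / W * oGd s t (M+1) l +
      2 * ∑ k ∈ range l, a k * b l / W * oGo s t (M+1) k l) := by
  have e1 : ∑ e ∈ range (M+1), ∑ f ∈ range (M+1),
        oP a b W (oO n s t e) (oO n s t f) * oK M e f =
      ∑ k ∈ range n, ∑ l ∈ range n, oP a b W k l * 
    (∑ e ∈ Ico (oT t k) (oT t (k+1)), (∑ f ∈ Ico (oT t l) (oT t (l+1)), oK M e f +
        ∑ f ∈ Ico (oB n s t (l+1)) (oB n s t l), oK M e f) +
      ∑ e ∈ Ico (oB n s t (k+1)) (oB n s t k), (∑ f ∈ Ico (oT t l) (oT t (l+1)), oK M e f +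
        ∑ f ∈ Ico (oB n s t (l+1)) (oB n s t l), oK M e f)) := by
    rw [← hM, group0 hts (fun e k => ∑ f ∈ range (oB n s t 0),
      oP a b W k (oO n s t f) * oK M e f)]
    refine sum_congr rfl fun k _ => ?_
    have e2 : ∀ e, ∑ f ∈ range (oB n s t 0), oP a b W k (oO n s t f) * oK M e f =
      ∑ l ∈ range n, oP a b W k l * (∑ f ∈ Ico (oT t l) (oT t (l+1)), oK M e f +
        ∑ f ∈ Ico (oB n s t (l+1)) (oB n s t l), oK M e f) := by
      intro e
      rw [group0 hts (fun f l => oP a b W k l * oK M e f)]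
      refine sum_congr rfl fun l _ => ?_
      rw [mul_add, mul_sum, mul_sum]
    rw [sum_congr rfl fun e _ => e2 e, sum_congr rfl fun e _ => e2 e, sum_comm,
      sum_comm (s := Ico (oB n s t (k+1)) (oB n s t k)), ← sum_add_distrib]
    refine sum_congr rfl fun l _ => ?_
    rw [mul_add, mul_sum, mul_sum]
  have e3 := sum_symm n (fun k l => oP a b W k l * 
    (∑ e ∈ Ico (oT t k) (oT t (k+1)), (∑ f ∈ Ico (oT t l) (oT t (l+1)), oK M e f +
        ∑ f ∈ Ico (oB n s t (l+1)) (oB n s t l), oK M e f) +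
      ∑ e ∈ Ico (oB n s t (k+1)) (oB n s t k), (∑ f ∈ Ico (oT t l) (oT t (l+1)), oK M e f +
        ∑ f ∈ Ico (oB n s t (l+1)) (oB n s t l), oK M e f))) (by
    intro k l
    rw [oP_symm]
    congr 1
    simp only [sum_add_distrib]
    rw [sum_comm (s := Ico (oT t k) (oT t (k+1))), sum_comm (s := Ico (oT t k) (oT t (k+1))),
      sum_comm (s := Ico (oB n s t (k+1)) (oB n s t k)),
      sum_comm (s := Ico (oB n s t (k+1)) (oB n s t k))]
    simp only [oK_symm M _ _]
    ring)
  change ∑ e ∈ range (M+1), ∑ f ∈ range (M+1),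
        oP a b W (oO n s t e) (oO n s t f) * oK M e f = _
  rw [e1, e3]
  refine sum_congr rfl fun l hl => ?_
  have hl' : l < n := by simpa using hl
  rw [G_diag hts M hM hl']
  congr 1
  · simp [oP]
  · congr 1
    refine sum_congr rfl fun k hk => ?_
    have hk' : k < l := by simpa using hk
    rw [G_off hts M hM hk' hl']
    simp [oP, hk'.le]

end HelperD
section HelperE
open Finset

/-- the difference of imbalances -/
noncomputable def oDl (s t : ℕ → ℕ) (k : ℕ) : ℝ := (s k : ℝ) - 2 * t k
/-- left coefficient -/
noncomputable def oC (s : ℕ → ℕ) (a : ℕ → ℝ) (k : ℕ) : ℝ := a k * oS s k - oDel s a k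
/-- right coefficient -/
noncomputable def oC2 (n : ℕ) (s : ℕ → ℕ) (b : ℕ → ℝ) (k : ℕ) : ℝ :=
  b k * (oS s n - oS s (k+1)) - oGam n s b (k+1)
/-- partial sums -/
noncomputable def oFi (s t : ℕ → ℕ) (a : ℕ → ℝ) (k : ℕ) : ℝ :=
  ∑ j ∈ range k, oC s a j * oDl s t j
/-- partial sums -/
noncomputable def oV (s t : ℕ → ℕ) (a : ℕ → ℝ) (k : ℕ) : ℝ :=
  ∑ j ∈ range k, a j * (oS s (j+1)^2 + oY s t (j+1)^2 - oS s j^2 - oY s t j^2)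
/-- potential -/
noncomputable def oZ (n : ℕ) (s t : ℕ → ℕ) (a b : ℕ → ℝ) (W : ℝ) (l : ℕ) : ℝ :=
  oGam n s b l * oFi s t a l * oY s t l / 2 +
    ((oS s n - oS s l) * W + oGam n s b l * oDel s a l) * oY s t l ^ 2 / 4 -
    oS s n / 4 * oGam n s b l * oV s t a l
/-- constant part -/
noncomputable def oCst (n : ℕ) (s : ℕ → ℕ) (a b : ℕ → ℝ) (l : ℕ) : ℝ :=
  a l * b l * oS s n * (oS s l * (s l)^2/4 + (s l:ℝ)^3/12 + s l/6) +
    oS s n / 4 * a l * oGam n s b (l+1) * (oS s (l+1)^2 - oS s l^2)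

variable {n : ℕ} {s t : ℕ → ℕ} {a b : ℕ → ℝ} {W : ℝ}

lemma oY_succ (k : ℕ) : oY s t (k+1) = oY s t k + oDl s t k := by
  unfold oY oDl; rw [oS_succ, oT_succ]; push_cast; ring

lemma U_eq (l : ℕ) : ∑ k ∈ range l, a k * (oS s (k+1) * oY s t (k+1) - oS s k * oY s t k) =
    oDel s a l * oY s t l + oFi s t a l := by
  induction l with
  | zero => simp [oDel, oFi]
  | succ l ih =>
    rw [sum_range_succ, ih]
    have h1 : oFi s t a (l+1) = oFi s t a l + oC s a l * oDl s t l := by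
      simp [oFi, sum_range_succ]
    rw [h1, oDel_succ, oY_succ, oS_succ]
    unfold oC
    ring

lemma term_eq (H : OH n s a b W) {l : ℕ} (hl : l < n) :
    a l * b l * oGd s t (oS s n) l + 2 * ∑ k ∈ range l, a k * b l * oGo s t (oS s n) k l =
    oCst n s a b l + (oFi s t a l * oC2 n s b l * oDl s t l / 2 +
      oC s a l * oC2 n s b l * oDl s t l ^ 2 / 4) + (oZ n s t a b W (l+1) - oZ n s t a b W l) := by
  have e1 : ∑ k ∈ range l, a k * b l * oGo s t (oS s n) k l =
      oS s n * s l / 8 * b l * oV s t a l + b l * (oDel s a l * oY s t l + oFi s t a l) *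
      ((oS s n - oS s (l+1)) * oY s t (l+1) - (oS s n - oS s l) * oY s t l) / 4 := by
    rw [← U_eq, oV, mul_sum, mul_sum, sum_mul, sum_div, ← sum_add_distrib]
    refine sum_congr rfl fun k _ => ?_
    unfold oGo; ring
  rw [e1]
  have h1 : oFi s t a (l+1) = oFi s t a l + oC s a l * oDl s t l := by
    simp [oFi, sum_range_succ]
  have h2 : oV s t a (l+1) = oV s t a l +
      a l * (oS s (l+1)^2 + oY s t (l+1)^2 - oS s l^2 - oY s t l^2) := by
    simp [oV, sum_range_succ]
  have h3 := H.row l hl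
  have h4 : oGam n s b l = oGam n s b (l+1) + s l * b l := by
    unfold oGam; rw [sum_eq_sum_Ico_succ_bot hl]; ring
  unfold oZ oGd oCst oC2
  rw [h1, h2]
  unfold oC
  rw [h4] at h3 ⊢
  simp only [oDel_succ, oY_succ, oS_succ]
  linear_combination ((oS s n - oS s l - s l) * (oY s t l + oDl s t l)^2 -
    (oS s n - oS s l) * oY s t l ^2)/4 * h3

lemma phi_tel (H : OH n s a b W) :
    ∑ l ∈ range n, (a l * b l / W * oGd s t (oS s n) l +
      2 * ∑ k ∈ range l, a k * b l / W * oGo s t (oS s n) k l) =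
    (∑ l ∈ range n, oCst n s a b l - oS s n * W / 4 + 
      ∑ l ∈ range n, (oFi s t a l * oC2 n s b l * oDl s t l / 2 +
      oC s a l * oC2 n s b l * oDl s t l ^ 2 / 4)) / W := by
  have e1 : ∑ l ∈ range n, (a l * b l / W * oGd s t (oS s n) l +
      2 * ∑ k ∈ range l, a k * b l / W * oGo s t (oS s n) k l) =
      (∑ l ∈ range n, (a l * b l * oGd s t (oS s n) l +
        2 * ∑ k ∈ range l, a k * b l * oGo s t (oS s n) k l)) / W := by
    rw [sum_div]
    refine sum_congr rfl fun l _ => ?_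
    rw [add_div, mul_div_assoc 2, sum_div]
    congr 1
    · ring
    · congr 1
      exact sum_congr rfl fun k _ => by ring
  rw [e1, sum_congr rfl fun l hl => term_eq H (by simpa using hl), sum_add_distrib,
    sum_add_distrib, sum_range_sub]
  have z0 : oZ n s t a b W 0 = oS s n * W / 4 := by
    simp [oZ, oFi, oDel, oV, oY, oS, oT]
  have zn : oZ n s t a b W n = 0 := by
    simp [oZ, oGam]
  rw [z0, zn]
  ring

lemma phi_final (hts : ∀ k, t k ≤ s k) (H : OH n s a b W) (M : ℕ) (hM : oB n s t 0 = M + 1) :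
    ∑ e ∈ range (M+1), ∑ f ∈ range (M+1),
        oP a b W (oO n s t e) (oO n s t f) *
          (((M:ℝ)+1) * (M - (max e f : ℕ)) - (M - e) * (M - f)) =
    (∑ l ∈ range n, oCst n s a b l - oS s n * W / 4 + 
      ∑ l ∈ range n, (oFi s t a l * oC2 n s b l * oDl s t l / 2 +
      oC s a l * oC2 n s b l * oDl s t l ^ 2 / 4)) / W := by
  have hN : (M:ℝ) + 1 = oS s n := by
    have := oB_real (n := n) (s := s) (t := t) (Nat.zero_le n)
    rw [hM] at this
    simpa [oS, oT] using this
  rw [phi_group hts a b W M hM, ← phi_tel H, hN]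

end HelperE
section HelperF
open Finset

/-- the quadratic form -/
noncomputable def oQ (n : ℕ) (c c2 D : ℕ → ℝ) : ℝ :=
  ∑ l ∈ range n, ((∑ j ∈ range l, c j * D j) * c2 l * D l / 2 + c l * c2 l * D l ^ 2 / 4)

lemma oQ_eq (n : ℕ) (c c2 D : ℕ → ℝ) : oQ n c c2 D =
    ∑ l ∈ range n, (∑ j ∈ range l, c j * c2 l / 2 * (D j * D l) + c l * c2 l / 4 * (D l * D l)) := by
  unfold oQ
  refine sum_congr rfl fun l _ => ?_
  rw [sum_mul, sum_mul, sum_div]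
  congr 1
  · exact sum_congr rfl fun j _ => by ring
  · ring

lemma oQ_congr (m : ℕ) (c c2 D D' : ℕ → ℝ) (hc0 : c 0 = 0) (hcm : c2 m = 0)
    (h : ∀ i j, 1 ≤ i → i < m → 1 ≤ j → j < m → D i * D j = D' i * D' j) :
    oQ (m+1) c c2 D = oQ (m+1) c c2 D' := by
  have key : ∀ j l, j < m + 1 → l < m + 1 → j ≤ l →
      c j * c2 l * (D j * D l) = c j * c2 l * (D' j * D' l) := by
    intro j l hj hl hjl
    rcases Nat.eq_zero_or_pos j with h0 | h0
    · rw [h0, hc0]; simp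
    rcases Nat.lt_or_ge l m with h1 | h1
    · rw [h j l h0 (by omega) (by omega) h1]
    · rw [show l = m by omega, hcm]; simp
  rw [oQ_eq, oQ_eq]
  refine sum_congr rfl fun l hl => ?_
  have hl' := mem_range.1 hl
  congr 1
  · refine sum_congr rfl fun j hj => ?_
    have hj' := mem_range.1 hj
    have := key j l (by omega) hl' hj'.le
    linarith
  · have := key l l hl' hl' le_rfl
    linarith

lemma oQ_lt (m : ℕ) (c c2 D D' : ℕ → ℝ) (hc0 : c 0 = 0) (hcm : c2 m = 0)
    (hc : ∀ l, 1 ≤ l → l ≤ m → 0 < c l) (hc2 : ∀ l, l < m → 0 < c2 l)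
    (h : ∀ i j, 1 ≤ i → i < m → 1 ≤ j → j < m → D i * D j ≤ D' i * D' j)
    (hs : ∃ i j, 1 ≤ i ∧ i < m ∧ 1 ≤ j ∧ j < m ∧ i ≤ j ∧ D i * D j < D' i * D' j) :
    oQ (m+1) c c2 D < oQ (m+1) c c2 D' := by
  have key : ∀ j l, j < m + 1 → l < m + 1 → j ≤ l →
      c j * c2 l * (D j * D l) ≤ c j * c2 l * (D' j * D' l) := by
    intro j l hj hl hjl
    rcases Nat.eq_zero_or_pos j with h0 | h0
    · rw [h0, hc0]; simp
    rcases Nat.lt_or_ge l m with h1 | h1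
    · exact mul_le_mul_of_nonneg_left (h j l h0 (by omega) (by omega) h1)
        (mul_pos (hc j h0 (by omega)) (hc2 l h1)).le
    · rw [show l = m by omega, hcm]; simp
  have off : ∀ l, l < m + 1 → ∑ j ∈ range l, c j * c2 l / 2 * (D j * D l) ≤
      ∑ j ∈ range l, c j * c2 l / 2 * (D' j * D' l) := by
    intro l hl
    refine sum_le_sum fun j hj => ?_
    have hj' := mem_range.1 hj
    have := key j l (by omega) hl hj'.le
    linarith
  have dia : ∀ l, l < m + 1 → c l * c2 l / 4 * (D l * D l) ≤ c l * c2 l / 4 * (D' l * D' l) := by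
    intro l hl
    have := key l l hl hl le_rfl
    linarith
  rw [oQ_eq, oQ_eq]
  obtain ⟨i, l, hi, hi', hl, hl', hil, hlt⟩ := hs
  have hlt2 := mul_lt_mul_of_pos_left hlt (mul_pos (hc i hi hi'.le) (hc2 l hl'))
  refine sum_lt_sum (fun l hl => add_le_add (off l (mem_range.1 hl)) (dia l (mem_range.1 hl)))
    ⟨l, mem_range.2 (by omega), ?_⟩
  rcases Nat.lt_or_ge i l with h1 | h1
  · refine add_lt_add_of_lt_of_le (sum_lt_sum (fun j hj => ?_) ⟨i, mem_range.2 h1, ?_⟩)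
      (dia l (by omega))
    · have hj' := mem_range.1 hj
      have := key j l (by omega) (by omega) hj'.le
      linarith
    · linarith
  · have : i = l := by omega
    subst this
    refine add_lt_add_of_le_of_lt (off i (by omega)) ?_
    linarith

/-- the basic recurrence -/
noncomputable def oA : ℕ → ℝ
  | 0 => 0
  | 1 => 1
  | (k+2) => 8 * oA (k+1) - oA k

lemma oA_rec (k : ℕ) : oA (k+2) = 8 * oA (k+1) - oA k := by rw [oA]

lemma oA_lt (k : ℕ) : 0 ≤ oA k ∧ oA k < oA (k+1) := by
  induction k with
  | zero => simp [oA]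
  | succ k ih =>
    refine ⟨by linarith [ih.1, ih.2], ?_⟩
    rw [oA]; linarith [ih.1, ih.2]

lemma oA_mono : StrictMono oA := strictMono_nat_of_lt_succ fun k => (oA_lt k).2

lemma oA_pos (k : ℕ) : 0 < oA (k+1) := lt_of_le_of_lt (oA_lt k).1 (oA_lt k).2

lemma oA_add (p q : ℕ) : oA (p+1) * oA (q+1) - oA p * oA q = oA (p+q+1) := by
  induction p using Nat.twoStepInduction with
  | zero => simp [oA]
  | one =>
    have h2 : oA (1+1) = 8 := by norm_num [oA]
    have h1 : oA 1 = 1 := by norm_num [oA]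
    rw [h2, h1, show 1 + q + 1 = q + 2 by ring, oA]; ring
  | more p ih1 ih2 =>
    have r1 := oA_rec (p+q+1)
    have r2 := oA_rec (p+1)
    have r3 := oA_rec p
    rw [show p + q + 1 + 1 = p + 1 + q + 1 by ring] at r1
    rw [show p + 2 + q + 1 = (p + q + 1) + 2 by ring, r1, ← ih1, ← ih2,
      show p + 2 + 1 = (p+1) + 2 by ring, r2, r3]
    ring

/-- sizes -/
def sv (m k : ℕ) : ℕ := if 1 ≤ k ∧ k < m then 6 else 7
/-- top sizes -/
def tv (m : ℕ) (v : ℕ → ℕ) (k : ℕ) : ℕ := if k = 0 then 1 else if k < m then v (k-1) + 1 else 7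
/-- left sequence -/
noncomputable def av (k : ℕ) : ℝ := oA (k+1)
/-- right sequence -/
noncomputable def bv (m k : ℕ) : ℝ := oA (m + 1 - k)

variable {m : ℕ} {v : ℕ → ℕ}

lemma av_succ (k : ℕ) : av (k+2) = 8 * av (k+1) - av k := by
  unfold av; rw [show k + 2 + 1 = (k+1) + 2 by ring, oA]

lemma del_v (k : ℕ) (hk : k < m) : oDel (sv m) av (k+1) = av (k+1) - av k := by
  induction k with
  | zero => simp [oDel, sv, av, oA]; norm_num
  | succ k ih =>
    rw [oDel_succ, ih (by omega), av_succ]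
    simp only [sv]
    rw [if_pos (by omega)]
    push_cast; ring

lemma gam_v (d : ℕ) (hd : d < m) : oGam (m+1) (sv m) (bv m) (m-d) = oA (d+2) - oA (d+1) := by
  induction d with
  | zero =>
    simp [oGam, sv, bv, oA]; norm_num
  | succ d ih =>
    have ih' := ih (by omega)
    have : oGam (m+1) (sv m) (bv m) (m-(d+1)) = sv m (m-(d+1)) * bv m (m-(d+1)) +
        oGam (m+1) (sv m) (bv m) (m-d) := by
      unfold oGam
      rw [sum_eq_sum_Ico_succ_bot (by omega), show m - (d+1) + 1 = m - d by omega]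
    rw [this, ih', sv, if_pos (by omega), bv, show m + 1 - (m - (d+1)) = d + 2 by omega,
      oA_rec (d+1), show d + 1 + 1 = d + 2 by ring]
    push_cast; ring

lemma OH_v (hm : 2 ≤ m) : OH (m+1) (sv m) av (bv m) (oA (m+2)) := by
  refine ⟨(oA_pos _).ne', ?_, fun k hk => del_v k (by omega), ?_⟩
  · intro k hk
    rcases Nat.eq_zero_or_pos k with h0 | h0
    · subst h0
      have h1 : oGam (m+1) (sv m) (bv m) 0 = sv m 0 * bv m 0 + oGam (m+1) (sv m) (bv m) 1 := by
        unfold oGam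
        rw [sum_eq_sum_Ico_succ_bot (by omega)]
      have h2 := gam_v (m := m) (m-1) (by omega)
      rw [show m - (m-1) = 1 by omega, show m - 1 + 2 = m + 1 by omega,
        show m - 1 + 1 = m by omega] at h2
      rw [h1, h2, oA]
      simp [oDel, sv, bv, av, oA]; ring
    · obtain ⟨i, rfl⟩ : ∃ i, k = i + 1 := ⟨k-1, by omega⟩
      obtain ⟨d, rfl⟩ : ∃ d, m = d + i + 1 := ⟨m - i - 1, by omega⟩
      have h2 := gam_v (m := d+i+1) d (by omega)
      rw [show d + i + 1 - d = i + 1 by omega] at h2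
      rw [h2, del_v i (by omega)]
      unfold av bv
      rw [show d + i + 1 + 1 - (i+1) = d + 1 by omega]
      have := oA_add (i+1) (d+1)
      rw [show i + 1 + (d+1) + 1 = d + i + 1 + 2 by ring] at this
      rw [← this]; ring
  · intro k hk
    obtain ⟨d, rfl⟩ : ∃ d, m = d + k + 1 := ⟨m - k - 1, by omega⟩
    have h2 := gam_v (m := d+k+1) d (by omega)
    rw [show d + k + 1 - d = k + 1 by omega] at h2
    rw [h2]
    unfold bv
    rw [show d + k + 1 + 1 - (k+1) = d + 1 by omega, show d + k + 1 + 1 - k = d + 2 by omega]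

lemma sv_pos (k : ℕ) : (0:ℝ) < sv m k := by unfold sv; split_ifs <;> norm_num

lemma c_zero : oC (sv m) av 0 = 0 := by simp [oC, oS, oDel]

lemma c_pos (l : ℕ) (hl : 1 ≤ l) : 0 < oC (sv m) av l := by
  have : oC (sv m) av l = ∑ j ∈ range l, sv m j * (av l - av j) := by
    unfold oC oS oDel
    rw [mul_sum, ← sum_sub_distrib]
    exact sum_congr rfl fun j _ => by ring
  rw [this]
  refine sum_pos (fun j hj => mul_pos (sv_pos j) (sub_pos.2 ?_)) ⟨0, mem_range.2 hl⟩
  exact oA_mono (by have := mem_range.1 hj; omega)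

lemma c2_zero : oC2 (m+1) (sv m) (bv m) m = 0 := by simp [oC2, oGam]

lemma c2_pos (l : ℕ) (hl : l < m) : 0 < oC2 (m+1) (sv m) (bv m) l := by
  have : oC2 (m+1) (sv m) (bv m) l = ∑ j ∈ Ico (l+1) (m+1), sv m j * (bv m l - bv m j) := by
    unfold oC2 oS oGam
    rw [← sum_range_add_sum_Ico (fun j => (sv m j : ℝ)) (show l + 1 ≤ m + 1 by omega),
      add_sub_cancel_left, mul_sum, ← sum_sub_distrib]
    exact sum_congr rfl fun j _ => by ring
  rw [this]
  refine sum_pos (fun j hj => mul_pos (sv_pos j) (sub_pos.2 ?_)) ⟨m, by simp; omega⟩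
  have := mem_Ico.1 hj
  exact oA_mono (by omega)

lemma T_v (k : ℕ) (hk : k < m) : oT (tv m v) (k+1) = k + 1 + ∑ j ∈ range k, v j := by
  induction k with
  | zero => simp [oT, tv]
  | succ k ih =>
    rw [oT_succ, ih (by omega), sum_range_succ, tv, if_neg (by omega), if_pos (by omega)]
    simp only [Nat.add_sub_cancel]
    omega

lemma S_v (k : ℕ) (hk : k < m) : ∑ j ∈ Ico (k+1) (m+1), sv m j = 6 * (m - 1 - k) + 7 := by
  rw [sum_Ico_succ_top (by omega)]
  have : ∀ j ∈ Ico (k+1) m, sv m j = 6 := by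
    intro j hj
    have := mem_Ico.1 hj
    rw [sv, if_pos (by omega)]
  rw [sum_congr rfl this]
  simp [sv]; omega

lemma B_v (k : ℕ) (hk : k < m) :
    oB (m+1) (sv m) (tv m v) (k+1) = 6 * m + 2 - 5 * k + ∑ j ∈ range k, v j := by
  unfold oB
  rw [T_v k hk, S_v k hk]; omega

lemma B0_v (hm : 2 ≤ m) : oB (m+1) (sv m) (tv m v) 0 = 6 * (m+1) + 1 + 1 := by
  unfold oB
  rw [sum_eq_sum_Ico_succ_bot (by omega), S_v 0 (by omega)]
  simp [oT, sv]; omega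

lemma tpos_v (w : Fin (m + 1 - 2) → Fin 5) (hv : ∀ j (h : j < m + 1 - 2), v j = (w ⟨j, h⟩ : ℕ))
    (k : ℕ) (hk : k < m) : tpos (m+1) w (k+1) = oT (tv m v) (k+1) := by
  rw [T_v k hk, tpos]
  congr 1
  rw [sum_filter]
  have e : ∀ j : Fin (m+1-2), (if (j:ℕ) + 1 < k + 1 then ((w j : ℕ)) else 0) =
      (fun j : ℕ => if j < k then v j else 0) j := by
    intro j
    simp only [hv j j.2, add_lt_add_iff_right]
  rw [sum_congr rfl fun j _ => e j, Fin.sum_univ_eq_sum_range (fun j : ℕ => if j < k then v j else 0),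
    ← sum_filter]
  congr 1
  ext j; simp; omega

lemma bpos_v (w : Fin (m + 1 - 2) → Fin 5) (hv : ∀ j (h : j < m + 1 - 2), v j = (w ⟨j, h⟩ : ℕ))
    (k : ℕ) (hk : k < m) : bpos (m+1) w (k+1) = oB (m+1) (sv m) (tv m v) (k+1) := by
  rw [B_v k hk, bpos]
  rw [sum_filter]
  have e : ∀ j : Fin (m+1-2), (if k + 1 ≤ (j:ℕ) + 1 then (5 - (w j : ℕ)) else 0) =
      (fun j : ℕ => if k ≤ j then 5 - v j else 0) j := by
    intro j
    simp only [hv j j.2, add_le_add_iff_right]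
  have e' : ∀ j : Fin (m+1-2), (w j : ℕ) = v j := by
    intro j
    simp only [hv j j.2]
  rw [sum_congr rfl fun j _ => e j, Fin.sum_univ_eq_sum_range (fun j : ℕ => if k ≤ j then 5 - v j else 0),
    ← sum_filter, sum_congr rfl fun j _ => e' j, Fin.sum_univ_eq_sum_range v]
  have f : (range (m+1-2)).filter (fun j => k ≤ j) = Ico k (m+1-2) := by
    ext j; simp; omega
  rw [f, ← sum_range_add_sum_Ico _ (show k ≤ m + 1 - 2 by omega)]
  have g : ∑ j ∈ Ico k (m+1-2), v j + ∑ j ∈ Ico k (m+1-2), (5 - v j) = 5 * (m + 1 - 2 - k) := by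
    rw [← sum_add_distrib]
    have : ∀ j ∈ Ico k (m+1-2), v j + (5 - v j) = 5 := by
      intro j hj
      have := mem_Ico.1 hj
      have h1 := hv j (by omega)
      have h2 := (w ⟨j, by omega⟩).2
      omega
    rw [sum_congr rfl this]; simp; omega
  omega

end HelperF
section HelperG
open Finset

/-- extension of the vector -/
def wv {N : ℕ} (w : Fin N → Fin 5) (j : ℕ) : ℕ := if h : j < N then (w ⟨j, h⟩ : ℕ) else 0

lemma wv_le {N : ℕ} (w : Fin N → Fin 5) (j : ℕ) : wv w j ≤ 4 := by
  unfold wv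
  split_ifs with h
  · have := (w ⟨j, h⟩).2; omega
  · omega

lemma kf_oct (m : ℕ) (hm : 2 ≤ m) : ∃ K : ℝ, ∀ w : Fin (m + 1 - 2) → Fin 5,
    kirchhoff (octChain (m+1) w) = K - oQ (m+1) (oC (sv m) av) (oC2 (m+1) (sv m) (bv m))
      (oDl (sv m) (tv m (wv w))) / oA (m+2) := by
  refine ⟨(∑ u ∈ range (6*(m+1)+1+1), ∑ v ∈ range (6*(m+1)+1+1), |(u:ℝ) - v|) / 2 -
    (∑ l ∈ range (m+1), oCst (m+1) (sv m) av (bv m) l - oS (sv m) (m+1) * oA (m+2) / 4) / oA (m+2),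
    fun w => ?_⟩
  have hv : ∀ j (h : j < m + 1 - 2), wv w j = (w ⟨j, h⟩ : ℕ) := by
    intro j h; unfold wv; rw [dif_pos h]
  have hts : ∀ k, tv m (wv w) k ≤ sv m k := by
    intro k
    have := wv_le w (k-1)
    unfold tv sv
    split_ifs <;> omega
  have hB0 := B0_v (v := wv w) hm
  have hB1 := B_v (v := wv w) 0 (show 0 < m by omega)
  simp only [range_zero, sum_empty] at hB1
  have hk := kf_chain hts (OH_v hm) (6*(m+1)+1) (by omega) hB0
    (oO_eq hts (by omega) (Or.inr ⟨by rw [hB1]; omega, by rw [hB0]; omega⟩))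
    (by intro k; unfold tv; split_ifs <;> omega)
    (by intro k hk; unfold oB; rw [S_v k hk]; omega)
    (by
      intro k hk
      have := oB_anti (n := m+1) hts (show 0 + 1 ≤ k + 1 by omega) (by omega)
      omega)
    (octChain (m+1) w)
    (by
      intro u v
      have e : ∀ x y : ℕ, (∃ k, 1 ≤ k ∧ k ≤ m + 1 - 1 ∧ x = tpos (m+1) w k ∧ y = bpos (m+1) w k) ↔
          ∃ k, k < m ∧ x = oT (tv m (wv w)) (k+1) ∧ y = oB (m+1) (sv m) (tv m (wv w)) (k+1) := by
        intro x y
        constructor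
        · rintro ⟨k, h1, h2, h3, h4⟩
          obtain ⟨i, rfl⟩ : ∃ i, k = i + 1 := ⟨k-1, by omega⟩
          exact ⟨i, by omega, by rw [h3, tpos_v w hv i (by omega)],
            by rw [h4, bpos_v w hv i (by omega)]⟩
        · rintro ⟨i, h1, h3, h4⟩
          exact ⟨i+1, by omega, by omega, by rw [h3, tpos_v w hv i (by omega)],
            by rw [h4, bpos_v w hv i (by omega)]⟩
      unfold octChain
      rw [SimpleGraph.fromRel_adj, e, e])
  refine hk.trans ?_
  rw [phi_final hts (OH_v hm) _ hB0]
  have : ∑ l ∈ range (m+1), (oFi (sv m) (tv m (wv w)) av l * oC2 (m+1) (sv m) (bv m) l *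
      oDl (sv m) (tv m (wv w)) l / 2 +
      oC (sv m) av l * oC2 (m+1) (sv m) (bv m) l * oDl (sv m) (tv m (wv w)) l ^ 2 / 4) =
    oQ (m+1) (oC (sv m) av) (oC2 (m+1) (sv m) (bv m)) (oDl (sv m) (tv m (wv w))) := rfl
  rw [this]
  ring

lemma dl_mid {m : ℕ} (v : ℕ → ℕ) (k : ℕ) (h1 : 1 ≤ k) (h2 : k < m) :
    oDl (sv m) (tv m v) k = 4 - 2 * (v (k-1) : ℝ) := by
  unfold oDl sv tv
  rw [if_pos ⟨h1, h2⟩, if_neg (by omega), if_pos h2]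
  push_cast; ring

lemma prod_le (x y : ℝ) (h1 : -4 ≤ x) (h2 : x ≤ 4) (h3 : -4 ≤ y) (h4 : y ≤ 4) : x * y ≤ 16 := by
  nlinarith [mul_nonneg (sub_nonneg.2 h1) (sub_nonneg.2 h4),
    mul_nonneg (sub_nonneg.2 h2) (sub_nonneg.2 h3)]

lemma prod_lt (x y : ℝ) (h1 : -4 ≤ x) (h2 : x < 4) (h3 : -4 < y) (h4 : y ≤ 4) : x * y < 16 := by
  rcases le_or_gt y 0 with h | h
  · nlinarith [mul_nonneg (sub_nonneg.2 h1) (neg_nonneg.2 h)]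
  · nlinarith [mul_pos (sub_pos.2 h2) h]

lemma main_aux (m : ℕ) (hm : 2 ≤ m) :
    (∀ w : Fin (m + 1 - 2) → Fin 5, w ≠ (fun _ => (0 : Fin 5)) → w ≠ (fun _ => (4 : Fin 5)) →
      kirchhoff (octChain (m+1) w) > kirchhoff (octChain (m+1) fun _ => (0 : Fin 5))) ∧
    kirchhoff (octChain (m+1) fun _ => (4 : Fin 5)) =
      kirchhoff (octChain (m+1) fun _ => (0 : Fin 5)) := by
  obtain ⟨K, hK⟩ := kf_oct m hm
  have d0 : ∀ k, 1 ≤ k → k < m →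
      oDl (sv m) (tv m (wv (fun _ : Fin (m+1-2) => (0 : Fin 5)))) k = 4 := by
    intro k h1 h2
    rw [dl_mid _ k h1 h2]; simp [wv]
  have d4 : ∀ k, 1 ≤ k → k < m →
      oDl (sv m) (tv m (wv (fun _ : Fin (m+1-2) => (4 : Fin 5)))) k = -4 := by
    intro k h1 h2
    rw [dl_mid _ k h1 h2]
    have : wv (fun _ : Fin (m+1-2) => (4 : Fin 5)) (k-1) = 4 := by
      unfold wv; rw [dif_pos (by omega)]; rfl
    rw [this]; norm_num
  constructor
  · intro w hw0 hw4
    rw [gt_iff_lt, hK, hK]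
    have b : ∀ k, 1 ≤ k → k < m → -4 ≤ oDl (sv m) (tv m (wv w)) k ∧
        oDl (sv m) (tv m (wv w)) k ≤ 4 := by
      intro k h1 h2
      rw [dl_mid _ k h1 h2]
      have : (wv w (k-1) : ℝ) ≤ 4 := by exact_mod_cast wv_le w (k-1)
      have : (0:ℝ) ≤ wv w (k-1) := Nat.cast_nonneg _
      constructor <;> linarith
    obtain ⟨i, hi⟩ := Function.ne_iff.1 hw0
    obtain ⟨j, hj⟩ := Function.ne_iff.1 hw4
    have hi2 : oDl (sv m) (tv m (wv w)) (i+1) < 4 := by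
      rw [dl_mid _ _ (by omega) (by omega)]
      have : 1 ≤ wv w (i + 1 - 1) := by
        unfold wv
        rw [Nat.add_sub_cancel, dif_pos i.2]
        have : (w i : ℕ) ≠ 0 := fun h => hi (Fin.ext h)
        simp only [Fin.eta]; omega
      have : (1:ℝ) ≤ wv w (i + 1 - 1) := by exact_mod_cast this
      linarith
    have hj2 : -4 < oDl (sv m) (tv m (wv w)) (j+1) := by
      rw [dl_mid _ _ (by omega) (by omega)]
      have : wv w (j + 1 - 1) ≤ 3 := by
        unfold wv
        rw [Nat.add_sub_cancel, dif_pos j.2]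
        have : (w j : ℕ) ≠ 4 := fun h => hj (Fin.ext h)
        have := (w j).2
        simp only [Fin.eta]; omega
      have : (wv w (j + 1 - 1) : ℝ) ≤ 3 := by exact_mod_cast this
      linarith
    have hlt := prod_lt _ _ (b (i+1) (by omega) (by omega)).1 hi2 hj2
      (b (j+1) (by omega) (by omega)).2
    have hQ := oQ_lt m (oC (sv m) av) (oC2 (m+1) (sv m) (bv m)) (oDl (sv m) (tv m (wv w)))
      (oDl (sv m) (tv m (wv (fun _ : Fin (m+1-2) => (0 : Fin 5))))) c_zero c2_zero
      (fun l h _ => c_pos l h) c2_pos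
      (by
        intro k l h1 h2 h3 h4
        rw [d0 k h1 h2, d0 l h3 h4]
        have := prod_le _ _ (b k h1 h2).1 (b k h1 h2).2 (b l h3 h4).1 (b l h3 h4).2
        linarith)
      (by
        rcases le_total (i:ℕ) j with h | h
        · refine ⟨i+1, j+1, by omega, by omega, by omega, by omega, by omega, ?_⟩
          rw [d0 _ (by omega) (by omega), d0 _ (by omega) (by omega)]; linarith
        · refine ⟨j+1, i+1, by omega, by omega, by omega, by omega, by omega, ?_⟩
          rw [d0 _ (by omega) (by omega), d0 _ (by omega) (by omega)]; linarith)
    have := div_lt_div_of_pos_right hQ (oA_pos (m+1))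
    linarith
  · rw [hK, hK]
    rw [oQ_congr m _ _ _ (oDl (sv m) (tv m (wv (fun _ : Fin (m+1-2) => (0 : Fin 5)))))
      c_zero c2_zero]
    intro k l h1 h2 h3 h4
    rw [d0 k h1 h2, d0 l h3 h4, d4 k h1 h2, d4 l h3 h4]; norm_num

end HelperG

/-- Theorem 2 of the paper. Among all octagonal chains with `n ≥ 3`
octagons, the helicene octagonal chain `D_n = O(0,0,…,0)` is the unique chain (up to
isomorphism) with minimum Kirchhoff index: for every `w` other than `(0,…,0)` and
`(4,…,4)` one has `Kf(O(w)) > Kf(D_n)`, and `Kf(O(4,…,4)) = Kf(D_n)`. -/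
theorem helicene_chain_unique_min_kirchhoff (n : ℕ) (hn : 3 ≤ n) :
    (∀ w : Fin (n - 2) → Fin 5, w ≠ (fun _ => (0 : Fin 5)) → w ≠ (fun _ => (4 : Fin 5)) →
      kirchhoff (octChain n w) > kirchhoff (octChain n fun _ => (0 : Fin 5))) ∧
    kirchhoff (octChain n fun _ => (4 : Fin 5)) =
      kirchhoff (octChain n fun _ => (0 : Fin 5)) := by
  obtain ⟨m, rfl⟩ : ∃ m, n = m + 1 := ⟨n - 1, by omega⟩
  exact main_aux m (by omega)
end
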